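/- Let (R, m) be an analytically unramified Cohen-Macaulay local ring of dimension d > 0 with infinite residue field, I an m-primary ideal, J a minimal reduction. If S̄ ≠ 0 then depth Ḡ ≥ depth S̄ − 1, where depths are taken with respect to the maximal homogeneous ideal. -/

import Mathlib

set_option synthInstance.maxHeartbeats 1000000
set_option maxHeartbeats 2000000

open IsLocalRing Polynomial Finset

variable {R : Type*}

/-- `x` is integral over the ideal `I`: it satisfies an equation
`x^n + a₁ x^{n-1} + ⋯ + aₙ = 0` with `aᵢ ∈ Iⁱ`. -/
def IsIntegralOverIdeal [CommRing R] (I : Ideal R) (x : R) : Prop :=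
  ∃ n : ℕ, 0 < n ∧ ∃ a : ℕ → R, (∀ i ∈ Finset.Icc 1 n, a i ∈ I ^ i) ∧
    x ^ n + ∑ i ∈ Finset.Icc 1 n, a i * x ^ (n - i) = 0

/-- The integral closure of an ideal (the set of integral elements is an ideal,
so the span equals it). -/
def intCl [CommRing R] (I : Ideal R) : Ideal R :=
  Ideal.span {x | IsIntegralOverIdeal I x}

/-- Length of a module, as the Krull dimension of its lattice of submodules. -/
noncomputable def mlen (R M : Type*) [CommRing R] [AddCommGroup M] [Module R M] :
    WithBot ℕ∞ :=
  Order.krullDim (Submodule R M)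

/-- The quotient module `N/(K ∩ N)` for ideals `N K`. -/
abbrev idealQuot [CommRing R] (N K : Ideal R) :=
  N ⧸ (Submodule.comap N.subtype K)

/-- Depth of `M` with respect to the ideal `J`: sup of lengths of `M`-regular
sequences contained in `J`. -/
noncomputable def rdepth (A : Type*) [CommRing A] (J : Ideal A)
    (M : Type*) [AddCommGroup M] [Module A M] : ℕ∞ :=
  sSup {n : ℕ∞ | ∃ rs : List A, (rs.length : ℕ∞) = n ∧ (∀ x ∈ rs, x ∈ J) ∧
    RingTheory.Sequence.IsRegular M rs}

/-- A local ring is Cohen-Macaulay if its depth equals its Krull dimension. -/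
def IsCMLocal (R : Type*) [CommRing R] [IsLocalRing R] : Prop :=
  (rdepth R (maximalIdeal R) R : WithBot ℕ∞) = ringKrullDim R

/-- A local ring is analytically unramified if its `m`-adic completion is reduced. -/
def AnalyticallyUnramified (R : Type*) [CommRing R] [IsLocalRing R] : Prop :=
  IsReduced (AdicCompletion (maximalIdeal R) R)

/-- An ideal is `m`-primary. -/
def IsMPrimary [CommRing R] [IsLocalRing R] (I : Ideal R) : Prop :=
  I.radical = maximalIdeal R

/-- `J ⊆ I` is a minimal reduction: generated by `d = dim R` elements and
`I^{n+1} = J I^n` for `n ≫ 0`. -/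
def IsMinimalReduction [CommRing R] (d : ℕ) (J I : Ideal R) : Prop :=
  J ≤ I ∧ (∃ s : Fin d → R, J = Ideal.span (Set.range s)) ∧
    ∃ N : ℕ, ∀ n ≥ N, I ^ (n + 1) = J * I ^ n

/-- Normal Hilbert data: `L n = λ(R/ intCl(I^{n+1}))` and for `n ≫ 0` this agrees
with the polynomial whose normalized coefficients are the `e i`. -/
def NormalHilbertData [CommRing R] (d : ℕ) (I : Ideal R) (L : ℕ → ℕ) (e : ℕ → ℤ) : Prop :=
  (∀ n, mlen R (R ⧸ intCl (I ^ (n + 1))) = (L n : WithBot ℕ∞)) ∧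
    ∃ N : ℕ, ∀ n ≥ N, (L n : ℤ) =
      ∑ i ∈ Finset.range (d + 1), (-1 : ℤ) ^ i * e i * ((n + d - i).choose (d - i))

/-- `t` is the Cohen-Macaulay type of the local ring `R` of dimension `d`:
`t = λ((Q : m)/Q)` for every ideal `Q` generated by a maximal regular sequence in `m`. -/
def CMTypeData (R : Type*) [CommRing R] [IsLocalRing R] (d t : ℕ) : Prop :=
  ∀ s : List R, s.length = d → (∀ x ∈ s, x ∈ maximalIdeal R) →
    RingTheory.Sequence.IsRegular R s →
      mlen R (idealQuot ((Ideal.span {x | x ∈ s}).colon (maximalIdeal R))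
        (Ideal.span {x | x ∈ s})) = (t : WithBot ℕ∞)

/-- The quotient module `N/(K ∩ N)` for submodules `N K` of a module. -/
abbrev submoduleQuot {A M : Type*} [CommRing A] [AddCommGroup M] [Module A M]
    (N K : Submodule A M) :=
  N ⧸ (Submodule.comap N.subtype K)


namespace SallyAux
set_option linter.unusedVariables false
open scoped Pointwise
lemma exists_ass_quot {R N : Type*} [CommRing R] [IsNoetherianRing R] [IsLocalRing R]
    [AddCommGroup N] [Module R N] [Module.Finite R N] {y : R} (hym : y ∈ maximalIdeal R)
    (hy : IsSMulRegular N y) {p : Ideal R} (hp : p ∈ associatedPrimes R N) :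
    ∃ q ∈ associatedPrimes R (QuotSMulTop y N), p ≤ q ∧ y ∈ q := by
  obtain ⟨hpp, x, hx⟩ := isAssociatedPrime_iff.mp hp
  set U : Submodule R N := Submodule.torsionBySet R N p with hU
  have hxU : x ∈ U := by
    rw [hU, Submodule.mem_torsionBySet_iff]
    rintro ⟨a, ha⟩
    have ha' : a ∈ p := ha
    rw [hx, Submodule.mem_colon_singleton] at ha'
    simpa using ha'
  have hx0 : x ≠ 0 := by
    rintro rfl
    apply hpp.ne_top
    rw [hx]
    ext a; simp [Submodule.mem_colon_singleton]
  have hnot : ¬ U ≤ y • (⊤ : Submodule R N) := by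
    intro hle
    have h2 : U ≤ Ideal.span {y} • U := by
      intro u hu
      obtain ⟨n, -, rfl⟩ := hle hu
      have hn : n ∈ U := by
        rw [hU, Submodule.mem_torsionBySet_iff]
        rintro ⟨a, ha⟩
        rw [hU, Submodule.mem_torsionBySet_iff] at hu
        have := hu ⟨a, ha⟩
        apply hy
        have h7 : a • (y • n) = 0 := this
        change y • (a • n) = y • 0
        rw [smul_comm, h7, smul_zero]
      exact Submodule.smul_mem_smul (Ideal.mem_span_singleton_self y) hn
    have h3 := Submodule.eq_bot_of_le_smul_of_le_jacobson_bot (Ideal.span {y}) U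
      (IsNoetherian.noetherian U) h2 (by
        rw [IsLocalRing.jacobson_eq_maximalIdeal _ bot_ne_top, Ideal.span_le]
        simpa using hym)
    rw [h3] at hxU
    exact hx0 (by simpa using hxU)
  obtain ⟨u, hu, huy⟩ := Set.not_subset.mp hnot
  have hu0 : (Submodule.Quotient.mk u : QuotSMulTop y N) ≠ 0 := by
    rw [Ne, Submodule.Quotient.mk_eq_zero]; exact huy
  obtain ⟨q, hq, hle⟩ := exists_le_isAssociatedPrime_of_isNoetherianRing R _ hu0
  refine ⟨q, hq, fun a ha => hle ?_, hle ?_⟩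
  · rw [Submodule.mem_colon_singleton]
    have hu' : u ∈ U := hu
    rw [hU, Submodule.mem_torsionBySet_iff] at hu'
    have : a • u = 0 := hu' ⟨a, ha⟩
    rw [← Submodule.Quotient.mk_smul, this]; simp
  · rw [Submodule.mem_colon_singleton, ← Submodule.Quotient.mk_smul]
    rw [Submodule.mem_bot, Submodule.Quotient.mk_eq_zero]
    exact Submodule.smul_mem_pointwise_smul _ _ _ trivial

lemma length_le_dim_ass {R : Type*} [CommRing R] [IsNoetherianRing R] [IsLocalRing R]
    (rs : List R) : ∀ {N : Type*} 
    [AddCommGroup N] [Module R N] [Module.Finite R N] (hm : ∀ r ∈ rs, r ∈ maximalIdeal R)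
    (hr : RingTheory.Sequence.IsWeaklyRegular N rs) {p : Ideal R} (hp : p ∈ associatedPrimes R N),
    (rs.length : WithBot ℕ∞) ≤ ringKrullDim (R ⧸ p) := by
  induction rs with
  | nil =>
    intro N _ _ _ _ _ p hp
    have := hp.1
    simpa using ringKrullDim_nonneg_of_nontrivial
  | cons y rs ih =>
    intro N _ _ _ hm hr p hp
    rw [RingTheory.Sequence.isWeaklyRegular_cons_iff] at hr
    obtain ⟨q, hq, hpq, hyq⟩ := exists_ass_quot (hm y (by simp)) hr.1 hp
    have h1 := ih (fun r h => hm r (by simp [h])) hr.2 hq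
    have hpp := hp.1
    have hyp : y ∉ p := by
      obtain ⟨hpp, x, hx⟩ := isAssociatedPrime_iff.mp hp
      intro h
      have h' := h
      rw [hx, Submodule.mem_colon_singleton, Submodule.mem_bot] at h'
      have : x = 0 := hr.1 (by simpa using h')
      apply hpp.ne_top
      rw [hx, this]
      ext a; simp [Submodule.mem_colon_singleton]
    have h2 := ringKrullDim_succ_le_of_surjective (Ideal.Quotient.factor hpq)
      (Ideal.Quotient.factor_surjective hpq) (r := Ideal.Quotient.mk p y)
      (by rw [mem_nonZeroDivisors_iff_ne_zero, Ne, Ideal.Quotient.eq_zero_iff_mem]; exact hyp)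
      (by simpa [Ideal.Quotient.eq_zero_iff_mem] using hyq)
    calc _ = (rs.length : WithBot ℕ∞) + 1 := by simp
      _ ≤ _ := by gcongr
      _ ≤ _ := h2

open CategoryTheory Abelian Limits in
lemma ext_quot {R : Type*} [CommRing R] (k : ModuleCat R) (N : ModuleCat R) (y : R)
    (hy : IsSMulRegular N y) (n : ℕ) (h : ∀ i < n + 1, Subsingleton (Ext k N i)) :
    ∀ i < n, Subsingleton (Ext k (ModuleCat.of R (QuotSMulTop y N)) i) := by
  intro i hi
  have zero1 := AddCommGrpCat.isZero_of_iff_subsingleton.mpr (h i (by omega))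
  have zero2 := AddCommGrpCat.isZero_of_iff_subsingleton.mpr (h (i + 1) (by omega))
  exact AddCommGrpCat.subsingleton_of_isZero <| ShortComplex.Exact.isZero_of_both_zeros
        ((Ext.covariant_sequence_exact₃' k hy.smulShortComplex_shortExact) i (i + 1) rfl)
        (zero1.eq_zero_of_src _) (zero2.eq_zero_of_tgt _)


open CategoryTheory Abelian Limits in
/-- A system of parameters on a module of maximal depth is a weakly regular sequence. -/
lemma sop_regular {R : Type*} [CommRing R] [IsNoetherianRing R] [IsLocalRing R]
    (xs : List R) : ∀ (N : ModuleCat R) [Module.Finite R N] [Nontrivial N]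
    (hm : ∀ r ∈ xs, r ∈ maximalIdeal R)
    (hext : ∀ i < xs.length, Subsingleton (Ext (ModuleCat.of R (R ⧸ maximalIdeal R)) N i))
    (hsop : ∀ p : Ideal R, p.IsPrime → Module.annihilator R N ≤ p → (∀ r ∈ xs, r ∈ p) →
      p = maximalIdeal R),
    RingTheory.Sequence.IsWeaklyRegular N xs := by
  induction xs with
  | nil => intro N _ _ _ _ _; simp
  | cons x xs ih =>
    intro N _ _ hm hext hsop
    have hx : IsSMulRegular N x := by
      by_contra hnot
      have : ∃ n : N, n ≠ 0 ∧ x • n = 0 := by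
        by_contra hc
        push Not at hc
        apply hnot
        intro a b hab
        by_contra hne
        refine hc (a - b) (sub_ne_zero.mpr hne) ?_
        have hab' : x • a = x • b := hab
        rw [smul_sub, hab', sub_self]
      have hmem : x ∈ ⋃ p ∈ associatedPrimes R N, (p : Set R) := by
        rw [biUnion_associatedPrimes_eq_zero_divisors]; exact this
      simp only [Set.mem_iUnion] at hmem
      obtain ⟨p, hp, hxp⟩ := hmem
      have hpp := hp.1
      have hlt : maximalIdeal R • (⊤ : Submodule R N) < ⊤ := by
        rw [lt_top_iff_ne_top]
        intro h
        have := Submodule.eq_bot_of_le_smul_of_le_jacobson_bot (maximalIdeal R) (⊤ : Submodule R N)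
          Module.Finite.fg_top h.ge (by rw [IsLocalRing.jacobson_eq_maximalIdeal _ bot_ne_top])
        exact top_ne_bot this
      obtain ⟨rs, hlen, hrs, hreg⟩ := ModuleCat.exists_isRegular_of_exists_subsingleton_ext
        (maximalIdeal R) (x :: xs).length N hlt (ModuleCat.of R (R ⧸ maximalIdeal R))
        (by rw [Module.support_eq_zeroLocus, Ideal.annihilator_quotient]) hext
      have h1 := length_le_dim_ass rs hrs hreg.1 hp
      rw [hlen] at h1
      classical
      have hloc : IsLocalRing (R ⧸ p) :=
        IsLocalRing.of_surjective' _ Ideal.Quotient.mk_surjective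
      have hnonunit : ∀ r ∈ xs, ¬ IsUnit (Ideal.Quotient.mk p r) := by
        intro r hr hu
        have h5 : IsLocalHom (Ideal.Quotient.mk p) := .of_surjective _ Ideal.Quotient.mk_surjective
        have := hm r (by simp [hr])
        exact this (h5.map_nonunit _ hu)
      let S : Finset (R ⧸ p) := (xs.map (Ideal.Quotient.mk p)).toFinset
      have hS : (S : Set (R ⧸ p)) ⊆ (maximalIdeal (R ⧸ p) : Set (R ⧸ p)) := by
        intro a ha
        simp only [S, List.coe_toFinset, List.mem_map, Set.mem_ofPred_eq] at ha
        obtain ⟨r, hr, rfl⟩ := ha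
        exact hnonunit r hr
      have h2 := ringKrullDim_le_ringKrullDim_quotient_add_card S
        (by rw [IsLocalRing.ringJacobson_eq_maximalIdeal]; exact hS)
      have h3 : ringKrullDim ((R ⧸ p) ⧸ Ideal.span (S : Set (R ⧸ p))) ≤ 0 := by
        have h7 : Ring.KrullDimLE 0 ((R ⧸ p) ⧸ Ideal.span (S : Set (R ⧸ p))) := by
          refine Ring.KrullDimLE.mk₀ fun Q hQ => ?_
          let π : R →+* (R ⧸ p) ⧸ Ideal.span (S : Set (R ⧸ p)) :=
            (Ideal.Quotient.mk _).comp (Ideal.Quotient.mk p)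
          have hπ : Function.Surjective π :=
            Ideal.Quotient.mk_surjective.comp Ideal.Quotient.mk_surjective
          have hpQ : p ≤ Q.comap π := by
            intro a ha
            have : Ideal.Quotient.mk p a = 0 := Ideal.Quotient.eq_zero_iff_mem.mpr ha
            simp [Ideal.mem_comap, π, this]
          have hQm := hsop (Q.comap π) (Ideal.IsPrime.comap π)
            (le_trans (by simpa [Submodule.annihilator_top] using hp.annihilator_le) hpQ) (by
              intro r hr
              rcases List.mem_cons.mp hr with rfl | hr
              · exact hpQ hxp
              · have : π r = 0 := by
                  simp only [π, RingHom.comp_apply]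
                  rw [Ideal.Quotient.eq_zero_iff_mem]
                  apply Ideal.subset_span
                  simp only [S, List.coe_toFinset, List.mem_map, Set.mem_ofPred_eq]
                  exact ⟨r, hr, rfl⟩
                simp [Ideal.mem_comap, this])
          have h8 : (Q.comap π).map π = Q := Ideal.map_comap_of_surjective π hπ Q
          have h9 : (Q.comap π).IsMaximal := by rw [hQm]; infer_instance
          rcases Ideal.map_eq_top_or_isMaximal_of_surjective π hπ h9 with h | h
          · exact absurd (h8.symm.trans h) hQ.ne_top
          · rwa [h8] at h
        exact Ring.krullDimLE_iff.mp h7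
      have h4 : S.card ≤ xs.length := by
        simpa [S] using List.toFinset_card_le (xs.map (Ideal.Quotient.mk p))
      have h6 : ((x :: xs).length : WithBot ℕ∞) ≤ (xs.length : ℕ) := by
        refine h1.trans (h2.trans ?_)
        calc _ ≤ (0 : WithBot ℕ∞) + S.card := by gcongr
          _ ≤ _ := by simpa using (by exact_mod_cast h4)
      have : (x :: xs).length ≤ xs.length := by exact_mod_cast h6
      simp at this
    rw [RingTheory.Sequence.isWeaklyRegular_cons_iff]
    refine ⟨hx, ?_⟩
    have : Nontrivial (QuotSMulTop x N) := 
      nontrivial_quotSMulTop_of_mem_maximalIdeal N (hm x (by simp))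
    refine ih (ModuleCat.of R (QuotSMulTop x N)) (fun r hr => hm r (by simp [hr]))
      (ext_quot _ N x hx _ hext) ?_
    intro p hp hann hxs
    refine hsop p hp (le_trans ?_ hann) ?_
    · intro a ha
      rw [Module.mem_annihilator] at ha ⊢
      intro n
      obtain ⟨n, rfl⟩ := Submodule.Quotient.mk_surjective _ n
      rw [← Submodule.Quotient.mk_smul, ha]; simp
    · intro r hr
      rcases List.mem_cons.mp hr with rfl | hr
      · apply hann
        change _ ∈ Module.annihilator R (QuotSMulTop _ N)
        rw [Module.mem_annihilator]
        intro n
        obtain ⟨n, rfl⟩ := Submodule.Quotient.mk_surjective _ n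
        rw [← Submodule.Quotient.mk_smul, Submodule.Quotient.mk_eq_zero]
        exact Submodule.smul_mem_pointwise_smul _ _ _ trivial
      · exact hxs r hr

open CategoryTheory Abelian Limits in
lemma weaklyRegular_of_CM {R : Type*} [CommRing R] [IsLocalRing R] [IsNoetherianRing R]
    (d : ℕ) (hdim : ringKrullDim R = d) (hCM : IsCMLocal R) (s : Fin d → R)
    (hs : (Ideal.span (Set.range s)).radical = maximalIdeal R) :
    RingTheory.Sequence.IsWeaklyRegular R (List.ofFn s) := by
  have hsm : ∀ i, s i ∈ maximalIdeal R := fun i => by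
    rw [← hs]; exact Ideal.le_radical (Ideal.subset_span ⟨i, rfl⟩)
  unfold IsCMLocal at hCM
  rw [hdim] at hCM
  have hCM' : rdepth R (maximalIdeal R) R = (d : ℕ∞) := by exact_mod_cast hCM
  unfold rdepth at hCM'
  have hne : Nonempty {n : ℕ∞ | ∃ rs : List R,
      (rs.length : ℕ∞) = n ∧ (∀ x ∈ rs, x ∈ maximalIdeal R) ∧
    RingTheory.Sequence.IsRegular R rs} := ⟨⟨0, [], by simp, by simp, .nil R R⟩⟩
  have hmem := ENat.sSup_mem_of_nonempty_of_lt_top (s := {n : ℕ∞ | ∃ rs : List R,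
      (rs.length : ℕ∞) = n ∧ (∀ x ∈ rs, x ∈ maximalIdeal R) ∧
    RingTheory.Sequence.IsRegular R rs})
      (by rw [hCM']; exact ENat.natCast_lt_top d)
  rw [hCM'] at hmem
  obtain ⟨rs, hlen, hrs, hreg⟩ := hmem
  have hlen' : rs.length = d := by exact_mod_cast hlen
  refine sop_regular (List.ofFn s) (ModuleCat.of R R) ?_ ?_ ?_
  · intro r hr
    rw [List.mem_ofFn] at hr
    obtain ⟨i, rfl⟩ := hr
    exact hsm i
  · rw [List.length_ofFn, ← hlen']
    refine ModuleCat.subsingleton_ext_of_exists_isRegular (maximalIdeal R)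
      (ModuleCat.of R (R ⧸ maximalIdeal R))
      (by rw [Module.support_eq_zeroLocus, Ideal.annihilator_quotient]) (ModuleCat.of R R) ?_ rs
      hrs hreg
    rw [lt_top_iff_ne_top]
    intro h
    have : (maximalIdeal R • (⊤ : Ideal R)) = ⊤ := h
    rw [smul_eq_mul, Ideal.mul_top] at this
    exact (inferInstance : (maximalIdeal R).IsMaximal).ne_top this
  · intro p hp _ hxs
    apply le_antisymm (IsLocalRing.le_maximalIdeal hp.ne_top)
    rw [← hs, hp.radical_le_iff, Ideal.span_le]
    rintro _ ⟨i, rfl⟩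
    exact hxs _ (by rw [List.mem_ofFn]; exact ⟨i, rfl⟩)
end SallyAux

namespace SallyAux
section QR
variable {R σ : Type*} [CommRing R]

/-- Forms of degree `n` in the variables of `S` with coefficients in `C`. -/
def Wf (n : ℕ) (S : Set σ) (C : Ideal R) : Submodule R (MvPolynomial σ R) where
  carrier := {f | ∀ β, f.coeff β ∈ C ∧
    (f.coeff β ≠ 0 → β.degree = n ∧ ∀ i, β i ≠ 0 → i ∈ S)}
  add_mem' := by
    intro f g hf hg β
    refine ⟨by rw [MvPolynomial.coeff_add]; exact C.add_mem (hf β).1 (hg β).1, fun h => ?_⟩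
    by_cases h1 : f.coeff β = 0
    · rw [MvPolynomial.coeff_add, h1, zero_add] at h
      exact (hg β).2 h
    · exact (hf β).2 h1
  zero_mem' := by intro β; simp
  smul_mem' := by
    intro c f hf β
    refine ⟨by rw [MvPolynomial.coeff_smul]; exact C.mul_mem_left _ (hf β).1, fun h => (hf β).2 ?_⟩
    rw [MvPolynomial.coeff_smul] at h
    intro h0
    simp [h0] at h

lemma mem_Wf {n : ℕ} {S : Set σ} {C : Ideal R} {f : MvPolynomial σ R} : f ∈ Wf n S C ↔
    ∀ β, f.coeff β ∈ C ∧ (f.coeff β ≠ 0 → β.degree = n ∧ ∀ i, β i ≠ 0 → i ∈ S) := Iff.rfl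

lemma monomial_mem_Wf {n : ℕ} {S : Set σ} {C : Ideal R} {β : σ →₀ ℕ} {c : R} (hc : c ∈ C)
    (hβ : β.degree = n) (hS : ∀ i, β i ≠ 0 → i ∈ S) : MvPolynomial.monomial β c ∈ Wf n S C := by
  classical
  intro γ
  rw [MvPolynomial.coeff_monomial]
  split_ifs with h
  · subst h; exact ⟨hc, fun _ => ⟨hβ, hS⟩⟩
  · simp

lemma X_mul_mem_Wf {n : ℕ} {S : Set σ} {C : Ideal R} {f : MvPolynomial σ R} (hf : f ∈ Wf n S C)
    {a : σ} (ha : a ∈ S) : MvPolynomial.X a * f ∈ Wf (n + 1) S C := by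
  classical
  intro β
  rw [MvPolynomial.coeff_X_mul']
  split_ifs with h
  · refine ⟨(hf _).1, fun h0 => ?_⟩
    obtain ⟨h1, h2⟩ := (hf _).2 h0
    have h3 : β = (β - Finsupp.single a 1) + Finsupp.single a 1 := by
      refine (tsub_add_cancel_of_le ?_).symm
      rw [Finsupp.single_le_iff]
      exact Nat.one_le_iff_ne_zero.mpr (Finsupp.mem_support_iff.mp h)
    refine ⟨?_, fun i hi => ?_⟩
    · rw [h3, map_add, h1, Finsupp.degree_single]
    · by_cases hia : i = a
      · exact hia ▸ ha
      · apply h2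
        rw [Finsupp.tsub_apply, Finsupp.single_eq_of_ne hia]
        simpa using hi
  · simp

variable (x : σ → R)

lemma prod_mem {S : Set σ} {β : σ →₀ ℕ} (hS : ∀ i, β i ≠ 0 → i ∈ S) :
    (β.prod fun i k => x i ^ k) ∈ Ideal.span (x '' S) ^ β.degree := by
  classical
  induction β using Finsupp.induction with
  | zero => simp
  | single_add a b f ha hb ih =>
    rw [Finsupp.prod_add_index' (by simp) (by intros; rw [pow_add]), map_add, pow_add]
    refine Ideal.mul_mem_mul ?_ (ih ?_)
    · rw [Finsupp.prod_single_index (by simp), Finsupp.degree_single]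
      have haS : a ∈ S := by
        apply hS
        simp only [Finsupp.add_apply, Finsupp.single_eq_same]; omega
      exact Ideal.pow_mem_pow (Ideal.subset_span (Set.mem_image_of_mem x haS)) _
    · intro i hi
      apply hS
      simp only [Finsupp.add_apply]; omega

lemma eval_mem_of_Wf {n : ℕ} {S : Set σ} {C : Ideal R} {f : MvPolynomial σ R}
    (hf : f ∈ Wf n S C) : MvPolynomial.eval x f ∈ Ideal.span (x '' S) ^ n * C := by
  rw [MvPolynomial.eval_eq]
  refine Ideal.sum_mem _ fun β hβ => ?_
  obtain ⟨h1, h2⟩ := hf β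
  obtain ⟨h3, h4⟩ := h2 (MvPolynomial.mem_support_iff.mp hβ)
  refine Ideal.mul_mem_mul_rev (I := Ideal.span (x '' S) ^ n) (J := C) ?_ h1
  rw [← h3]
  exact prod_mem x h4

lemma exists_Wf {n : ℕ} {S : Set σ} {C : Ideal R} : ∀ {z : R},
    z ∈ Ideal.span (x '' S) ^ n * C → ∃ f ∈ Wf n S C, MvPolynomial.eval x f = z := by
  induction n with
  | zero =>
    intro z hz
    rw [pow_zero, one_mul] at hz
    exact ⟨MvPolynomial.monomial 0 z, monomial_mem_Wf hz (by simp) (by simp), by simp⟩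
  | succ n ih =>
    intro z hz
    rw [pow_succ', mul_assoc] at hz
    refine Submodule.mul_induction_on hz ?_ ?_
    · intro r hr s hs
      obtain ⟨f, hf, rfl⟩ := ih hs
      refine Submodule.span_induction ?_ ?_ ?_ ?_ hr
      · rintro _ ⟨a, ha, rfl⟩
        exact ⟨MvPolynomial.X a * f, X_mul_mem_Wf hf ha, by simp⟩
      · exact ⟨0, Submodule.zero_mem _, by simp⟩
      · rintro u v _ _ ⟨g, hg, hg'⟩ ⟨h, hh, hh'⟩
        exact ⟨g + h, Submodule.add_mem _ hg hh, by rw [map_add, hg', hh', add_mul]⟩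
      · rintro c u _ ⟨g, hg, hg'⟩
        exact ⟨c • g, Submodule.smul_mem _ c hg, by
          rw [MvPolynomial.smul_eval, hg', smul_eq_mul, mul_assoc]⟩
    · rintro u v ⟨g, hg, hg'⟩ ⟨h, hh, hh'⟩
      exact ⟨g + h, Submodule.add_mem _ hg hh, by rw [map_add, hg', hh']⟩

/-- Quasi-regularity. -/
def QR (S : Set σ) : Prop := ∀ n, ∀ f ∈ Wf n S (⊤ : Ideal R),
  MvPolynomial.eval x f ∈ Ideal.span (x '' S) ^ (n + 1) →
    ∀ β, f.coeff β ∈ Ideal.span (x '' S)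

lemma Wf_mono {n : ℕ} {S T : Set σ} {C D : Ideal R} (h : S ⊆ T) (h' : C ≤ D) :
    Wf n S C ≤ Wf n T D := fun _ hf β =>
  ⟨h' (hf β).1, fun h0 => ⟨((hf β).2 h0).1, fun i hi => h (((hf β).2 h0).2 i hi)⟩⟩

lemma reg_pow {S : Set σ} (hQ : QR x S) {a : R}
    (hreg : ∀ z, a * z ∈ Ideal.span (x '' S) → z ∈ Ideal.span (x '' S)) (j : ℕ) :
    ∀ z, a * z ∈ Ideal.span (x '' S) ^ j → z ∈ Ideal.span (x '' S) ^ j := by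
  induction j with
  | zero => intro z _; simp
  | succ j ih =>
    intro z hz
    have h1 := ih z (Ideal.pow_le_pow_right (Nat.le_succ j) hz)
    obtain ⟨g, hg, rfl⟩ := exists_Wf x (C := ⊤) (by simpa [Ideal.mul_top] using h1)
    have h2 := hQ j (a • g) (Submodule.smul_mem _ _ hg)
      (by rw [MvPolynomial.smul_eval]; exact hz)
    rw [pow_succ]
    apply eval_mem_of_Wf
    intro β
    refine ⟨hreg _ ?_, (hg β).2⟩
    simpa [MvPolynomial.coeff_smul] using h2 β

lemma QR_empty : QR x (∅ : Set σ) := by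
  intro n f hf hz β
  simp only [Set.image_empty, Ideal.span_empty] at hz ⊢
  rw [Ideal.mem_bot]
  by_contra h0
  obtain ⟨h1, h2⟩ := (hf β).2 h0
  have hf0 : f = MvPolynomial.monomial 0 (f.coeff 0) := by
    classical
    ext γ
    rw [MvPolynomial.coeff_monomial]
    split_ifs with h
    · rw [h]
    · by_contra h3
      apply h
      ext i
      by_contra h4
      exact ((hf γ).2 h3).2 i (fun h5 => h4 h5.symm)
  have hβ : β = 0 := by
    ext i
    by_contra h4
    exact h2 i h4
  subst hβ
  apply h0
  rw [hf0] at hz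
  simpa [pow_succ] using hz

lemma QR_insert {S : Set σ} (hQ : QR x S) {a : σ} (ha : a ∉ S)
    (hreg : ∀ z, x a * z ∈ Ideal.span (x '' S) → z ∈ Ideal.span (x '' S)) :
    QR x (insert a S) := by
  classical
  have hSQ : Ideal.span (x '' S) ≤ Ideal.span (x '' insert a S) :=
    Ideal.span_mono (Set.image_mono (Set.subset_insert a S))
  have haQ : x a ∈ Ideal.span (x '' insert a S) := Ideal.subset_span ⟨a, by simp, rfl⟩
  intro n
  induction n with
  | zero =>
    intro f hf hz β
    by_cases h0 : f.coeff β = 0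
    · rw [h0]; exact Ideal.zero_mem _
    have hβ : β = 0 := by
      have := ((hf β).2 h0).1
      rwa [Finsupp.degree_eq_zero_iff] at this
    have hf0 : f = MvPolynomial.C (f.coeff 0) := by
      ext γ
      rw [MvPolynomial.coeff_C]
      split_ifs with h
      · rw [h]
      · by_contra h3
        apply h
        have := ((hf γ).2 h3).1
        rw [Finsupp.degree_eq_zero_iff] at this
        exact this.symm
    rw [hβ]
    rw [hf0] at hz
    simpa using hz
  | succ m ih =>
    intro f hf hz
    rw [pow_succ] at hz
    obtain ⟨g, hg, hgz⟩ := exists_Wf x hz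
    suffices h : ∀ β, (f - g).coeff β ∈ Ideal.span (x '' insert a S) by
      intro β
      have := Ideal.add_mem _ (h β) (hg β).1
      simpa using this
    have hf' : f - g ∈ Wf (m + 1) (insert a S) (⊤ : Ideal R) :=
      Submodule.sub_mem _ hf (Wf_mono le_rfl le_top hg)
    have hz' : MvPolynomial.eval x (f - g) = 0 := by rw [map_sub, hgz, sub_self]
    generalize f - g = F at hf' hz'
    clear hz hg hgz hf f g
    set e := Finsupp.single a 1 with he
    set h := F.divMonomial e with hh
    set f0 := F.modMonomial e with hf0
    have hdecomp : MvPolynomial.X a * h + f0 = F := by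
      have := MvPolynomial.divMonomial_add_modMonomial F e
      exact this
    have hhW : h ∈ Wf m (insert a S) (⊤ : Ideal R) := by
      intro β
      refine ⟨trivial, fun h0 => ?_⟩
      rw [hh, MvPolynomial.coeff_divMonomial] at h0
      obtain ⟨h1, h2⟩ := (hf' _).2 h0
      refine ⟨?_, fun i hi => h2 i ?_⟩
      · rw [map_add, he, Finsupp.degree_single] at h1; omega
      · rw [Finsupp.add_apply]; omega
    have hf0W : f0 ∈ Wf (m + 1) S (⊤ : Ideal R) := by
      intro β
      refine ⟨trivial, fun h0 => ?_⟩
      by_cases hle : e ≤ β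
      · exact absurd (MvPolynomial.coeff_modMonomial_of_le F hle) h0
      · rw [hf0, MvPolynomial.coeff_modMonomial_of_not_le F hle] at h0
        obtain ⟨h1, h2⟩ := (hf' _).2 h0
        refine ⟨h1, fun i hi => ?_⟩
        rcases h2 i hi with h3 | h3
        · exfalso; apply hle
          rw [he, Finsupp.single_le_iff, ← h3]; omega
        · exact h3
    have hev : x a * MvPolynomial.eval x h + MvPolynomial.eval x f0 = 0 := by
      rw [← hz', ← hdecomp]; simp
    have hev0 : MvPolynomial.eval x f0 ∈ Ideal.span (x '' S) ^ (m + 1) := by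
      simpa [Ideal.mul_top] using eval_mem_of_Wf x hf0W
    have hevh : MvPolynomial.eval x h ∈ Ideal.span (x '' S) ^ (m + 1) := by
      refine reg_pow x hQ hreg _ _ ?_
      rw [eq_neg_of_add_eq_zero_left hev]
      exact neg_mem hev0
    obtain ⟨h', hh'W, hh'⟩ := exists_Wf x (C := ⊤) (by simpa [Ideal.mul_top] using hevh)
    have h1 := hQ (m + 1) (f0 + x a • h')
      (Submodule.add_mem _ hf0W (Submodule.smul_mem _ _ hh'W)) (by
        rw [map_add, MvPolynomial.smul_eval, hh', add_comm (MvPolynomial.eval x f0), hev]; exact Ideal.zero_mem _)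
    have h2 := ih h hhW (Ideal.pow_right_mono hSQ _ hevh)
    intro β
    rw [← hdecomp, MvPolynomial.coeff_add, MvPolynomial.coeff_X_mul']
    refine Ideal.add_mem _ ?_ ?_
    · split_ifs
      · exact h2 _
      · exact Ideal.zero_mem _
    · have h3 := hSQ (h1 β)
      rw [MvPolynomial.coeff_add, MvPolynomial.coeff_smul, smul_eq_mul] at h3
      have h4 := Ideal.sub_mem _ h3 (Ideal.mul_mem_right (h'.coeff β) _ haQ)
      simpa using h4

end QR
end SallyAux

namespace SallyAux
section C
variable {R σ : Type*} [CommRing R]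

lemma krull_sup [IsNoetherianRing R] [IsLocalRing R] (B J : Ideal R) (hJ : J ≠ ⊤) {z : R}
    (hz : ∀ N, z ∈ B ⊔ J ^ N) : z ∈ B := by
  have h := J.iInf_pow_smul_eq_bot_of_isLocalRing (M := R ⧸ B) hJ
  rw [← Ideal.Quotient.eq_zero_iff_mem, ← Submodule.mem_bot R, ← h, Submodule.mem_iInf]
  intro N
  obtain ⟨b, hb, c, hc, rfl⟩ := Submodule.mem_sup.mp (hz N)
  have : Ideal.Quotient.mk B (b + c) = c • (1 : R ⧸ B) := by
    rw [map_add, Ideal.Quotient.eq_zero_iff_mem.mpr hb, zero_add, Algebra.smul_def, mul_one]; rfl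
  rw [this]
  exact Submodule.smul_mem_smul hc trivial

lemma prim_nzd [IsNoetherianRing R] [IsLocalRing R] (J : Ideal R)
    {f g : MvPolynomial σ R} {β0 : σ →₀ ℕ} (hu : IsUnit (f.coeff β0))
    (hfg : ∀ β, (f * g).coeff β ∈ J) : ∀ β, g.coeff β ∈ J := by
  classical
  suffices h : ∀ r β, g.coeff β ∈ J ⊔ maximalIdeal R ^ r by
    intro β
    exact krull_sup J (maximalIdeal R) (Ideal.IsPrime.ne_top inferInstance) fun N => h N β
  intro r
  induction r with
  | zero => intro β; simp
  | succ r ih =>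
    by_contra hc
    push Not at hc
    obtain ⟨γ, hγ⟩ := hc
    let A := f.support.filter fun β => IsUnit (f.coeff β)
    let B := g.support.filter fun γ => g.coeff γ ∉ J ⊔ maximalIdeal R ^ (r + 1)
    have hA : A.Nonempty := ⟨β0, by simp only [A, Finset.mem_filter, MvPolynomial.mem_support_iff]; exact ⟨hu.ne_zero, hu⟩⟩
    have hB : B.Nonempty := ⟨γ, by
      simp only [B, Finset.mem_filter, MvPolynomial.mem_support_iff]
      exact ⟨fun h => hγ (by rw [h]; exact Ideal.zero_mem _), hγ⟩⟩
    obtain ⟨a, ha, b, hb, huniq⟩ := UniqueSums.uniqueAdd_of_nonempty hA hB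
    simp only [A, B, Finset.mem_filter] at ha hb
    have h1 : (f * g).coeff (a + b) ∈ J ⊔ maximalIdeal R ^ (r + 1) :=
      (le_sup_left : J ≤ _) (hfg _)
    rw [MvPolynomial.coeff_mul, ← Finset.add_sum_erase _ _
      (show (a, b) ∈ Finset.HasAntidiagonal.antidiagonal (a + b) by simp)] at h1
    have h2 : ∑ p ∈ (Finset.HasAntidiagonal.antidiagonal (a + b)).erase (a, b), f.coeff p.1 * g.coeff p.2
        ∈ J ⊔ maximalIdeal R ^ (r + 1) := by
      refine Ideal.sum_mem _ fun p hp => ?_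
      rw [Finset.mem_erase, Finset.HasAntidiagonal.mem_antidiagonal] at hp
      by_cases hg : g.coeff p.2 ∈ J ⊔ maximalIdeal R ^ (r + 1)
      · exact Ideal.mul_mem_left _ _ hg
      · by_cases hf : IsUnit (f.coeff p.1)
        · exfalso
          have := huniq (a := p.1) (b := p.2) (by
            simp only [A, Finset.mem_filter, MvPolynomial.mem_support_iff]
            exact ⟨hf.ne_zero, hf⟩) (by
            simp only [B, Finset.mem_filter, MvPolynomial.mem_support_iff]
            exact ⟨fun h => hg (by rw [h]; exact Ideal.zero_mem _), hg⟩) hp.2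
          exact hp.1 (Prod.ext this.1 this.2)
        · have h3 : f.coeff p.1 ∈ maximalIdeal R := hf
          obtain ⟨j, hj, m, hm, hjm⟩ := Submodule.mem_sup.mp (ih p.2)
          rw [← hjm, mul_add]
          refine Ideal.add_mem _ ((le_sup_left : J ≤ _) (J.mul_mem_left _ hj)) ?_
          refine (le_sup_right : _ ≤ J ⊔ maximalIdeal R ^ (r + 1)) ?_
          rw [pow_succ']
          exact Ideal.mul_mem_mul h3 hm
    have h4 := (Ideal.add_mem_iff_left _ h2).mp h1
    have h5 := (Ideal.unit_mul_mem_iff_mem _ ha.2).mp h4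
    exact hb.2 h5

lemma mul_mem_Wf {n m : ℕ} {S : Set σ} {C D : Ideal R} {f g : MvPolynomial σ R}
    (hf : f ∈ Wf n S C) (hg : g ∈ Wf m S D) : f * g ∈ Wf (n + m) S (C * D) := by
  classical
  intro β
  rw [MvPolynomial.coeff_mul]
  refine ⟨Ideal.sum_mem _ fun p _ => Ideal.mul_mem_mul (hf _).1 (hg _).1, fun h => ?_⟩
  obtain ⟨p, hp, hne⟩ := Finset.exists_ne_zero_of_sum_ne_zero h
  rw [Finset.HasAntidiagonal.mem_antidiagonal] at hp
  obtain ⟨h1, h2⟩ := (hf p.1).2 (left_ne_zero_of_mul hne)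
  obtain ⟨h3, h4⟩ := (hg p.2).2 (right_ne_zero_of_mul hne)
  refine ⟨by rw [← hp, map_add, h1, h3], fun i hi => ?_⟩
  rw [← hp, Finsupp.add_apply] at hi
  by_cases h5 : p.1 i = 0
  · exact h4 i (by omega)
  · exact h2 i h5

/-- (**) primitive forms are nonzerodivisors on the associated graded ring of `J`. -/
lemma prim_cancel [IsNoetherianRing R] [IsLocalRing R] {x : σ → R} {S : Set σ} (hQ : QR x S)
    {j : ℕ} {f : MvPolynomial σ R} (hf : f ∈ Wf j S (⊤ : Ideal R)) {β0 : σ →₀ ℕ}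
    (hu : IsUnit (f.coeff β0)) (a : ℕ) : ∀ z, MvPolynomial.eval x f * z ∈ Ideal.span (x '' S) ^ (a + j) →
      z ∈ Ideal.span (x '' S) ^ a := by
  induction a with
  | zero => intro z _; simp
  | succ a ih =>
    intro z hz
    have h1 := ih z (Ideal.pow_le_pow_right (by omega) hz)
    obtain ⟨g, hg, rfl⟩ := exists_Wf x (C := ⊤) (by simpa [Ideal.mul_top] using h1)
    have h2 := hQ (j + a) (f * g) (Wf_mono le_rfl le_top (mul_mem_Wf hf hg))
      (by rw [map_mul]; convert hz using 2; omega)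
    have h3 := prim_nzd (Ideal.span (x '' S)) hu h2
    rw [pow_succ]
    apply eval_mem_of_Wf
    exact fun β => ⟨h3 β, (hg β).2⟩

variable {d : ℕ} (x : Fin d → R)

/-- elementwise weak regularity. -/
def WReg : Prop := ∀ (i : Fin d) z, x i * z ∈ Ideal.span (x '' {j | j < i}) →
  z ∈ Ideal.span (x '' {j | j < i})

lemma wReg_of_list (h : RingTheory.Sequence.IsWeaklyRegular R (List.ofFn x)) : WReg x := by
  intro i z hz
  have h1 := h.regular_mod_prev i (by simp)
  have h2 : Ideal.ofList ((List.ofFn x).take i) • (⊤ : Submodule R R) =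
      Ideal.span (x '' {j | j < i}) := by
    rw [smul_eq_mul, Ideal.mul_top, Ideal.ofList]
    congr 1
    ext a
    simp only [Set.mem_ofPred_eq, Set.mem_image, List.mem_take_iff_getElem, List.getElem_ofFn,
      List.length_ofFn]
    constructor
    · rintro ⟨j, hj, rfl⟩
      exact ⟨⟨j, by omega⟩, by simp [Fin.lt_def]; omega, rfl⟩
    · rintro ⟨j, hj, rfl⟩
      exact ⟨j, by have := Fin.lt_def.mp hj; omega, rfl⟩
  rw [h2] at h1
  have h3 : (List.ofFn x)[(i : ℕ)]'(by simp) = x i := by simp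
  rw [h3] at h1
  rw [← Ideal.Quotient.eq_zero_iff_mem]
  apply h1
  change x i • _ = x i • (0 : R ⧸ _)
  rw [smul_zero]
  change Ideal.Quotient.mk _ (x i * z) = 0
  exact Ideal.Quotient.eq_zero_iff_mem.mpr hz

lemma QR_aux {A : Type*} [CommRing A] (y : Fin d → A) (i : ℕ)
    (h : ∀ (a : Fin d), i ≤ a → ∀ z, y a * z ∈ Ideal.span (y '' {j | i ≤ j.val ∧ j < a}) →
      z ∈ Ideal.span (y '' {j | i ≤ j.val ∧ j < a})) :
    QR y {j | i ≤ j.val} := by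
  have key : ∀ n : ℕ, QR y {j : Fin d | i ≤ j.val ∧ j.val < n} := by
    intro n
    induction n with
    | zero =>
      have : {j : Fin d | i ≤ j.val ∧ j.val < 0} = ∅ := by ext; simp
      rw [this]; exact QR_empty y
    | succ n ih =>
      by_cases hn : n < d ∧ i ≤ n
      · have : {j : Fin d | i ≤ j.val ∧ j.val < n + 1} =
          insert ⟨n, hn.1⟩ {j : Fin d | i ≤ j.val ∧ j.val < n} := by
          ext j; simp only [Set.mem_ofPred_eq, Set.mem_insert_iff, Fin.ext_iff]; omega
        rw [this]
        refine QR_insert y ih (by simp) ?_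
        exact h ⟨n, hn.1⟩ hn.2
      · have : {j : Fin d | i ≤ j.val ∧ j.val < n + 1} = {j : Fin d | i ≤ j.val ∧ j.val < n} := by
          ext j; simp only [Set.mem_ofPred_eq]; have := j.2; omega
        rw [this]; exact ih
  have h2 := key d
  convert h2 using 2
  ext j; simp

variable {x}
lemma WReg.QR (h : WReg x) : QR x Set.univ := by
  have := QR_aux x 0 (fun a _ => by simpa using h a)
  simpa using this

lemma WReg.QR_quot (h : WReg x) (i : ℕ) (hi : i ≤ d) :
    SallyAux.QR (fun j => Ideal.Quotient.mk (Ideal.span (x '' {j | j.val < i})) (x j)) 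
      {j | i ≤ j.val} := by
  apply QR_aux
  intro a ha z
  obtain ⟨z, rfl⟩ := Ideal.Quotient.mk_surjective z
  have key : ∀ w, Ideal.Quotient.mk (Ideal.span (x '' {j | j.val < i})) w ∈ Ideal.span
      ((fun j => Ideal.Quotient.mk (Ideal.span (x '' {j | j.val < i})) (x j)) ''
        {j | i ≤ j.val ∧ j < a}) ↔ w ∈ Ideal.span (x '' {j | j < a}) := by
    intro w
    rw [← Set.image_image (Ideal.Quotient.mk _) x, ← Ideal.map_span, ← Ideal.mem_comap,
      Ideal.comap_map_of_surjective _ Ideal.Quotient.mk_surjective, ← RingHom.ker_eq_comap_bot,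
      Ideal.mk_ker, ← Ideal.span_union, ← Set.image_union]
    have : ({j : Fin d | i ≤ j.val ∧ j < a} ∪ {j | j.val < i}) = {j | j < a} := by
      ext j; simp only [Set.mem_union, Set.mem_ofPred_eq, Fin.lt_def]; omega
    rw [this]
  rw [← map_mul, key, key]
  exact h a z

/-- `(x_1..x_i) ∩ J^n C ⊆ (x_1..x_i) J^(n-1) C`, for `J ≤ C`. -/
lemma WReg.inter [IsNoetherianRing R] [IsLocalRing R] (h : WReg x) (i : ℕ) (hi : i ≤ d)
    {J : Ideal R} (hJ : J = Ideal.span (Set.range x)) (hJt : J ≠ ⊤) {C : Ideal R} (hC : J ≤ C)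
    (n : ℕ) {z : R} (hz : z ∈ Ideal.span (x '' {j | j.val < i})) (hz' : z ∈ J ^ (n + 1) * C) :
    z ∈ Ideal.span (x '' {j | j.val < i}) * (J ^ n * C) := by
  classical
  set Q := Ideal.span (x '' {j | j.val < i}) with hQdef
  have hJ' : J = Ideal.span (x '' Set.univ) := by rw [hJ, Set.image_univ]
  have hQJ : Q ≤ J := by rw [hJ']; exact Ideal.span_mono (Set.image_mono (Set.subset_univ _))
  have step : ∀ (C : Ideal R) (n : ℕ) (z : R), z ∈ Q → z ∈ J ^ (n + 1) * C →
      ∃ a ∈ Q * (J ^ n * C), ∃ b ∈ Q, b ∈ J ^ (n + 2) ∧ z = a + b := by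
    intro C n z hz hz'
    rw [hJ'] at hz'
    obtain ⟨f, hf, rfl⟩ := exists_Wf x hz'
    have hlow : ∀ β : Fin d →₀ ℕ, f.coeff β ≠ 0 → (∃ j, β j ≠ 0 ∧ j.val < i) →
        f.coeff β * ∏ j ∈ β.support, x j ^ β j ∈ Q * (J ^ n * C) := by
      rintro β hβ ⟨j, hj, hji⟩
      have h3 : β = Finsupp.single j 1 + (β - Finsupp.single j 1) := by
        refine (add_tsub_cancel_of_le ?_).symm
        rw [Finsupp.single_le_iff]; omega
      obtain ⟨γ, hγ⟩ : ∃ γ, γ = β - Finsupp.single j 1 := ⟨_, rfl⟩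
      rw [← hγ] at h3
      have h5 : γ.degree = n := by
        have := ((hf β).2 hβ).1
        rw [h3, map_add, Finsupp.degree_single] at this; omega
      have h4 : ∏ j ∈ β.support, x j ^ β j = x j * γ.prod fun j k => x j ^ k := by
        change (β.prod fun j k => x j ^ k) = _
        rw [h3, Finsupp.prod_add_index' (by simp) (by intros; rw [pow_add]),
          Finsupp.prod_single_index (by simp), pow_one]
      rw [h4, mul_left_comm (MvPolynomial.coeff β f)]
      have h6 : x j ∈ Q := Ideal.subset_span (Set.mem_image_of_mem x hji)
      refine Ideal.mul_mem_mul h6 ?_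
      refine Ideal.mul_mem_mul_rev (I := J ^ n) (J := C) ?_ (hf β).1
      rw [hJ', ← h5]
      exact prod_mem x (by simp)
    let T := f.support.filter fun β => ∃ j, β j ≠ 0 ∧ j.val < i
    let f2 : MvPolynomial (Fin d) R := ∑ β ∈ f.support.filter (fun β => ¬ ∃ j, β j ≠ 0 ∧ j.val < i),
      MvPolynomial.monomial β (f.coeff β)
    have hcoeff2 : ∀ β, f2.coeff β = if ∃ j, β j ≠ 0 ∧ j.val < i then 0 else f.coeff β := by
      intro β
      simp only [f2, MvPolynomial.coeff_sum, MvPolynomial.coeff_monomial]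
      rw [Finset.sum_ite_eq' ]
      by_cases h0 : f.coeff β = 0
      · simp [h0]
      · simp only [Finset.mem_filter, MvPolynomial.mem_support_iff]
        by_cases h1 : ∃ j, β j ≠ 0 ∧ j.val < i
        · rw [if_pos h1, if_neg (fun h => h.2 h1)]
        · rw [if_neg h1, if_pos ⟨h0, h1⟩]
    have hsplit : MvPolynomial.eval x f =
        (∑ β ∈ T, f.coeff β * ∏ j ∈ β.support, x j ^ β j) + MvPolynomial.eval x f2 := by
      rw [MvPolynomial.eval_eq, ← Finset.sum_filter_add_sum_filter_not _
        (fun β => ∃ j, β j ≠ 0 ∧ j.val < i)]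
      congr 1
      simp only [f2, map_sum, MvPolynomial.eval_monomial]
      rfl
    have ha : (∑ β ∈ T, f.coeff β * ∏ j ∈ β.support, x j ^ β j) ∈ Q * (J ^ n * C) := by
      refine Ideal.sum_mem _ fun β hβ => ?_
      simp only [T, Finset.mem_filter, MvPolynomial.mem_support_iff] at hβ
      exact hlow β hβ.1 hβ.2
    have hb : MvPolynomial.eval x f2 ∈ Q := by
      rw [hsplit] at hz
      exact (Ideal.add_mem_iff_right _ ((Ideal.mul_le_right (I := J ^ n * C) (J := Q)) (by rwa [mul_comm] at ha))).mp hz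
    refine ⟨_, ha, _, hb, ?_, hsplit⟩
    have hq := h.QR_quot i hi (n + 1) (MvPolynomial.map (Ideal.Quotient.mk Q) f2) (by
      intro β
      refine ⟨trivial, fun h0 => ?_⟩
      rw [MvPolynomial.coeff_map] at h0
      have h1 : f2.coeff β ≠ 0 := fun h => h0 (by rw [h, map_zero])
      rw [hcoeff2] at h1
      split_ifs at h1 with h2
      · exact absurd rfl h1
      · push Not at h2
        exact ⟨((hf β).2 h1).1, h2⟩) (by
      have : MvPolynomial.eval (fun j => Ideal.Quotient.mk Q (x j))
          (MvPolynomial.map (Ideal.Quotient.mk Q) f2) = Ideal.Quotient.mk Q (MvPolynomial.eval x f2) := by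
        rw [MvPolynomial.eval_map]; exact (MvPolynomial.eval₂_comp _ _ _).symm
      rw [this, Ideal.Quotient.eq_zero_iff_mem.mpr hb]
      exact Ideal.zero_mem _)
    have hcJ : ∀ β, f2.coeff β ∈ J := by
      intro β
      have h1 := hq β
      rw [MvPolynomial.coeff_map, ← Set.image_image (Ideal.Quotient.mk _) x, ← Ideal.map_span,
        ← Ideal.mem_comap,
        Ideal.comap_map_of_surjective _ Ideal.Quotient.mk_surjective, ← RingHom.ker_eq_comap_bot,
        Ideal.mk_ker] at h1
      refine (sup_le ?_ hQJ : _ ≤ J) h1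
      rw [hJ']; exact Ideal.span_mono (Set.image_mono (Set.subset_univ _))
    have h9 : MvPolynomial.eval x f2 ∈ Ideal.span (x '' Set.univ) ^ (n + 1) * J := by
      apply eval_mem_of_Wf
      intro β
      refine ⟨hcJ β, fun h1 => ?_⟩
      rw [hcoeff2] at h1
      split_ifs at h1 with h2
      · exact absurd rfl h1
      · exact (hf β).2 h1
    rwa [← hJ', ← pow_succ] at h9
  have iter : ∀ (N n : ℕ) (z : R), z ∈ Q → z ∈ J ^ (n + 1) → z ∈ Q * J ^ n ⊔ J ^ (n + 1 + N) := by
    intro N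
    induction N with
    | zero => intro n z _ hz; exact (le_sup_right : _ ≤ Q * J ^ n ⊔ _) hz
    | succ N ih =>
      intro n z hz hz'
      obtain ⟨a, ha, b, hb, hb', rfl⟩ := step ⊤ n z hz (by simpa [Ideal.mul_top] using hz')
      rw [Ideal.mul_top] at ha
      refine Ideal.add_mem _ ((le_sup_left : Q * J ^ n ≤ _) ha) ?_
      refine (sup_le_sup ?_ ?_ : Q * J ^ (n + 1) ⊔ J ^ (n + 1 + 1 + N) ≤ _) (ih (n + 1) b hb hb')
      · exact Ideal.mul_mono_right (Ideal.pow_le_pow_right (by omega))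
      · exact Ideal.pow_le_pow_right (by omega)
  obtain ⟨a, ha, b, hb, hb', rfl⟩ := step C n z hz hz'
  refine Ideal.add_mem _ ha ?_
  refine krull_sup _ J hJt fun N => ?_
  refine (sup_le_sup ?_ ?_ : Q * J ^ (n + 1) ⊔ J ^ (n + 1 + 1 + N) ≤ _) (iter N (n + 1) b hb hb')
  · refine Ideal.mul_mono_right ?_
    rw [pow_succ]; exact Ideal.mul_mono_right hC
  · exact Ideal.pow_le_pow_right (by omega)

end C
end SallyAux

namespace SallyAux
section D
variable {A W : Type*} [CommRing A] [CommRing W] [Algebra A W]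

/-- almost integral elements are integral -/
lemma isIntegral_of_almost [IsNoetherianRing A]
    (hinj : Function.Injective (algebraMap A W)) {u : A}
    (hu : IsUnit (algebraMap A W u)) {w : W} {k : ℕ}
    (hk : ∀ i, u ^ k • w ^ i ∈ (1 : Submodule A W)) : IsIntegral A w := by
  let U : Submodule A W := Submodule.comap (LinearMap.lsmul A W (u ^ k)) 1
  have hN : IsNoetherian A (1 : Submodule A W) := by
    have : (1 : Submodule A W) = LinearMap.range (Algebra.linearMap A W) := Submodule.one_eq_range
    rw [this]
    exact isNoetherian_of_surjective (f := (Algebra.linearMap A W).rangeRestrict)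
      (LinearMap.range_rangeRestrict _)
  have hU : IsNoetherian A U := by
    let g : U →ₗ[A] (1 : Submodule A W) :=
      ((LinearMap.lsmul A W (u ^ k)).comp U.subtype).codRestrict 1 (fun x => x.2)
    refine isNoetherian_of_injective g ?_
    intro x y hxy
    have h1 : u ^ k • (x : W) = u ^ k • (y : W) := congrArg Subtype.val hxy
    rw [Algebra.smul_def, Algebra.smul_def, map_pow] at h1
    exact Subtype.ext ((hu.pow k).mul_left_cancel h1)
  have hle : Subalgebra.toSubmodule (Algebra.adjoin A {w}) ≤ U := by
    rw [Algebra.adjoin_eq_span, Submodule.span_le]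
    intro y hy
    obtain ⟨i, rfl⟩ := Submonoid.mem_closure_singleton.mp hy
    exact hk i
  have hfg : (Subalgebra.toSubmodule (Algebra.adjoin A {w})).FG := by
    have : IsNoetherian A (Subalgebra.toSubmodule (Algebra.adjoin A {w})) :=
      isNoetherian_of_le hle
    exact Module.Finite.iff_fg.mp inferInstance
  exact IsIntegral.of_mem_of_fg _ hfg w (Algebra.subset_adjoin rfl)

lemma almost_of_isIntegral {u : A}
    (hW : ∀ w : W, ∃ n : ℕ, u ^ n • w ∈ (1 : Submodule A W)) {w : W} (hw : IsIntegral A w) :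
    ∃ k : ℕ, ∀ i, u ^ k • w ^ i ∈ (1 : Submodule A W) := by
  classical
  obtain ⟨s, hs⟩ := hw.fg_adjoin_singleton
  choose n hn using hW
  refine ⟨s.sup n, fun i => ?_⟩
  have h1 : w ^ i ∈ Submodule.span A (s : Set W) := by
    rw [hs]; exact Subalgebra.pow_mem (Algebra.adjoin A {w}) (Algebra.subset_adjoin (Set.mem_singleton w)) i
  have h2 : Submodule.span A (s : Set W) ≤
      Submodule.comap (LinearMap.lsmul A W (u ^ s.sup n)) 1 := by
    rw [Submodule.span_le]
    intro y hy
    have h3 : n y ≤ s.sup n := Finset.le_sup hy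
    change u ^ s.sup n • y ∈ (1 : Submodule A W)
    rw [← Nat.sub_add_cancel h3, pow_add, mul_smul]
    exact Submodule.smul_mem _ _ (hn y)
  exact h2 h1

/-- elements regular modulo `u` are regular modulo `B` -/
lemma integral_cancel [IsNoetherianRing A]
    (hinj : Function.Injective (algebraMap A W)) {u : A}
    (hu : IsUnit (algebraMap A W u))
    (hW : ∀ w : W, ∃ n : ℕ, u ^ n • w ∈ (1 : Submodule A W))
    {s : A} (hs : ∀ b, s * b ∈ Ideal.span {u} → b ∈ Ideal.span {u}) {w : W}
    (hw : IsIntegral A (s • w)) : IsIntegral A w := by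
  have hureg : ∀ a b : A, u * a = u * b → a = b := by
    intro a b h
    apply hinj
    have := congrArg (algebraMap A W) h
    rw [map_mul, map_mul] at this
    exact hu.mul_left_cancel this
  have hsi : ∀ i b, s ^ i * b ∈ Ideal.span {u} → b ∈ Ideal.span {u} := by
    intro i
    induction i with
    | zero => intro b hb; simpa using hb
    | succ i ih => intro b hb; apply ih; apply hs; rwa [← mul_assoc, ← pow_succ']
  have hsn : ∀ i n b, s ^ i * b ∈ Ideal.span {u ^ n} → b ∈ Ideal.span {u ^ n} := by
    intro i n
    induction n with
    | zero => intro b _; simp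
    | succ n ih =>
      intro b hb
      rw [Ideal.mem_span_singleton] at hb
      obtain ⟨c, hc⟩ := hb
      obtain ⟨b', rfl⟩ := Ideal.mem_span_singleton.mp (hsi i b (by
        rw [Ideal.mem_span_singleton, hc]; exact ⟨u ^ n * c, by ring⟩))
      have h1 : b' ∈ Ideal.span {u ^ n} := by
        apply ih
        rw [Ideal.mem_span_singleton]
        refine ⟨c, hureg _ _ ?_⟩
        rw [← mul_assoc u (u ^ n) c, ← pow_succ', ← hc]; ring
      rw [Ideal.mem_span_singleton] at h1 ⊢
      rw [pow_succ']
      exact mul_dvd_mul_left u h1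
  obtain ⟨k, hk⟩ := almost_of_isIntegral hW hw
  refine isIntegral_of_almost hinj hu (k := k) fun i => ?_
  obtain ⟨N, hN⟩ := hW (u ^ k • w ^ i)
  obtain ⟨a, ha⟩ := Submodule.mem_one.mp (hk i)
  obtain ⟨b, hb⟩ := Submodule.mem_one.mp hN
  have h1 : b ∈ Ideal.span {u ^ N} := by
    apply hsn i
    rw [Ideal.mem_span_singleton]
    refine ⟨a, hinj ?_⟩
    rw [map_mul, map_mul, hb, ha]
    simp only [Algebra.smul_def, map_pow]
    ring
  obtain ⟨c, rfl⟩ := Ideal.mem_span_singleton.mp h1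
  rw [Submodule.mem_one]
  refine ⟨c, (hu.pow N).mul_left_cancel ?_⟩
  rw [map_mul, map_pow] at hb
  rw [hb, Algebra.smul_def, map_pow]

end D
end SallyAux

namespace SallyAux
section E
variable {A : Type*} [CommRing A] (p : Ideal A) [p.IsPrime]

/-- length of the localization at `p` -/
noncomputable def mu (N : Type*) [AddCommGroup N] [Module A N] : ℕ∞ :=
  Module.length (Localization.AtPrime p) (LocalizedModule p.primeCompl N)

variable {N M P : Type*} [AddCommGroup N] [Module A N] [AddCommGroup M] [Module A M]
  [AddCommGroup P] [Module A P]

lemma mu_exact (f : N →ₗ[A] M) (g : M →ₗ[A] P) (hf : Function.Injective f)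
    (hg : Function.Surjective g) (h : Function.Exact f g) : mu p M = mu p N + mu p P := by
  unfold mu
  exact Module.length_eq_add_of_exact (LocalizedModule.map p.primeCompl f)
    (LocalizedModule.map p.primeCompl g)
    (LocalizedModule.map_injective p.primeCompl f hf)
    (LocalizedModule.map_surjective p.primeCompl g hg)
    (LocalizedModule.map_exact p.primeCompl f g h)

lemma mu_congr (e : N ≃ₗ[A] M) : mu p N = mu p M := by
  have := mu_exact p (0 : PUnit →ₗ[A] N) e.toLinearMap (Function.injective_of_subsingleton _)
    e.surjective (by
      intro y; simp only [LinearEquiv.coe_coe, LinearEquiv.map_eq_zero_iff, LinearMap.zero_apply, Set.mem_range, exists_const]; exact eq_comm)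
  rw [this]
  have h0 : mu p (PUnit) = 0 := by
    unfold mu
    rw [Module.length_eq_zero_iff]
    refine ⟨fun a b => ?_⟩
    induction a using LocalizedModule.induction_on with | _ m s => ?_
    induction b using LocalizedModule.induction_on with | _ m' s' => ?_
    rw [LocalizedModule.mk_eq]
    exact ⟨1, Subsingleton.elim _ _⟩
  rw [h0, zero_add]

lemma mu_pos {x : N} (hx : ∀ s ∉ p, s • x ≠ 0) : 1 ≤ mu p N := by
  rw [Order.one_le_iff_ne_zero]
  unfold mu
  rw [Ne, Module.length_eq_zero_iff]
  intro h
  have h1 : LocalizedModule.mk (S := p.primeCompl) x 1 = LocalizedModule.mk 0 1 := Subsingleton.elim _ _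
  rw [LocalizedModule.mk_eq] at h1
  obtain ⟨c, hc⟩ := h1
  refine hx c c.2 ?_
  simpa [Submonoid.smul_def] using hc

lemma mu_quot_ne_top [IsNoetherianRing A] {u : A} (hup : u ∈ p) {c : ℕ}
    (hc : p ^ c ≤ Ideal.span {u}) : mu p (A ⧸ Ideal.span {u}) ≠ ⊤ := by
  let A' := Localization.AtPrime p
  let u' : A' := algebraMap A A' u
  have hu' : u' ∈ maximalIdeal A' := by
    rw [← Localization.AtPrime.map_eq_maximalIdeal]
    exact Ideal.mem_map_of_mem _ hup
  have hnt : Nontrivial (A' ⧸ Ideal.span {u'}) := by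
    rw [Ideal.Quotient.nontrivial_iff, Ne, Ideal.span_singleton_eq_top]
    exact hu'
  have hloc : IsLocalRing (A' ⧸ Ideal.span {u'}) :=
    IsLocalRing.of_surjective' (Ideal.Quotient.mk _) Ideal.Quotient.mk_surjective
  have hart : IsArtinianRing (A' ⧸ Ideal.span {u'}) := by
    rw [isArtinianRing_iff_isNilpotent_maximalIdeal]
    refine ⟨c, ?_⟩
    have h1 : maximalIdeal (A' ⧸ Ideal.span {u'}) =
        (maximalIdeal A').map (Ideal.Quotient.mk (Ideal.span {u'})) := by
      have := IsLocalHom.of_surjective (Ideal.Quotient.mk (Ideal.span {u'})) Ideal.Quotient.mk_surjective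
      have hc := IsLocalRing.maximalIdeal_comap (Ideal.Quotient.mk (Ideal.span {u'}))
      rw [← hc, Ideal.map_comap_of_surjective _ Ideal.Quotient.mk_surjective]
    rw [h1, ← Ideal.map_pow, ← Localization.AtPrime.map_eq_maximalIdeal, ← Ideal.map_pow,
      Ideal.zero_eq_bot, Ideal.map_eq_bot_iff_le_ker, Ideal.mk_ker, Ideal.map_le_iff_le_comap]
    refine hc.trans ?_
    rw [Ideal.span_singleton_le_iff_mem]
    exact Ideal.subset_span rfl
  have hlen : Module.length A' (A' ⧸ Ideal.span {u'}) ≠ ⊤ := by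
    rw [Module.length_eq_of_surjective (S := A') (R := A' ⧸ Ideal.span {u'})
      (M := A' ⧸ Ideal.span {u'}) Ideal.Quotient.mk_surjective]
    exact Module.length_ne_top
  let X := LocalizedModule p.primeCompl (A ⧸ Ideal.span {u})
  let g : A' →ₗ[A'] X := LinearMap.toSpanSingleton A' X
    (LocalizedModule.mk (Ideal.Quotient.mk _ 1 : A ⧸ Ideal.span {u}) 1)
  have hg : Function.Surjective g := by
    intro y
    induction y using LocalizedModule.induction_on with | _ m s => ?_
    obtain ⟨m, rfl⟩ := Ideal.Quotient.mk_surjective m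
    refine ⟨Localization.mk m s, ?_⟩
    simp only [g, X, LinearMap.toSpanSingleton_apply]
    rw [LocalizedModule.mk_smul_mk, mul_one]
    congr 1
    change Ideal.Quotient.mk _ (m * 1) = _
    rw [mul_one]
  have hker : Ideal.span {u'} ≤ LinearMap.ker g := by
    rw [Ideal.span_singleton_le_iff_mem, LinearMap.mem_ker]
    simp only [g, X, u', LinearMap.toSpanSingleton_apply]
    rw [algebraMap_smul, LocalizedModule.smul'_mk]
    have : u • (Ideal.Quotient.mk (Ideal.span {u}) 1) = 0 := by
      change Ideal.Quotient.mk _ (u * 1) = 0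
      rw [mul_one, Ideal.Quotient.eq_zero_iff_mem]
      exact Ideal.subset_span rfl
    rw [this, LocalizedModule.zero_mk]
  have h2 := Module.length_le_of_surjective (Submodule.liftQ _ g hker) (by
    intro y
    obtain ⟨a, rfl⟩ := hg y
    exact ⟨Submodule.Quotient.mk a, rfl⟩)
  exact ne_top_of_le_ne_top hlen h2

variable {W : Type*} [AddCommGroup W] [Module A W]

/-- relative length -/
noncomputable def nu (X Y : Submodule A W) : ℕ∞ := mu p (Y ⧸ X.comap Y.subtype)

lemma nu_add {X Y Z : Submodule A W} (h1 : X ≤ Y) (h2 : Y ≤ Z) :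
    nu p X Z = nu p X Y + nu p Y Z := by
  unfold nu
  have hA : X.comap Y.subtype ≤ (X.comap Z.subtype).comap (Submodule.inclusion h2) :=
    fun x hx => hx
  have hB : X.comap Z.subtype ≤ (Y.comap Z.subtype).comap LinearMap.id := fun x hx => h1 hx
  refine mu_exact p (Submodule.mapQ _ _ (Submodule.inclusion h2) hA)
    (Submodule.mapQ _ _ LinearMap.id hB) ?_ ?_ ?_
  · intro a b hab
    obtain ⟨a, rfl⟩ := Submodule.Quotient.mk_surjective _ a
    obtain ⟨b, rfl⟩ := Submodule.Quotient.mk_surjective _ b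
    simp only [Submodule.mapQ_apply] at hab
    rw [Submodule.Quotient.eq] at hab ⊢
    exact hab
  · intro a
    obtain ⟨a, rfl⟩ := Submodule.Quotient.mk_surjective _ a
    exact ⟨Submodule.Quotient.mk a, rfl⟩
  · intro a
    obtain ⟨a, rfl⟩ := Submodule.Quotient.mk_surjective _ a
    rw [Submodule.mapQ_apply, Submodule.Quotient.mk_eq_zero]
    constructor
    · intro h
      exact ⟨Submodule.Quotient.mk ⟨a, h⟩, rfl⟩
    · rintro ⟨b, hb⟩
      obtain ⟨b, rfl⟩ := Submodule.Quotient.mk_surjective _ b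
      rw [Submodule.mapQ_apply, Submodule.Quotient.eq] at hb
      have h3 : (b : W) - a ∈ X := hb
      have h4 := Y.sub_mem b.2 (h1 h3)
      simpa using h4

lemma nu_map (e : W ≃ₗ[A] W) (X Y : Submodule A W) :
    nu p (X.map e.toLinearMap) (Y.map e.toLinearMap) = nu p X Y := by
  unfold nu
  refine (mu_congr p (Submodule.Quotient.equiv _ _ (e.submoduleMap Y) ?_)).symm
  ext ⟨z, hz⟩
  obtain ⟨y, hy, rfl⟩ := hz
  simp only [Submodule.mem_map, Submodule.mem_comap]
  constructor
  · rintro ⟨x, hx, hxy⟩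
    have := congrArg Subtype.val hxy
    exact ⟨x, hx, this⟩
  · rintro ⟨x, hx, hxy⟩
    have h1 : x = y := e.injective hxy
    subst h1
    exact ⟨⟨x, hy⟩, hx, rfl⟩

lemma nu_pos {X Y : Submodule A W} {y : W} (hy : y ∈ Y) (h : ∀ s ∉ p, s • y ∉ X) : 1 ≤ nu p X Y := by
  refine mu_pos p (x := Submodule.Quotient.mk ⟨y, hy⟩) fun s hs h0 => h s hs ?_
  rw [← Submodule.Quotient.mk_smul, Submodule.Quotient.mk_eq_zero] at h0
  exact h0

lemma nu_krull (e : W ≃ₗ[A] W) (O M : Submodule A W) (hOM : O ≤ M)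
    (heM : ∀ X : Submodule A W, X.map e.toLinearMap ≤ X) {n : ℕ}
    (hn : M.map (e ^ n).toLinearMap ≤ O) (hfin : nu p (O.map e.toLinearMap) O ≠ ⊤) :
    nu p (M.map e.toLinearMap) M = nu p (O.map e.toLinearMap) O := by
  have hpow : ∀ n : ℕ, ∀ X : Submodule A W, X.map (e ^ n).toLinearMap ≤ X ∧
      nu p (O.map (e ^ n).toLinearMap) O ≠ ⊤ := by
    intro n
    induction n with
    | zero =>
      intro X
      have : ∀ X : Submodule A W, X.map (e ^ 0).toLinearMap = X := fun X => by
        rw [pow_zero]; exact Submodule.map_id X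
      rw [this, this]
      refine ⟨le_rfl, ?_⟩
      have := nu_add p (le_rfl : O ≤ O) (le_rfl : O ≤ O)
      unfold nu mu
      rw [Module.length_eq_zero_iff.mpr]
      · simp
      · refine ⟨fun a b => ?_⟩
        induction a using LocalizedModule.induction_on with | _ m s => ?_
        induction b using LocalizedModule.induction_on with | _ m' s' => ?_
        obtain ⟨m, rfl⟩ := Submodule.Quotient.mk_surjective _ m
        obtain ⟨m', rfl⟩ := Submodule.Quotient.mk_surjective _ m'
        have h0 : ∀ m : O, (Submodule.Quotient.mk m : O ⧸ O.comap O.subtype) = 0 := fun m => by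
          rw [Submodule.Quotient.mk_eq_zero]; exact m.2
        rw [h0, h0, LocalizedModule.zero_mk, LocalizedModule.zero_mk]
    | succ n ih =>
      intro X
      have hs : ∀ X : Submodule A W, X.map (e ^ (n + 1)).toLinearMap =
          (X.map (e ^ n).toLinearMap).map e.toLinearMap := fun X => by
        rw [← Submodule.map_comp, pow_succ']; rfl
      refine ⟨by rw [hs]; exact (heM _).trans (ih X).1, ?_⟩
      rw [hs, nu_add p (Submodule.map_mono (ih O).1) (heM O), nu_map]
      exact WithTop.add_ne_top.mpr ⟨(ih O).2, hfin⟩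
  have h1 := nu_add p (heM O) hOM
  have h2 := nu_add p (Submodule.map_mono hOM) (heM M)
  rw [nu_map] at h2
  have h3 : nu p O M ≠ ⊤ := by
    rw [← nu_map p (e ^ n)]
    have h4 := nu_add p (Submodule.map_mono (f := (e ^ n).toLinearMap) hOM) hn
    have h5 := (hpow n O).2
    rw [h4] at h5
    exact (WithTop.add_ne_top.mp h5).1
  rw [h1, add_comm] at h2
  exact (ENat.add_right_injective_of_ne_top h3 h2).symm
end E
end SallyAux

namespace SallyAux
section F
variable {A B : Type*} [CommRing A] [CommRing B] [Algebra A B]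

/-- saturated submodules containing `uB` -/
def Sat (p : Ideal A) (u : A) (N : Submodule A B) : Prop :=
  (∀ b : B, u • b ∈ N) ∧ ∀ s ∉ p, ∀ b, s • b ∈ N → b ∈ N

/-- uniform bound on chains of saturated submodules -/
def ChainB (B : Type*) [CommRing B] [Algebra A B] (p : Ideal A) (u : A) : Prop :=
  ∃ q : ℕ, ∀ N : ℕ → Submodule A B, (∀ i ≤ q, Sat p u (N i)) →
    ¬ ∀ i ≤ q, N i < N (i + 1)

variable {p : Ideal A} [hp : p.IsPrime] {u : A}

lemma sat_max (hc : ChainB B p u) (P : Submodule A B → Prop) (hP : ∀ N, P N → Sat p u N)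
    {N₀ : Submodule A B} (h0 : P N₀) : ∃ N, P N ∧ ∀ N', P N' → ¬ N < N' := by
  by_contra hcon
  push Not at hcon
  choose! f hf1 hf2 using hcon
  obtain ⟨q, hq⟩ := hc
  have hPi : ∀ i, P (f^[i] N₀) := by
    intro i
    induction i with
    | zero => exact h0
    | succ i ih => rw [Function.iterate_succ_apply']; exact hf1 _ ih
  refine hq (fun i => f^[i] N₀) (fun i _ => hP _ (hPi i)) fun i _ => ?_
  rw [Function.iterate_succ_apply']
  exact hf2 _ (hPi i)

lemma sat_min (hc : ChainB B p u) (P : Submodule A B → Prop) (hP : ∀ N, P N → Sat p u N)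
    {N₀ : Submodule A B} (h0 : P N₀) : ∃ N, P N ∧ ∀ N', P N' → ¬ N' < N := by
  by_contra hcon
  push Not at hcon
  choose! f hf1 hf2 using hcon
  obtain ⟨q, hq⟩ := hc
  have hPi : ∀ i, P (f^[i] N₀) := by
    intro i
    induction i with
    | zero => exact h0
    | succ i ih => rw [Function.iterate_succ_apply']; exact hf1 _ ih
  refine hq (fun i => f^[q + 1 - i] N₀) (fun i _ => hP _ (hPi _)) fun i hi => ?_
  have : q + 1 - i = (q + 1 - (i + 1)) + 1 := by omega
  rw [this, Function.iterate_succ_apply']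
  exact hf2 _ (hPi _)

/-- saturation -/
def satur (p : Ideal A) [hp : p.IsPrime] (N : Submodule A B) : Submodule A B where
  carrier := {b | ∃ s ∉ p, s • b ∈ N}
  zero_mem' := ⟨1, fun h => hp.ne_top ((Ideal.eq_top_iff_one _).mpr h), by simp⟩
  add_mem' := by
    rintro a b ⟨s, hs, h1⟩ ⟨t, ht, h2⟩
    refine ⟨s * t, fun h => (hp.mem_or_mem h).elim hs ht, ?_⟩
    rw [smul_add]
    refine N.add_mem ?_ ?_
    · rw [mul_comm, mul_smul]; exact N.smul_mem _ h1
    · rw [mul_smul]; exact N.smul_mem _ h2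
  smul_mem' := by
    rintro a b ⟨s, hs, h1⟩
    exact ⟨s, hs, by rw [smul_comm]; exact N.smul_mem _ h1⟩

lemma le_satur (N : Submodule A B) : N ≤ satur p N := fun b hb =>
  ⟨1, fun h => hp.ne_top ((Ideal.eq_top_iff_one _).mpr h), by simpa using hb⟩

lemma satur_sat {N : Submodule A B} (hN : ∀ b : B, u • b ∈ N) : Sat p u (satur p N) := by
  refine ⟨fun b => le_satur _ (hN b), ?_⟩
  rintro s hs b ⟨t, ht, h⟩
  exact ⟨t * s, fun h => (hp.mem_or_mem h).elim ht hs, by rwa [mul_smul]⟩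

lemma fg_up_to (hc : ChainB B p u) (N : Submodule A B) (hN : ∀ b : B, u • b ∈ N) :
    ∃ Y : Finset B, (∀ y ∈ Y, y ∈ N) ∧ ∀ n ∈ N, ∃ s ∉ p,
      s • n ∈ Submodule.span A (Y : Set B) ⊔ LinearMap.range (LinearMap.lsmul A B u) := by
  classical
  obtain ⟨N', ⟨Y, hY, rfl⟩, hmax⟩ := sat_max hc (fun N' => ∃ Y : Finset B, (∀ y ∈ Y, y ∈ N) ∧
    N' = satur p (Submodule.span A (Y : Set B) ⊔ LinearMap.range (LinearMap.lsmul A B u)))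
    (by
      rintro N' ⟨Y, hY, rfl⟩
      exact satur_sat fun b => Submodule.mem_sup_right ⟨b, rfl⟩)
    ⟨∅, by simp, rfl⟩
  refine ⟨Y, hY, fun n hn => ?_⟩
  by_contra hcon
  refine hmax _ ⟨insert n Y, ?_, rfl⟩ ?_
  · intro y hy
    rcases Finset.mem_insert.mp hy with rfl | hy
    · exact hn
    · exact hY _ hy
  · refine lt_of_le_of_ne ?_ ?_
    · rintro b ⟨s, hs, hb⟩
      refine ⟨s, hs, (show Submodule.span A (Y : Set B) ⊔ LinearMap.range (LinearMap.lsmul A B u) ≤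
        Submodule.span A ((insert n Y : Finset B) : Set B) ⊔
          LinearMap.range (LinearMap.lsmul A B u) from
          sup_le_sup_right (Submodule.span_mono ?_) _) hb⟩
      intro z hz; simp only [Finset.coe_insert, Set.mem_insert_iff]; exact Or.inr hz
    · intro heq
      apply hcon
      have : n ∈ satur p (Submodule.span A ((insert n Y : Finset B) : Set B) ⊔
          LinearMap.range (LinearMap.lsmul A B u)) :=
        le_satur _ (Submodule.mem_sup_left (Submodule.subset_span (by simp)))
      rw [← heq] at this
      exact this

lemma exists_lift_fg {N P : Type*} [AddCommGroup N] [Module A N] [AddCommGroup P] [Module A P]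
    [IsNoetherian A P] (φ : N →ₗ[A] P) :
    ∃ F : Finset N, ∀ n : N, n ∈ Submodule.span A (F : Set N) ⊔ LinearMap.ker φ := by
  classical
  obtain ⟨t, ht⟩ := IsNoetherian.noetherian (LinearMap.range φ)
  have h1 : ∀ x ∈ t, ∃ n, φ n = x := fun x hx => by
    have : x ∈ LinearMap.range φ := ht ▸ Submodule.subset_span hx
    exact this
  choose! f hf using h1
  refine ⟨t.image f, fun n => ?_⟩
  have h2 : (Submodule.span A ((t.image f : Finset N) : Set N)).map φ = LinearMap.range φ := by
    rw [Submodule.map_span, ← ht]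
    congr 1
    ext x
    simp only [Finset.coe_image, Set.mem_image, exists_exists_and_eq_and, Finset.mem_coe]
    constructor
    · rintro ⟨a, ha, rfl⟩; rwa [hf a ha]
    · intro hx; exact ⟨x, hx, hf x hx⟩
  have h3 : φ n ∈ (Submodule.span A ((t.image f : Finset N) : Set N)).map φ := h2 ▸ ⟨n, rfl⟩
  obtain ⟨m, hm, hmn⟩ := h3
  rw [← add_sub_cancel m n]
  exact Submodule.add_mem_sup hm (by rw [LinearMap.mem_ker, map_sub, hmn, sub_self])

theorem finite_mod_u [IsNoetherianRing A] {c : ℕ} (hpc : p ^ c ≤ Ideal.span {u})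
    [Algebra.IsIntegral A B]
    (hc : ChainB B p u)
    (hreg : ∀ b b' : B, u • b = u • b' → b = b')
    (hsat : ∀ s ∉ p, ∀ b b' : B, s • b = u • b' → ∃ b'', b = u • b'')
    (hInt : ∀ Q : Ideal B, Q.FG → algebraMap A B u ∈ Q → ∀ y : B,
      (∀ q ∈ Q, ∃ r ∈ Q, y * q = u • r) → ∃ b, y = u • b)
    (hN2 : ∀ M : Ideal B, M.IsPrime → (∀ a, algebraMap A B a ∈ M ↔ a ∈ p) →
      (∃ l : Finset B, ∀ b : B, ∃ s ∉ p, s • (Ideal.Quotient.mk M b) ∈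
        Submodule.span A ((fun b => Ideal.Quotient.mk M b) '' (l : Set B))) →
        Module.Finite A (B ⧸ M)) :
    ∃ F : Finset B, ∀ b : B, b ∈ Submodule.span A (F : Set B) ⊔
      LinearMap.range (LinearMap.lsmul A B u) := by
  classical
  have h1p : (1 : A) ∉ p := fun h => hp.ne_top ((Ideal.eq_top_iff_one _).mpr h)
  obtain ⟨N, ⟨hNs, ⟨I, rfl⟩, F, hF⟩, hmin⟩ := sat_min hc (fun N => Sat p u N ∧
      (∃ I : Ideal B, N = I.restrictScalars A) ∧
      ∃ F : Finset B, ∀ b : B, b ∈ Submodule.span A (F : Set B) ⊔ N) (fun N h => h.1)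
    (N₀ := ⊤) ⟨⟨fun _ => trivial, fun _ _ _ _ => trivial⟩, ⟨⊤, rfl⟩, ∅, by simp⟩
  by_cases hI : ∀ y ∈ I, ∃ b, y = u • b
  · refine ⟨F, fun b => ?_⟩
    refine (show Submodule.span A (F : Set B) ⊔ I.restrictScalars A ≤ Submodule.span A (F : Set B) ⊔
      LinearMap.range (LinearMap.lsmul A B u) from sup_le_sup_left ?_ _) (hF b)
    intro y hy
    obtain ⟨b, rfl⟩ := hI y hy
    exact ⟨b, rfl⟩
  exfalso
  push Not at hI
  obtain ⟨y₀, hy₀, hy₀'⟩ := hI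
  -- colon ideals
  let col : B → Ideal B := fun y =>
    { carrier := {b | ∃ z, b * y = u • z}
      zero_mem' := ⟨0, by simp⟩
      add_mem' := by
        rintro a b ⟨z, hz⟩ ⟨w, hw⟩
        exact ⟨z + w, by rw [add_mul, hz, hw, smul_add]⟩
      smul_mem' := by
        rintro a b ⟨z, hz⟩
        exact ⟨a * z, by rw [smul_eq_mul, mul_assoc, hz, mul_smul_comm]⟩ }
  have hcolsat : ∀ y, Sat p u ((col y).restrictScalars A) := by
    intro y
    refine ⟨fun b => ⟨b * y, by rw [smul_mul_assoc]⟩, ?_⟩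
    rintro s hs b ⟨z, hz⟩
    exact hsat s hs (b * y) z (by rw [← hz, smul_mul_assoc])
  obtain ⟨M', ⟨y, hy, hy', rfl⟩, hmax⟩ := sat_max hc (fun N => ∃ y ∈ I, (∀ b, y ≠ u • b) ∧
    N = (col y).restrictScalars A) (by rintro N ⟨y, _, _, rfl⟩; exact hcolsat y)
    ⟨y₀, hy₀, hy₀', rfl⟩
  set M := col y with hM
  have hMu : ∀ b : B, u • b ∈ M := (hcolsat y).1
  have hMs : ∀ s ∉ p, ∀ b, s • b ∈ M → b ∈ M := (hcolsat y).2
  have h1M : (1 : B) ∉ M := by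
    rintro ⟨z, hz⟩
    rw [one_mul] at hz
    exact hy' z hz
  have hMp : M.IsPrime := by
    refine ⟨fun h => h1M (h ▸ trivial), ?_⟩
    intro a b hab
    by_contra! hcon
    obtain ⟨ha, hb⟩ := hcon
    refine hmax _ ⟨b * y, I.mul_mem_left _ hy, ?_, rfl⟩ ?_
    · intro z hz; exact hb ⟨z, hz⟩
    · refine lt_of_le_of_ne ?_ ?_
      · rintro x ⟨z, hz⟩
        exact ⟨b * z, by rw [mul_left_comm, hz, mul_smul_comm]⟩
      · intro heq
        apply ha
        have : a ∈ (col (b * y)).restrictScalars A := by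
          obtain ⟨z, hz⟩ := hab
          exact ⟨z, by rw [← mul_assoc, hz]⟩
        rw [← heq] at this
        exact this
  have hker : ∀ a, algebraMap A B a ∈ M ↔ a ∈ p := by
    intro a
    constructor
    · intro h
      by_contra hap
      exact h1M (hMs a hap 1 (by rwa [Algebra.smul_def, mul_one]))
    · intro h
      obtain ⟨z, hz⟩ := Ideal.mem_span_singleton.mp (hpc (Ideal.pow_mem_pow h c))
      refine hMp.mem_of_pow_mem c ?_
      rw [← map_pow, hz, map_mul, ← Algebra.smul_def]
      exact hMu _
  obtain ⟨l, -, hl⟩ := fg_up_to hc (⊤ : Submodule A B) (fun _ => trivial)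
  have hfin : Module.Finite A (B ⧸ M) := by
    refine hN2 M hMp hker ⟨l, fun b => ?_⟩
    obtain ⟨s, hs, h⟩ := hl b trivial
    refine ⟨s, hs, ?_⟩
    obtain ⟨b1, h1, b2, ⟨b3, h3⟩, h12⟩ := Submodule.mem_sup.mp h
    have e1 : s • (Ideal.Quotient.mk M b) = Ideal.Quotient.mk M b1 := by
      change Ideal.Quotient.mk M (s • b) = _
      rw [← h12, map_add, ← h3]
      have : Ideal.Quotient.mk M (LinearMap.lsmul A B u b3) = 0 :=
        Ideal.Quotient.eq_zero_iff_mem.mpr (hMu b3)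
      rw [this, add_zero]
    rw [e1]
    have := Submodule.mem_map_of_mem (f := (Ideal.Quotient.mkₐ A M).toLinearMap) h1
    rw [Submodule.map_span] at this
    exact this
  have hnoeth : IsNoetherian A (B ⧸ M) := inferInstance
  -- Q
  let Q : Ideal B :=
    { carrier := {b | ∀ z ∈ I, ∃ w, b * z = u • w}
      zero_mem' := fun z _ => ⟨0, by simp⟩
      add_mem' := by
        intro a b ha hb z hz
        obtain ⟨w, hw⟩ := ha z hz
        obtain ⟨w', hw'⟩ := hb z hz
        exact ⟨w + w', by rw [add_mul, hw, hw', smul_add]⟩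
      smul_mem' := by
        intro a b hb z hz
        obtain ⟨w, hw⟩ := hb z hz
        exact ⟨a * w, by rw [smul_eq_mul, mul_assoc, hw, mul_smul_comm]⟩ }
  have hQM : Q ≤ M := fun q hq => hq y hy
  have hQu : ∀ b : B, u • b ∈ Q := fun b z _ => ⟨b * z, by rw [smul_mul_assoc]⟩
  obtain ⟨Y₀, hY₀, hY₀'⟩ := fg_up_to hc (Q.restrictScalars A) hQu
  let Y : Finset B := insert (algebraMap A B u) Y₀
  have huQ : algebraMap A B u ∈ Q := by
    have := hQu 1
    rwa [Algebra.smul_def, mul_one] at this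
  have hYQ : ∀ g ∈ Y, g ∈ Q := by
    intro g hg
    rcases Finset.mem_insert.mp hg with rfl | hg
    · exact huQ
    · exact hY₀ g hg
  have hYs : ∀ q ∈ Q, ∃ s ∉ p, s • q ∈ Ideal.span (Y : Set B) := by
    intro q hq
    obtain ⟨s, hs, h⟩ := hY₀' q hq
    refine ⟨s, hs, ?_⟩
    obtain ⟨b1, h1, b2, ⟨b3, h3⟩, h12⟩ := Submodule.mem_sup.mp h
    rw [← h12]
    refine Ideal.add_mem _ ?_ ?_
    · have h4 : Submodule.span A (Y₀ : Set B) ≤ (Ideal.span (Y : Set B)).restrictScalars A := by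
        rw [Submodule.span_le]
        intro g hg
        exact Ideal.subset_span (by simp only [Y, Finset.coe_insert]; exact Or.inr hg)
      exact h4 h1
    · rw [← h3]
      change u • b3 ∈ _
      rw [Algebra.smul_def]
      exact Ideal.mul_mem_right _ _ (Ideal.subset_span (by simp [Y]))
  -- I'
  let I' : Ideal B :=
    { carrier := {z | z ∈ I ∧ ∀ q ∈ Q, ∃ w ∈ M, q * z = u • w}
      zero_mem' := ⟨I.zero_mem, fun q _ => ⟨0, M.zero_mem, by simp⟩⟩
      add_mem' := by
        rintro a b ⟨ha, ha'⟩ ⟨hb, hb'⟩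
        refine ⟨I.add_mem ha hb, fun q hq => ?_⟩
        obtain ⟨w, hw, h⟩ := ha' q hq
        obtain ⟨w', hw', h'⟩ := hb' q hq
        exact ⟨w + w', M.add_mem hw hw', by rw [mul_add, h, h', smul_add]⟩
      smul_mem' := by
        rintro a b ⟨hb, hb'⟩
        refine ⟨I.mul_mem_left _ hb, fun q hq => ?_⟩
        obtain ⟨w, hw, h⟩ := hb' q hq
        exact ⟨a * w, M.mul_mem_left _ hw, by
          rw [smul_eq_mul, mul_left_comm, h, mul_smul_comm]⟩ }
  have hI'sat : Sat p u (I'.restrictScalars A) := by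
    refine ⟨fun b => ⟨hNs.1 b, fun q hq => ⟨q * b, M.mul_mem_right _ (hQM hq), by
      rw [mul_smul_comm]⟩⟩, ?_⟩
    rintro s hs z ⟨hz, hz'⟩
    have hzI : z ∈ I := hNs.2 s hs z hz
    refine ⟨hzI, fun q hq => ?_⟩
    obtain ⟨w, hw⟩ := hq z hzI
    refine ⟨w, ?_, hw⟩
    obtain ⟨w', hw', h⟩ := hz' q hq
    refine hMs s hs w ?_
    have : s • w = w' := hreg _ _ (by rw [← h, mul_smul_comm, hw, smul_comm])
    rwa [this]
  refine hmin _ ⟨hI'sat, ⟨I', rfl⟩, ?_⟩ (lt_of_le_of_ne (fun z hz => hz.1) ?_)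
  · -- finiteness
    let δ := LinearEquiv.ofInjective (LinearMap.lsmul A B u) (fun b b' h => hreg b b' h)
    have hδ : ∀ x, u • δ.symm x = x := fun x => by
      have := congrArg Subtype.val (δ.apply_symm_apply x)
      exact this
    let φ : Y → (I.restrictScalars A) →ₗ[A] B := fun q => δ.symm.toLinearMap ∘ₗ
      LinearMap.codRestrict _ ((LinearMap.mulLeft A (q : B)) ∘ₗ (I.restrictScalars A).subtype)
        (fun z => by
          obtain ⟨w, hw⟩ := hYQ q q.2 z z.2
          exact ⟨w, hw.symm⟩)
    have hφ : ∀ (q : Y) (z : I.restrictScalars A), (q : B) * (z : B) = u • φ q z := by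
      intro q z
      have hmem : (q : B) * (z : B) ∈ LinearMap.range (LinearMap.lsmul A B u) := by
        obtain ⟨w, hw⟩ := hYQ q q.2 z z.2
        exact ⟨w, hw.symm⟩
      exact (hδ ⟨(q : B) * (z : B), hmem⟩).symm
    let Φ : (I.restrictScalars A) →ₗ[A] (Y → B ⧸ M) :=
      LinearMap.pi fun q => (Ideal.Quotient.mkₐ A M).toLinearMap ∘ₗ φ q
    obtain ⟨F', hF'⟩ := exists_lift_fg Φ
    have hkerΦ : ∀ z : I.restrictScalars A, Φ z = 0 → (z : B) ∈ I' := by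
      intro z hz
      have hg : ∀ g ∈ Ideal.span (Y : Set B), ∃ w ∈ M, g * (z : B) = u • w := by
        intro g hg
        induction hg using Submodule.span_induction with
        | mem g hg =>
          refine ⟨φ ⟨g, hg⟩ z, ?_, hφ ⟨g, hg⟩ z⟩
          exact Ideal.Quotient.eq_zero_iff_mem.mp (congrFun hz ⟨g, hg⟩)
        | zero => exact ⟨0, M.zero_mem, by simp⟩
        | add a b _ _ ha hb =>
          obtain ⟨w, hw, h⟩ := ha
          obtain ⟨w', hw', h'⟩ := hb
          exact ⟨w + w', M.add_mem hw hw', by rw [add_mul, h, h', smul_add]⟩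
        | smul a b _ hb =>
          obtain ⟨w, hw, h⟩ := hb
          exact ⟨a * w, M.mul_mem_left _ hw, by
            rw [smul_eq_mul, mul_assoc, h, mul_smul_comm]⟩
      refine ⟨z.2, fun q hq => ?_⟩
      obtain ⟨s, hs, hsq⟩ := hYs q hq
      obtain ⟨w, hw⟩ := hq z z.2
      refine ⟨w, hMs s hs w ?_, hw⟩
      obtain ⟨w', hw', h⟩ := hg _ hsq
      have : s • w = w' := hreg _ _ (by rw [← h, smul_mul_assoc, hw, smul_comm])
      rwa [this]
    refine ⟨F ∪ F'.image Subtype.val, fun b => ?_⟩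
    obtain ⟨b1, h1, b2, h2, rfl⟩ := Submodule.mem_sup.mp (hF b)
    obtain ⟨b3, h3, b4, h4, h34⟩ := Submodule.mem_sup.mp (hF' ⟨b2, h2⟩)
    have e : b2 = b3 + b4 := (congrArg Subtype.val h34).symm
    rw [e]
    refine Submodule.add_mem _ (Submodule.mem_sup_left ?_) (Submodule.add_mem _
      (Submodule.mem_sup_left ?_) (Submodule.mem_sup_right ?_))
    · exact Submodule.span_mono (by simp) h1
    · have := Submodule.mem_map_of_mem (f := (I.restrictScalars A).subtype) h3
      rw [Submodule.map_span] at this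
      refine Submodule.span_mono ?_ this
      simp
    · exact hkerΦ b4 h4
  · -- properness
    intro heq
    have hII : ∀ z ∈ I, ∀ q ∈ Q, ∃ w ∈ M, q * z = u • w := by
      intro z hz
      have : z ∈ I'.restrictScalars A := heq ▸ hz
      exact this.2
    have hyQ : ∀ q ∈ Q, ∃ r ∈ Q, y * q = u • r := by
      intro q hq
      obtain ⟨r, hr⟩ := hq y hy
      refine ⟨r, fun z hz => ?_, by rw [mul_comm, hr]⟩
      obtain ⟨w, ⟨v, hv⟩, h⟩ := hII z hz q hq
      refine ⟨v, hreg _ _ ?_⟩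
      rw [← hv, ← smul_mul_assoc, ← hr, ← smul_mul_assoc, ← h]
      ring
    choose! r hrQ hr using hyQ
    choose! s hsp hs using hYs
    let σ : A := ∏ g ∈ Y, s (r g)
    have hσ : σ ∉ p := by
      intro h
      obtain ⟨g, hg, h⟩ := (Ideal.IsPrime.prod_mem_iff).mp h
      exact hsp _ (hrQ g (hYQ g hg)) h
    obtain ⟨b, hb⟩ := hInt (Ideal.span (Y : Set B)) ⟨Y, rfl⟩ (Ideal.subset_span (by simp [Y])) (σ • y) (by
      intro q hq
      induction hq using Submodule.span_induction with
      | mem g hg =>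
        refine ⟨σ • r g, ?_, by rw [smul_mul_assoc, hr g (hYQ g hg), smul_comm]⟩
        have : σ = (∏ g' ∈ Y.erase g, s (r g')) * s (r g) := by
          rw [mul_comm]; exact (Finset.mul_prod_erase Y (fun g => s (r g)) hg).symm
        rw [this, mul_smul, Algebra.smul_def]
        exact Ideal.mul_mem_left _ _ (hs _ (hrQ g (hYQ g hg)))
      | zero => exact ⟨0, Ideal.zero_mem _, by simp⟩
      | add a b _ _ ha hb =>
        obtain ⟨w, hw, h⟩ := ha
        obtain ⟨w', hw', h'⟩ := hb
        exact ⟨w + w', Ideal.add_mem _ hw hw', by rw [mul_add, h, h', smul_add]⟩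
      | smul a b _ hb =>
        obtain ⟨w, hw, h⟩ := hb
        exact ⟨a * w, Ideal.mul_mem_left _ _ hw, by
          rw [smul_eq_mul, mul_left_comm, h, mul_smul_comm]⟩)
    obtain ⟨b', hb'⟩ := hsat σ hσ y b hb
    exact hy' b' hb'
end F
end SallyAux

namespace SallyAux
section G
variable {A W : Type*} [CommRing A] [CommRing W] [Algebra A W]

lemma nu_step (p : Ideal A) [p.IsPrime] (N : ℕ → Submodule A W) (b : ℕ → W) :
    ∀ l : ℕ, (∀ i < l, N i ≤ N (i + 1)) → (∀ i < l, b i ∈ N (i + 1)) →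
      (∀ i < l, ∀ s ∉ p, s • b i ∉ N i) → N 0 ≤ N l ∧ (l : ℕ∞) ≤ nu p (N 0) (N l) := by
  intro l
  induction l with
  | zero => intro _ _ _; simp
  | succ l ih =>
    intro h1 h2 h3
    obtain ⟨h4, h5⟩ := ih (fun i hi => h1 i (by omega)) (fun i hi => h2 i (by omega))
      (fun i hi => h3 i (by omega))
    refine ⟨h4.trans (h1 l (by omega)), ?_⟩
    rw [nu_add p h4 (h1 l (by omega))]
    push_cast
    exact add_le_add h5 (nu_pos p (h2 l (by omega)) (h3 l (by omega)))

lemma chain_bound [IsNoetherianRing A] (p : Ideal A) [p.IsPrime]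
    (hinj : Function.Injective (algebraMap A W)) {u : A}
    (hu : IsUnit (algebraMap A W u))
    (hW : ∀ w : W, ∃ n : ℕ, u ^ n • w ∈ (1 : Submodule A W))
    (hup : u ∈ p) {c : ℕ} (hpc : p ^ c ≤ Ideal.span {u}) :
    ∃ q : ℕ, ∀ N : ℕ → Submodule A W, ∀ b : ℕ → W, u • (1 : W) ∈ N 0 →
      (∀ i ≤ q, u • b i ∈ N 0) → (∀ i ≤ q, N i ≤ N (i + 1)) → (∀ i ≤ q, b i ∈ N (i + 1)) →
      ¬ (∀ i ≤ q, ∀ s ∉ p, s • b i ∉ N i) := by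
  classical
  let e : W ≃ₗ[A] W := LinearEquiv.ofBijective (LinearMap.lsmul A W u) (by
    constructor
    · intro x y h
      have h : u • x = u • y := h
      rw [Algebra.smul_def, Algebra.smul_def] at h
      exact hu.mul_left_cancel h
    · intro y
      obtain ⟨v, hv⟩ := hu.exists_right_inv
      exact ⟨v * y, by simp only [LinearMap.lsmul_apply, Algebra.smul_def]; rw [← mul_assoc, hv, one_mul]⟩)
  have he : ∀ w, e w = u • w := fun w => rfl
  have hen : ∀ n : ℕ, ∀ w, (e ^ n) w = u ^ n • w := by
    intro n
    induction n with
    | zero => intro w; simp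
    | succ n ih =>
      intro w
      rw [pow_succ', LinearEquiv.mul_apply, ih, he, smul_smul, pow_succ']
  have heM : ∀ X : Submodule A W, X.map e.toLinearMap ≤ X := by
    rintro X _ ⟨x, hx, rfl⟩
    exact X.smul_mem u hx
  have hfin : nu p ((1 : Submodule A W).map e.toLinearMap) 1 ≠ ⊤ := by
    have h1 := mu_quot_ne_top p hup hpc
    let g : A →ₗ[A] ((1 : Submodule A W) ⧸
      ((1 : Submodule A W).map e.toLinearMap).comap (1 : Submodule A W).subtype) :=
      (Submodule.mkQ _) ∘ₗ (LinearMap.codRestrict 1 (Algebra.linearMap A W)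
        (fun a => Submodule.mem_one.mpr ⟨a, rfl⟩))
    have hg : Function.Surjective g := by
      intro y
      obtain ⟨⟨y, hy⟩, rfl⟩ := Submodule.mkQ_surjective _ y
      obtain ⟨a, rfl⟩ := Submodule.mem_one.mp hy
      exact ⟨a, rfl⟩
    have hk : LinearMap.ker g = Ideal.span {u} := by
      ext a
      rw [LinearMap.mem_ker]
      change Submodule.mkQ _ _ = 0 ↔ _
      rw [Submodule.mkQ_apply, Submodule.Quotient.mk_eq_zero, Ideal.mem_span_singleton]
      constructor
      · rintro ⟨x, hx, hxa⟩
        obtain ⟨b, rfl⟩ := Submodule.mem_one.mp hx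
        have hxa : u • algebraMap A W b = algebraMap A W a := hxa
        refine ⟨b, hinj ?_⟩
        rw [← hxa, Algebra.smul_def, map_mul]
      · rintro ⟨b, rfl⟩
        refine ⟨algebraMap A W b, Submodule.mem_one.mpr ⟨b, rfl⟩, ?_⟩
        change u • algebraMap A W b = algebraMap A W (u * b)
        rw [Algebra.smul_def, map_mul]
    have h2 := mu_congr p ((Submodule.quotEquivOfEq _ _ hk.symm).trans (g.quotKerEquivOfSurjective hg))
    unfold nu
    rw [← h2]
    exact h1
  obtain ⟨q, hq⟩ := ENat.ne_top_iff_exists.mp hfin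
  refine ⟨q, fun N b h0 hub hmono hb hnb => ?_⟩
  let T : Finset W := (Finset.range (q + 1)).image b
  let M : Submodule A W := 1 ⊔ Submodule.span A (T : Set W)
  have hM1 : (1 : Submodule A W) ≤ M := le_sup_left
  have hbM : ∀ i ≤ q, b i ∈ M := fun i hi => Submodule.mem_sup_right
    (Submodule.subset_span (Finset.mem_coe.mpr (Finset.mem_image_of_mem b (Finset.mem_range.mpr (by omega)))))
  have huM : ∀ x ∈ M, u • x ∈ N 0 := by
    have : M ≤ (N 0).comap (LinearMap.lsmul A W u) := by
      refine sup_le ?_ ?_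
      · intro x hx
        obtain ⟨a, rfl⟩ := Submodule.mem_one.mp hx
        change u • algebraMap A W a ∈ N 0
        rw [Algebra.algebraMap_eq_smul_one, smul_comm]
        exact (N 0).smul_mem a h0
      · rw [Submodule.span_le]
        intro x hx
        obtain ⟨i, hi, rfl⟩ := Finset.mem_image.mp (Finset.mem_coe.mp hx)
        exact hub i (by have := Finset.mem_range.mp hi; omega)
    exact this
  choose n hn using hW
  have hMn : M.map (e ^ (T.sup n)).toLinearMap ≤ 1 := by
    rw [Submodule.map_le_iff_le_comap]
    refine sup_le ?_ ?_
    · intro x hx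
      change (e ^ (T.sup n)) x ∈ (1 : Submodule A W)
      rw [hen]
      exact Submodule.smul_mem _ _ hx
    · rw [Submodule.span_le]
      intro x hx
      change (e ^ (T.sup n)) x ∈ (1 : Submodule A W)
      have h3 : n x ≤ T.sup n := Finset.le_sup (Finset.mem_coe.mp hx)
      rw [hen, ← Nat.sub_add_cancel h3, pow_add, mul_smul]
      exact Submodule.smul_mem _ _ (hn x)
  have h1 := nu_krull p e 1 M hM1 heM hMn hfin
  obtain ⟨h2, h3⟩ := nu_step p (fun i => M ⊓ N i) b (q + 1)
    (fun i hi => inf_le_inf_left _ (hmono i (by omega)))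
    (fun i hi => ⟨hbM i (by omega), hb i (by omega)⟩)
    (fun i hi s hs h => hnb i (by omega) s hs h.2)
  have h4 : M.map e.toLinearMap ≤ M ⊓ N 0 := by
    rintro _ ⟨x, hx, rfl⟩
    exact ⟨M.smul_mem u hx, huM x hx⟩
  have h5 := nu_add p (h4.trans h2) (inf_le_left : M ⊓ N (q + 1) ≤ M)
  have h6 := nu_add p h4 h2
  have h7 : ((q + 1 : ℕ) : ℕ∞) ≤ (q : ℕ∞) := by
    rw [hq, ← h1, h5, h6]
    refine h3.trans ?_
    exact le_add_right le_add_self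
  have h8 : q + 1 ≤ q := by exact_mod_cast h7
  omega

lemma isIntegral_of_stable {B W : Type*} [CommRing B] [CommRing W] [Algebra B W]
    (Q : Submodule B W) (hQ : Q.FG) {w x : W} (hx : x ∈ Q) (hxu : IsUnit x)
    (hw : ∀ q ∈ Q, w * q ∈ Q) : IsIntegral B w := by
  have : Module.Finite B Q := Module.Finite.iff_fg.mpr hQ
  let f : Module.End B Q := (LinearMap.mulLeft B w).restrict hw
  obtain ⟨P, hP, h0⟩ := LinearMap.exists_monic_and_aeval_eq_zero B f
  refine ⟨P, hP, ?_⟩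
  have hf : ∀ P : Polynomial B, ∀ q : Q, ((aeval f P) q : W) = aeval w P * q := by
    intro P
    induction P using Polynomial.induction_on' with
    | add P P' h h' => intro q; simp [h, h', add_mul]
    | monomial n a =>
      intro q
      have hn : ∀ n : ℕ, ∀ q : Q, ((f ^ n) q : W) = w ^ n * q := by
        intro n
        induction n with
        | zero => intro q; simp
        | succ n ih =>
          intro q
          rw [pow_succ', Module.End.mul_apply]
          change w * (((f ^ n) q : Q) : W) = _
          rw [ih, pow_succ']; ring
      rw [aeval_monomial, aeval_monomial]
      simp [hn, Algebra.smul_def, mul_assoc]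
  have h1 := hf P ⟨x, hx⟩
  rw [h0] at h1
  simp only [LinearMap.zero_apply, ZeroMemClass.coe_zero] at h1
  exact (hxu.mul_left_eq_zero).mp h1.symm

theorem finite_integralClosure [IsNoetherianRing A] (p : Ideal A) [p.IsPrime]
    (hinj : Function.Injective (algebraMap A W)) {u : A}
    (hu : IsUnit (algebraMap A W u))
    (hW : ∀ w : W, ∃ n : ℕ, u ^ n • w ∈ (1 : Submodule A W))
    (hup : u ∈ p) {c : ℕ} (hpc : p ^ c ≤ Ideal.span {u})
    (hs : ∀ s ∉ p, ∀ b, s * b ∈ Ideal.span {u} → b ∈ Ideal.span {u})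
    (hN2 : ∀ M : Ideal (integralClosure A W), M.IsPrime →
      (∀ a, algebraMap A (integralClosure A W) a ∈ M ↔ a ∈ p) →
      (∃ l : Finset (integralClosure A W), ∀ b : (integralClosure A W),
        ∃ s ∉ p, s • (Ideal.Quotient.mk M b) ∈
        Submodule.span A ((fun b => Ideal.Quotient.mk M b) '' (l : Set (integralClosure A W)))) →
        Module.Finite A ((integralClosure A W) ⧸ M)) :
    ∃ F : Finset (integralClosure A W), ∀ b : (integralClosure A W),
      b ∈ Submodule.span A (F : Set (integralClosure A W)) ⊔
      LinearMap.range (LinearMap.lsmul A (integralClosure A W) u) := by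
  obtain ⟨v, hv⟩ := hu.exists_right_inv
  have hdiv : ∀ y : integralClosure A W, ∀ w : W, (y : W) = u • w → IsIntegral A w →
      ∃ b : integralClosure A W, y = u • b := fun y w h1 h2 => ⟨⟨w, h2⟩, Subtype.ext h1⟩
  have huv : ∀ w : W, u • (v * w) = w := fun w => by
    rw [Algebra.smul_def, ← mul_assoc, hv, one_mul]
  have hreg : ∀ x y : W, u • x = u • y → x = y := by
    intro x y h
    rw [Algebra.smul_def, Algebra.smul_def] at h
    exact hu.mul_left_cancel h
  refine finite_mod_u (p := p) hpc ?_ ?_ ?_ ?_ hN2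
  · obtain ⟨q, hq⟩ := chain_bound p hinj hu hW hup hpc
    refine ⟨q, fun N hN hlt => ?_⟩
    have hex : ∀ i, ∃ b, i ≤ q → b ∈ N (i + 1) ∧ b ∉ N i := by
      intro i
      by_cases hi : i ≤ q
      · obtain ⟨b, h1, h2⟩ := SetLike.exists_of_lt (hlt i hi)
        exact ⟨b, fun _ => ⟨h1, h2⟩⟩
      · exact ⟨0, fun h => absurd h hi⟩
    choose b hb using hex
    let ι : integralClosure A W →ₗ[A] W := (integralClosure A W).val.toLinearMap
    have hι : Function.Injective ι := Subtype.val_injective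
    refine hq (fun i => (N i).map ι) (fun i => (b i : W)) ?_ ?_ ?_ ?_ ?_
    · exact ⟨u • 1, (hN 0 (by omega)).1 1, rfl⟩
    · intro i hi
      exact ⟨u • b i, (hN 0 (by omega)).1 _, rfl⟩
    · intro i hi
      exact Submodule.map_mono (hlt i hi).le
    · intro i hi
      exact ⟨b i, (hb i hi).1, rfl⟩
    · rintro i hi s hs ⟨x, hx, hxs⟩
      have : x = s • b i := hι hxs
      rw [this] at hx
      exact (hb i hi).2 ((hN i hi).2 s hs _ hx)
  · intro b b' h
    exact Subtype.ext (hreg _ _ (congrArg Subtype.val h))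
  · intro s hsp b b' h
    refine hdiv b (v * b) (huv _).symm ?_
    refine integral_cancel hinj hu hW (hs s hsp) ?_
    have h1 : s • (v * (b : W)) = b' := by
      apply hreg
      rw [smul_comm, huv]
      exact congrArg Subtype.val h
    rw [h1]
    exact b'.2
  · intro Q hQ huQ y hy
    refine hdiv y (v * y) (huv _).symm ?_
    have : IsIntegral (integralClosure A W) (v * (y : W)) := by
      let Q' : Submodule (integralClosure A W) W :=
        Submodule.map (Algebra.linearMap (integralClosure A W) W) Q
      refine isIntegral_of_stable Q' (Submodule.FG.map _ hQ) (x := algebraMap A W u) ⟨_, huQ, rfl⟩ hu ?_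
      rintro _ ⟨q, hq, rfl⟩
      obtain ⟨r, hr, h⟩ := hy q hq
      refine ⟨r, hr, ?_⟩
      change (r : W) = v * y * q
      apply hreg
      rw [mul_assoc, huv]
      exact (congrArg Subtype.val h).symm
    exact isIntegral_trans (R := A) (A := integralClosure A W) _ this
end G
end SallyAux

namespace SallyAux
section H

theorem N2_aux0 {P P' C K K' Ω : Type*} [CommRing P] [IsDomain P] [IsNoetherianRing P]
    [CommRing P'] [IsDomain P'] [IsNoetherianRing P'] [IsIntegrallyClosed P']
    [CommRing C] [IsDomain C] [Algebra P C] [Algebra P P'] [Module.Finite P P']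
    [Field K] [Algebra P K] [IsFractionRing P K] [Field K'] [Algebra P' K'] [IsFractionRing P' K']
    [Field Ω] [IsAlgClosed Ω] [Algebra K' Ω] [Algebra P' Ω] [IsScalarTower P' K' Ω]
    [Algebra P Ω] [IsScalarTower P P' Ω]
    (hPP' : Function.Injective (algebraMap P P'))
    (hPC : Function.Injective (algebraMap P C)) [Algebra.IsIntegral P C]
    (p e : ℕ) [hp : ExpChar P p] (l : Finset C)
    (hl : ∀ c : C, ∃ f : P, f ≠ 0 ∧ f • c ∈ Submodule.span P (l : Set C))
    (hg : ∀ x ∈ l, ∃ g : P[X], (g.map (algebraMap P (K))).Separable ∧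
      aeval (x ^ (p ^ e)) g = 0 ∧ ∀ i, ∃ c' : P', algebraMap P P' (g.coeff i) = c' ^ (p ^ e)) :
    Module.Finite P C := by
  classical
  have hP'Ω : Function.Injective (algebraMap P' Ω) := by
    rw [IsScalarTower.algebraMap_eq P' K' Ω]
    exact (algebraMap K' Ω).injective.comp (IsFractionRing.injective P' K')
  have hPΩ : Function.Injective (algebraMap P Ω) := by
    rw [IsScalarTower.algebraMap_eq P P' Ω]
    exact hP'Ω.comp hPP'
  have : FaithfulSMul P C := (faithfulSMul_iff_algebraMap_injective P C).mpr hPC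
  have : FaithfulSMul P Ω := (faithfulSMul_iff_algebraMap_injective P Ω).mpr hPΩ
  have : Algebra.IsAlgebraic P C := Algebra.IsIntegral.isAlgebraic
  have : ExpChar P' p := expChar_of_injective_ringHom hPP' p
  have : ExpChar Ω p := expChar_of_injective_ringHom hPΩ p
  let lam : C →ₐ[P] Ω := IsAlgClosed.lift
  have hlam : Function.Injective lam := by
    rw [← AlgHom.coe_toRingHom, RingHom.injective_iff_ker_eq_bot]
    refine Ideal.eq_bot_of_comap_eq_bot (R := P) ?_
    rw [eq_bot_iff]
    intro a ha
    have h1 : lam (algebraMap P C a) = 0 := ha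
    rw [AlgHom.commutes] at h1
    exact (map_eq_zero_iff _ hPΩ).mp h1
  have hsep : ∀ x ∈ l, IsSeparable K' (lam x) := by
    intro x hx
    obtain ⟨g, hgs, hg0, hgc⟩ := hg x hx
    have h1 : g.map (algebraMap P P') ∈ Polynomial.lifts (iterateFrobenius P' p e) := by
      rw [Polynomial.lifts_iff_coeff_lifts]
      intro i
      obtain ⟨c', hc'⟩ := hgc i
      refine ⟨c', ?_⟩
      rw [iterateFrobenius_def, coeff_map, hc']
    obtain ⟨g', hg'⟩ := h1
    have hg' : g'.map (iterateFrobenius P' p e) = g.map (algebraMap P P') := hg'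
    have hcomp : (iterateFrobenius Ω p e).comp (algebraMap P' Ω) =
        (algebraMap P' Ω).comp (iterateFrobenius P' p e) := by
      ext z
      simp [iterateFrobenius_def]
    have h2 : (g'.map (algebraMap P' Ω)).map (iterateFrobenius Ω p e) = g.map (algebraMap P Ω) := by
      rw [Polynomial.map_map, hcomp, ← Polynomial.map_map, hg', Polynomial.map_map,
        ← IsScalarTower.algebraMap_eq]
    have h3 : (g.map (algebraMap P Ω)).Separable := by
      let r : K →+* Ω := IsFractionRing.lift hPΩ
      have hr : r.comp (algebraMap P (K)) = algebraMap P Ω := by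
        ext z; exact IsFractionRing.lift_algebraMap hPΩ z
      rw [← hr, ← Polynomial.map_map]
      exact hgs.map
    rw [← h2, Polynomial.separable_map, IsScalarTower.algebraMap_eq P' K' Ω, ← Polynomial.map_map,
      Polynomial.separable_map] at h3
    refine h3.of_dvd (minpoly.dvd _ _ ?_)
    have h4 : lam (aeval (x ^ (p ^ e)) g) = 0 := by rw [hg0, map_zero]
    rw [← Polynomial.aeval_algHom_apply, map_pow, aeval_def, ← eval_map, ← h2,
      ← iterateFrobenius_def, eval_map, Polynomial.eval₂_hom, iterateFrobenius_def] at h4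
    have h5 := eq_zero_of_pow_eq_zero h4
    rw [aeval_def, ← eval_map, Polynomial.map_map, ← IsScalarTower.algebraMap_eq]
    exact h5
  let L' : IntermediateField K' Ω := IntermediateField.adjoin K' (lam '' (l : Set C))
  have hLsep : Algebra.IsSeparable K' L' := by
    rw [IntermediateField.isSeparable_adjoin_iff_isSeparable]
    rintro _ ⟨x, hx, rfl⟩
    exact hsep x hx
  have hLfin : FiniteDimensional K' L' := by
    have : Finite (lam '' (l : Set C)) := (l.finite_toSet.image lam).to_subtype
    refine IntermediateField.finiteDimensional_adjoin ?_
    rintro _ ⟨x, hx, rfl⟩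
    exact (hsep x hx).isIntegral
  have hPL : ∀ a : P, algebraMap P Ω a ∈ L' := by
    intro a
    rw [IsScalarTower.algebraMap_apply P P' Ω, IsScalarTower.algebraMap_apply P' K' Ω]
    exact L'.algebraMap_mem _
  have hCL : ∀ c : C, lam c ∈ L' := by
    intro c
    obtain ⟨f, hf, hfc⟩ := hl c
    have h1 : lam (f • c) ∈ L' := by
      generalize f • c = z at hfc ⊢
      induction hfc using Submodule.span_induction with
      | mem x hx => exact IntermediateField.subset_adjoin _ _ ⟨x, hx, rfl⟩
      | zero => rw [map_zero]; exact L'.zero_mem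
      | add a b _ _ ha hb => rw [map_add]; exact L'.add_mem ha hb
      | smul a b _ hb =>
        rw [map_smul, Algebra.smul_def]
        exact L'.mul_mem (hPL a) hb
    rw [map_smul, Algebra.smul_def] at h1
    have h2 : algebraMap P Ω f ≠ 0 := fun h => hf ((map_eq_zero_iff _ hPΩ).mp h)
    rw [← inv_mul_cancel_left₀ h2 (lam c)]
    exact L'.mul_mem (L'.inv_mem (hPL f)) h1
  have hCint : ∀ c : C, IsIntegral P' (⟨lam c, hCL c⟩ : L') := by
    intro c
    have h1 : IsIntegral P' (lam c) := ((Algebra.IsIntegral.isIntegral (R := P) c).map lam).tower_top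
    exact (isIntegral_algHom_iff (L'.val.restrictScalars P') Subtype.val_injective).mp h1
  have : Module.Finite P' (integralClosure P' L') := IsIntegralClosure.finite P' K' L' _
  let : Module P (integralClosure P' L') := Module.compHom _ (algebraMap P P')
  have : IsScalarTower P P' (integralClosure P' L') := ⟨fun a b x => by
    rw [Algebra.smul_def a b, mul_smul]; rfl⟩
  have : Module.Finite P (integralClosure P' L') := Module.Finite.trans P' _
  let Φ : C →ₗ[P] (integralClosure P' L') :=
    { toFun := fun c => ⟨⟨lam c, hCL c⟩, hCint c⟩
      map_add' := fun a b => by ext; exact map_add lam a b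
      map_smul' := fun a b => by
        ext
        change lam (a • b) = algebraMap P P' a • lam b
        rw [map_smul, algebraMap_smul] }
  have hΦ : Function.Injective Φ := by
    intro a b h
    apply hlam
    exact congrArg (fun z : integralClosure P' L' => ((z : L') : Ω)) h
  have : IsNoetherian P C := isNoetherian_of_injective Φ hΦ
  infer_instance

theorem N2_aux {P P' C : Type*} [CommRing P] [IsDomain P] [IsNoetherianRing P]
    [CommRing P'] [IsDomain P'] [IsNoetherianRing P'] [IsIntegrallyClosed P']
    [CommRing C] [IsDomain C] [Algebra P C] [Algebra P P'] [Module.Finite P P']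
    (hPP' : Function.Injective (algebraMap P P'))
    (hPC : Function.Injective (algebraMap P C)) [Algebra.IsIntegral P C]
    (p e : ℕ) [hp : ExpChar P p] (l : Finset C)
    (hl : ∀ c : C, ∃ f : P, f ≠ 0 ∧ f • c ∈ Submodule.span P (l : Set C))
    (hg : ∀ x ∈ l, ∃ g : P[X], (g.map (algebraMap P (FractionRing P))).Separable ∧
      aeval (x ^ (p ^ e)) g = 0 ∧ ∀ i, ∃ c' : P', algebraMap P P' (g.coeff i) = c' ^ (p ^ e)) :
    Module.Finite P C :=
  N2_aux0 (K := FractionRing P) (K' := FractionRing P')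
    (Ω := AlgebraicClosure (FractionRing P')) hPP' hPC p e l hl hg
end H
end SallyAux

namespace SallyAux
section H2

lemma exists_exp {P C : Type*} [CommRing P] [IsDomain P] [IsIntegrallyClosed P]
    [CommRing C] [IsDomain C] [Algebra P C]
    (hPC : Function.Injective (algebraMap P C)) [Algebra.IsIntegral P C]
    (p : ℕ) [hp : ExpChar P p] (l : Finset C) :
    ∃ e : ℕ, ∀ x ∈ l, ((minpoly P (x ^ p ^ e)).map (algebraMap P (FractionRing P))).Separable := by
  classical
  let K := FractionRing P
  let L := FractionRing C
  have : FaithfulSMul P C := (faithfulSMul_iff_algebraMap_injective P C).mpr hPC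
  let : Algebra K L := FractionRing.liftAlgebra P L
  have : IsScalarTower P K L := FractionRing.isScalarTower_liftAlgebra P L
  have : Algebra.IsAlgebraic P C := Algebra.IsIntegral.isAlgebraic
  have : Algebra.IsAlgebraic K L := by
    have h3 : Algebra.IsAlgebraic C L := IsLocalization.isAlgebraic (R := C) (S := L) (nonZeroDivisors C)
    have h4 : Algebra.IsAlgebraic P L := Algebra.IsAlgebraic.trans P C L
    exact (IsFractionRing.comap_isAlgebraic_iff (A := P) (K := K) (C := L)).mp h4
  have : ExpChar K p := expChar_of_injective_ringHom (IsFractionRing.injective P K) p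
  have : ExpChar (separableClosure K L) p :=
    expChar_of_injective_ringHom (algebraMap K (separableClosure K L)).injective p
  have h1 : ∀ x : C, ∃ n, algebraMap C L x ^ p ^ n ∈ separableClosure K L := by
    intro x
    obtain ⟨n, y, hy⟩ := IsPurelyInseparable.pow_mem (separableClosure K L) p (algebraMap C L x)
    refine ⟨n, ?_⟩
    rw [← hy]
    exact y.2
  choose n hn using h1
  refine ⟨l.sup n, fun x hx => ?_⟩
  have h2 : algebraMap C L x ^ p ^ (l.sup n) ∈ separableClosure K L := by
    have h3 : n x ≤ l.sup n := Finset.le_sup hx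
    rw [← Nat.add_sub_cancel' h3, pow_add, pow_mul]
    exact pow_mem (hn x) _
  rw [← map_pow, mem_separableClosure_iff] at h2
  rw [← minpoly.isIntegrallyClosed_eq_field_fractions K L (Algebra.IsIntegral.isIntegral _)]
  exact h2

theorem N2_aux' {P P' C : Type*} [CommRing P] [IsDomain P] [IsNoetherianRing P]
    [CommRing P'] [IsDomain P'] [IsNoetherianRing P'] [IsIntegrallyClosed P']
    [CommRing C] [IsDomain C] [Algebra P C] (φ : P →+* P') (hφf : φ.Finite)
    (hφ : Function.Injective φ)
    (hPC : Function.Injective (algebraMap P C)) [Algebra.IsIntegral P C]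
    (p e : ℕ) [hp : ExpChar P p] (l : Finset C)
    (hl : ∀ c : C, ∃ f : P, f ≠ 0 ∧ f • c ∈ Submodule.span P (l : Set C))
    (hg : ∀ x ∈ l, ∃ g : P[X], (g.map (algebraMap P (FractionRing P))).Separable ∧
      aeval (x ^ (p ^ e)) g = 0 ∧ ∀ i, ∃ c' : P', φ (g.coeff i) = c' ^ (p ^ e)) :
    Module.Finite P C := by
  let := φ.toAlgebra
  have : Module.Finite P P' := hφf
  exact N2_aux (P' := P') hφ hPC p e l hl hg

lemma phi_finite {k k' σ : Type*} [Field k] [Field k'] [Algebra k k'] [FiniteDimensional k k']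
    [Finite σ] {q : ℕ} (hq : 0 < q) :
    ((MvPolynomial.expand q : MvPolynomial σ k' →ₐ[k'] MvPolynomial σ k').toRingHom.comp
      (MvPolynomial.map (algebraMap k k'))).Finite := by
  set φ := ((MvPolynomial.expand q : MvPolynomial σ k' →ₐ[k'] MvPolynomial σ k').toRingHom.comp
      (MvPolynomial.map (algebraMap k k'))) with hφ
  have hC : φ.comp MvPolynomial.C = MvPolynomial.C.comp (algebraMap k k') := by
    ext a
    simp [hφ]
  refine RingHom.IsIntegral.to_finite ?_ ?_
  · intro x
    induction x using MvPolynomial.induction_on with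
    | C a =>
      obtain ⟨g, hg, h0⟩ := Algebra.IsIntegral.isIntegral (R := k) a
      refine ⟨g.map MvPolynomial.C, hg.map _, ?_⟩
      rw [Polynomial.eval₂_map, hC, ← Polynomial.hom_eval₂, h0, map_zero]
    | add a b ha hb => exact ha.add φ hb
    | mul_X a i ha =>
      refine ha.mul φ ⟨X ^ q - C (MvPolynomial.X i), monic_X_pow_sub_C _ hq.ne', ?_⟩
      simp [hφ]
  · refine RingHom.FiniteType.of_comp_finiteType (f := MvPolynomial.C) ?_
    rw [hC]
    have : Algebra.FiniteType k (MvPolynomial σ k') :=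
      Algebra.FiniteType.trans (S := k') inferInstance inferInstance
    have h2 : algebraMap k (MvPolynomial σ k') = MvPolynomial.C.comp (algebraMap k k') := rfl
    rw [← h2, RingHom.finiteType_algebraMap]
    exact this

lemma icl_mv (σ k : Type*) [Field k] [Finite σ] : IsIntegrallyClosed (MvPolynomial σ k) :=
  inferInstance

theorem N2 {k σ C : Type*} [Field k] [Finite σ] [CommRing C] [IsDomain C]
    [Algebra (MvPolynomial σ k) C] (hPC : Function.Injective (algebraMap (MvPolynomial σ k) C))
    [Algebra.IsIntegral (MvPolynomial σ k) C] (l : Finset C)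
    (hl : ∀ c : C, ∃ f : MvPolynomial σ k, f ≠ 0 ∧
      f • c ∈ Submodule.span (MvPolynomial σ k) (l : Set C)) :
    Module.Finite (MvPolynomial σ k) C := by
  classical
  obtain ⟨p, hp⟩ := ExpChar.exists k
  have hpP : ExpChar (MvPolynomial σ k) p := inferInstance
  obtain ⟨e, he⟩ := exists_exp hPC p l
  have hq : 0 < p ^ e := pow_pos (expChar_pos k p) e
  -- coefficients
  let g : C → (MvPolynomial σ k)[X] := fun x => minpoly _ (x ^ p ^ e)
  let S : Set k := ⋃ x ∈ l, ⋃ i ∈ (g x).support, ((g x).coeff i).coeff '' (((g x).coeff i).support)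
  have hS : S.Finite := l.finite_toSet.biUnion fun x _ =>
    (g x).support.finite_toSet.biUnion fun i _ => (Finset.finite_toSet _).image _
  have hroot : ∀ a : k, ∃ z : AlgebraicClosure k, z ^ p ^ e = algebraMap k _ a := fun a =>
    IsAlgClosed.exists_pow_nat_eq _ hq
  choose r hr using hroot
  let k' := IntermediateField.adjoin k (r '' S)
  have : Finite (r '' S) := (hS.image r).to_subtype
  have hfin : FiniteDimensional k k' := IntermediateField.finiteDimensional_adjoin
    (fun x _ => Algebra.IsIntegral.isIntegral x)
  have hpk' : ExpChar k' p := expChar_of_injective_ringHom (algebraMap k k').injective p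
  let φ := ((MvPolynomial.expand (p ^ e) : MvPolynomial σ k' →ₐ[k'] MvPolynomial σ k').toRingHom.comp
      (MvPolynomial.map (algebraMap k k')))
  have : IsIntegrallyClosed (MvPolynomial σ k') := icl_mv σ k'
  refine N2_aux' φ (phi_finite hq) ?_ hPC p e l hl ?_
  · exact (MvPolynomial.expand_injective hq).comp
      (MvPolynomial.map_injective _ (algebraMap k k').injective)
  · intro x hx
    refine ⟨g x, he x hx, minpoly.aeval _ _, fun i => ?_⟩
    by_cases hi : i ∈ (g x).support
    · have h1 : φ ((g x).coeff i) ∈ (iterateFrobenius (MvPolynomial σ k') p e).range := by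
        rw [((g x).coeff i).as_sum, map_sum]
        refine Subring.sum_mem _ fun m hm => ?_
        have hmem : r (((g x).coeff i).coeff m) ∈ k' := by
          refine IntermediateField.subset_adjoin _ _ ⟨_, ?_, rfl⟩
          simp only [S, Set.mem_iUnion]
          exact ⟨x, hx, i, hi, m, hm, rfl⟩
        refine ⟨MvPolynomial.monomial m ⟨_, hmem⟩, ?_⟩
        rw [iterateFrobenius_def, MvPolynomial.monomial_pow]
        simp only [φ, RingHom.comp_apply, MvPolynomial.map_monomial]
        have : (⟨r (((g x).coeff i).coeff m), hmem⟩ : k') ^ p ^ e =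
            algebraMap k k' (((g x).coeff i).coeff m) := Subtype.ext (hr _)
        rw [this]
        change _ = MvPolynomial.expand _ _
        rw [MvPolynomial.expand_monomial]
      obtain ⟨c', hc'⟩ := h1
      exact ⟨c', by rw [← hc', iterateFrobenius_def]⟩
    · rw [Polynomial.notMem_support_iff] at hi
      exact ⟨0, by rw [hi, map_zero, zero_pow hq.ne']⟩
end H2
end SallyAux

namespace SallyAux
section GS
variable {R : Type*} [CommRing R]
open scoped LaurentPolynomial

/-- Laurent polynomials whose degree `n` coefficient lies in `F n`. -/
def GS (F : ℤ → Ideal R) : Submodule R R[T;T⁻¹] where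
  carrier := {p | ∀ n : ℤ, p.coeff n ∈ F n}
  add_mem' := by
    intro p q hp hq n
    exact (F n).add_mem (hp n) (hq n)
  zero_mem' := by
    intro n
    exact (F n).zero_mem
  smul_mem' := by
    intro a p hp n
    exact (F n).mul_mem_left a (hp n)

lemma mem_GS {F : ℤ → Ideal R} {p : R[T;T⁻¹]} : p ∈ GS F ↔ ∀ n : ℤ, p.coeff n ∈ F n := Iff.rfl

lemma single_mem_GS {F : ℤ → Ideal R} {n : ℤ} {a : R} (h : a ∈ F n) :
    (AddMonoidAlgebra.single n a : R[T;T⁻¹]) ∈ GS F := by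
  intro k
  rw [AddMonoidAlgebra.coeff_single, Finsupp.single_apply]
  split_ifs with hk
  · exact hk ▸ h
  · exact (F k).zero_mem

lemma GS_le_of {F : ℤ → Ideal R} (P : AddSubmonoid R[T;T⁻¹])
    (h : ∀ n, ∀ a ∈ F n, (AddMonoidAlgebra.single n a : R[T;T⁻¹]) ∈ P) {p : R[T;T⁻¹]}
    (hp : p ∈ GS F) : p ∈ P := by
  rw [← AddMonoidAlgebra.sum_coeff_single p]
  exact P.sum_mem fun n _ => h n _ (hp n)

lemma GS_mul {F G H : ℤ → Ideal R} (hFG : ∀ i j, ∀ a ∈ F i, ∀ b ∈ G j, a * b ∈ H (i + j))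
    {p q : R[T;T⁻¹]} (hp : p ∈ GS F) (hq : q ∈ GS G) : p * q ∈ GS H := by
  refine GS_le_of (F := F) ((GS H).toAddSubmonoid.comap (AddMonoidHom.mulRight q)) ?_ hp
  intro i a ha
  refine GS_le_of (F := G)
    ((GS H).toAddSubmonoid.comap (AddMonoidHom.mulLeft (AddMonoidAlgebra.single i a : R[T;T⁻¹]))) ?_ hq
  intro j b hb
  change (AddMonoidAlgebra.single i a * AddMonoidAlgebra.single j b : R[T;T⁻¹]) ∈ GS H
  rw [AddMonoidAlgebra.single_mul_single]
  exact single_mem_GS (hFG i j a ha b hb)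

lemma toNat_pow_mul (J : Ideal R) (i j : ℤ) {a b : R} (ha : a ∈ J ^ i.toNat) (hb : b ∈ J ^ j.toNat) :
    a * b ∈ J ^ (i + j).toNat := by
  have : a * b ∈ J ^ (i.toNat + j.toNat) := by
    rw [pow_add]; exact Ideal.mul_mem_mul ha hb
  exact Ideal.pow_le_pow_right (by omega) this

/-- The extended Rees algebra. -/
def exR (J : Ideal R) : Subalgebra R R[T;T⁻¹] where
  carrier := GS (fun n => J ^ n.toNat)
  mul_mem' := fun hp hq => GS_mul (fun i j _ ha _ hb => toNat_pow_mul J i j ha hb) hp hq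
  add_mem' := fun hp hq => Submodule.add_mem _ hp hq
  algebraMap_mem' := by
    intro r
    exact single_mem_GS (F := fun n : ℤ => J ^ n.toNat) (n := 0) (a := r) (by simp)

lemma mem_exR {J : Ideal R} {p : R[T;T⁻¹]} : p ∈ exR J ↔ ∀ n : ℤ, p.coeff n ∈ J ^ n.toNat := Iff.rfl

lemma single_mem_exR {J : Ideal R} {n : ℤ} {a : R} (h : a ∈ J ^ n.toNat) :
    (AddMonoidAlgebra.single n a : R[T;T⁻¹]) ∈ exR J := single_mem_GS (F := fun n => J ^ n.toNat) h

/-- The element `t⁻¹`. -/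
noncomputable def exu (J : Ideal R) : exR J := ⟨AddMonoidAlgebra.single (-1) 1, single_mem_exR (by simp)⟩

lemma coeff_u_mul (p : R[T;T⁻¹]) (n : ℤ) :
    ((AddMonoidAlgebra.single (-1) 1 : R[T;T⁻¹]) * p).coeff n = p.coeff (n + 1) := by
  rw [AddMonoidAlgebra.coeff_single_mul_apply, one_mul]
  congr 1
  ring

/-- surjection from polynomial ring modulo `t⁻¹` -/
noncomputable def exφ {d : ℕ} {J : Ideal R} (x : Fin d → R) (hJ : J = Ideal.span (Set.range x)) :
    MvPolynomial (Fin d) R →ₐ[R] exR J :=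
  MvPolynomial.aeval fun i => ⟨AddMonoidAlgebra.single 1 (x i), single_mem_exR (by
    rw [hJ]; simpa using Ideal.subset_span (Set.mem_range_self i))⟩

variable {d : ℕ} {J : Ideal R} (x : Fin d → R) (hJ : J = Ideal.span (Set.range x))

lemma exφ_monomial (β : Fin d →₀ ℕ) (a : R) :
    (exφ x hJ (MvPolynomial.monomial β a) : R[T;T⁻¹]) =
      AddMonoidAlgebra.single (β.degree : ℤ) (MvPolynomial.eval x (MvPolynomial.monomial β a)) := by
  rw [exφ, MvPolynomial.aeval_monomial, MvPolynomial.eval_monomial]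
  have h1 : ∀ s : Finset (Fin d), ((∏ i ∈ s, (⟨AddMonoidAlgebra.single 1 (x i), single_mem_exR (by
    rw [hJ]; simpa using Ideal.subset_span (Set.mem_range_self i))⟩ : exR J) ^ (β i) : exR J) : R[T;T⁻¹])
      = AddMonoidAlgebra.single (∑ i ∈ s, (β i : ℤ)) (∏ i ∈ s, x i ^ β i) := by
    intro s
    induction s using Finset.induction_on with
    | empty => simp
    | insert i s hi ih =>
      rw [Finset.prod_insert hi, Finset.sum_insert hi, Finset.prod_insert hi]
      rw [Subalgebra.coe_mul, ih, Subalgebra.coe_pow, AddMonoidAlgebra.single_pow,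
        AddMonoidAlgebra.single_mul_single]
      simp
  rw [Subalgebra.coe_mul, Finsupp.prod, h1, Finsupp.prod]
  have h2 : ((algebraMap R (exR J) a : exR J) : R[T;T⁻¹]) = AddMonoidAlgebra.single 0 a := rfl
  rw [h2, AddMonoidAlgebra.single_mul_single, zero_add]
  congr 1
  change _ = ((∑ i ∈ β.support, β i : ℕ) : ℤ)
  push_cast
  rfl

lemma exφ_coeff (f : MvPolynomial (Fin d) R) (n : ℕ) :
    (exφ x hJ f : R[T;T⁻¹]).coeff n =
      MvPolynomial.eval x (MvPolynomial.homogeneousComponent n f) := by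
  induction f using MvPolynomial.induction_on' with
  | monomial β a =>
    rw [exφ_monomial, AddMonoidAlgebra.coeff_single, Finsupp.single_apply]
    split_ifs with h
    · have : β.degree = n := by exact_mod_cast h
      rw [MvPolynomial.homogeneousComponent_of_mem (n := β.degree)
        (MvPolynomial.isHomogeneous_monomial a rfl), if_pos this.symm]
    · rw [MvPolynomial.homogeneousComponent_of_mem (n := β.degree)
        (MvPolynomial.isHomogeneous_monomial a rfl), if_neg, map_zero]
      rintro rfl; exact h rfl
  | add p q hp hq =>
    rw [map_add, map_add, map_add, ← hp, ← hq]; rfl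

lemma homComp_mem_Wf (f : MvPolynomial (Fin d) R) (n : ℕ) :
    MvPolynomial.homogeneousComponent n f ∈ Wf n Set.univ (⊤ : Ideal R) := by
  intro β
  refine ⟨trivial, fun h => ⟨?_, fun _ _ => trivial⟩⟩
  by_contra h'
  rw [MvPolynomial.coeff_homogeneousComponent, if_neg h'] at h
  exact h rfl

include hJ in
lemma exφ_mem_u (hx : QR x Set.univ) {f : MvPolynomial (Fin d) R}
    (h : exφ x hJ f ∈ Ideal.span {exu J}) (β : Fin d →₀ ℕ) : f.coeff β ∈ J := by
  obtain ⟨q, hq⟩ := Ideal.mem_span_singleton'.1 h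
  have h1 : MvPolynomial.eval x (MvPolynomial.homogeneousComponent β.degree f) ∈
      Ideal.span (x '' Set.univ) ^ (β.degree + 1) := by
    rw [← exφ_coeff x hJ, ← hq, mul_comm, Subalgebra.coe_mul, exu, coeff_u_mul, Set.image_univ, ← hJ]
    have := q.2 (β.degree + 1)
    exact this
  have h2 := hx _ _ (homComp_mem_Wf f β.degree) h1 β
  rw [MvPolynomial.coeff_homogeneousComponent, if_pos rfl, Set.image_univ, ← hJ] at h2
  exact h2

lemma algebraMap_mem_u {j : R} (hj : j ∈ J) : algebraMap R (exR J) j ∈ Ideal.span {exu J} := by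
  refine Ideal.mem_span_singleton'.2 ⟨⟨AddMonoidAlgebra.single 1 j, single_mem_exR (by simpa using hj)⟩, ?_⟩
  apply Subtype.ext
  rw [Subalgebra.coe_mul, exu]
  change AddMonoidAlgebra.single 1 j * AddMonoidAlgebra.single (-1) 1 = AddMonoidAlgebra.single 0 j
  rw [AddMonoidAlgebra.single_mul_single]
  simp

lemma exφ_mem_of_coeff (P : Ideal (exR J)) {f : MvPolynomial (Fin d) R}
    (h : ∀ β, algebraMap R (exR J) (f.coeff β) ∈ P) : exφ x hJ f ∈ P := by
  rw [f.as_sum, map_sum]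
  refine P.sum_mem fun β _ => ?_
  rw [exφ, MvPolynomial.aeval_monomial]
  exact P.mul_mem_right _ (h β)

lemma exR_induction (P : AddSubmonoid (exR J))
    (h : ∀ n : ℤ, ∀ a, ∀ ha : a ∈ J ^ n.toNat, (⟨AddMonoidAlgebra.single n a, single_mem_exR ha⟩ : exR J) ∈ P)
    (p : exR J) : p ∈ P := by
  have := GS_le_of (F := fun n => J ^ n.toNat) (P.map (exR J).toSubring.subtype.toAddMonoidHom)
    (fun n a ha => ⟨⟨_, single_mem_exR ha⟩, h n a ha, rfl⟩) p.2
  obtain ⟨q, hq, hqp⟩ := this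
  rwa [show q = p from Subtype.ext hqp] at hq

lemma single_eq_φ {n : ℕ} {a : R} (ha : a ∈ J ^ n) : ∃ f : MvPolynomial (Fin d) R,
    (exφ x hJ f : R[T;T⁻¹]) = AddMonoidAlgebra.single (n : ℤ) a := by
  obtain ⟨f, hf, hfa⟩ := exists_Wf x (S := Set.univ) (C := ⊤) (n := n) (z := a) (by
    rw [Ideal.mul_top, Set.image_univ, ← hJ]; exact ha)
  refine ⟨f, ?_⟩
  rw [f.as_sum, map_sum, AddSubmonoidClass.coe_finsetSum, ← hfa, MvPolynomial.eval_eq]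
  have h2 : ∀ β ∈ f.support, (exφ x hJ (MvPolynomial.monomial β (f.coeff β)) : R[T;T⁻¹]) =
      AddMonoidAlgebra.single (n : ℤ) (f.coeff β * ∏ i ∈ β.support, x i ^ β i) := by
    intro β hβ
    rw [exφ_monomial, ((hf β).2 (by simpa using hβ)).1, MvPolynomial.eval_monomial]
    rfl
  rw [Finset.sum_congr rfl h2]
  exact (map_sum (AddMonoidAlgebra.singleAddHom (n : ℤ)) _ _).symm

lemma exists_φ_add (p : exR J) : ∃ f, ∃ q, p = exφ x hJ f + exu J * q := by
  let P : AddSubmonoid (exR J) :=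
    { carrier := {p | ∃ f, ∃ q, p = exφ x hJ f + exu J * q}
      add_mem' := by
        rintro _ _ ⟨f, q, rfl⟩ ⟨f', q', rfl⟩
        exact ⟨f + f', q + q', by rw [map_add]; ring⟩
      zero_mem' := ⟨0, 0, by simp⟩ }
  refine exR_induction P ?_ p
  intro n a ha
  by_cases hn : 0 ≤ n
  · obtain ⟨m, rfl⟩ := Int.eq_ofNat_of_zero_le hn
    obtain ⟨f, hf⟩ := single_eq_φ x hJ (n := m) (a := a) (by simpa using ha)
    exact ⟨f, 0, by apply Subtype.ext; simpa using hf.symm⟩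
  · refine ⟨0, ⟨AddMonoidAlgebra.single (n + 1) a, single_mem_exR ?_⟩, ?_⟩
    · rw [show (n + 1).toNat = 0 by omega]; simp
    · apply Subtype.ext
      rw [map_zero, zero_add, Subalgebra.coe_mul, exu, AddMonoidAlgebra.single_mul_single]
      simp

include hJ in
lemma exR_noeth [IsNoetherianRing R] : IsNoetherianRing (exR J) := by
  let g : MvPolynomial (Fin d) R →+* exR J := (exφ x hJ).toRingHom
  let G : (MvPolynomial (Fin d) R)[X] →+* exR J := Polynomial.eval₂RingHom g (exu J)
  refine isNoetherianRing_of_surjective _ _ G ?_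
  intro p
  refine exR_induction (AddMonoidHom.mrange G.toAddMonoidHom) ?_ p
  intro n a ha
  by_cases hn : 0 ≤ n
  · obtain ⟨m, rfl⟩ := Int.eq_ofNat_of_zero_le hn
    obtain ⟨f, hf⟩ := single_eq_φ x hJ (n := m) (a := a) (by simpa using ha)
    refine ⟨Polynomial.C f, ?_⟩
    apply Subtype.ext
    change ((G (Polynomial.C f) : exR J) : R[T;T⁻¹]) = _
    rw [show G (Polynomial.C f) = exφ x hJ f from Polynomial.eval₂_C _ _]
    exact hf
  · refine ⟨Polynomial.C (MvPolynomial.C a) * Polynomial.X ^ (-n).toNat, ?_⟩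
    apply Subtype.ext
    change ((G _ : exR J) : R[T;T⁻¹]) = _
    rw [map_mul, map_pow, show G (Polynomial.C (MvPolynomial.C a)) = exφ x hJ (MvPolynomial.C a) from
      Polynomial.eval₂_C _ _, show G Polynomial.X = exu J from Polynomial.eval₂_X _ _]
    rw [Subalgebra.coe_mul, Subalgebra.coe_pow, exu, exφ, MvPolynomial.aeval_C,
      AddMonoidAlgebra.single_pow]
    change AddMonoidAlgebra.single 0 a * _ = _
    rw [AddMonoidAlgebra.single_mul_single]
    congr 1
    · rw [zero_add, nsmul_eq_mul]; rw [Int.toNat_of_nonneg (by omega)]; ring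
    · simp

end GS
end SallyAux

namespace SallyAux
section N2t
lemma N2_transfer {A B k σ : Type*} [CommRing A] [CommRing B] [Algebra A B] [Algebra.IsIntegral A B]
    [Field k] [Finite σ]
    (π : A →+* MvPolynomial σ k) (hπ : Function.Surjective π) (M : Ideal B) [M.IsPrime]
    (hM : ∀ a, algebraMap A B a ∈ M ↔ π a = 0) (l : Finset B)
    (hl : ∀ b, ∃ s, π s ≠ 0 ∧ s • (Ideal.Quotient.mk M b) ∈
      Submodule.span A ((fun b => Ideal.Quotient.mk M b) '' (l : Set B))) :
    Module.Finite A (B ⧸ M) := by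
  classical
  let ρ : MvPolynomial σ k →+* B ⧸ M := RingHom.liftOfSurjective π hπ ⟨algebraMap A (B ⧸ M), by
    intro a ha
    rw [RingHom.mem_ker] at ha ⊢
    rw [IsScalarTower.algebraMap_apply A B (B ⧸ M)]
    exact Ideal.Quotient.eq_zero_iff_mem.2 ((hM a).2 ha)⟩
  have hρ : ∀ a, ρ (π a) = algebraMap A (B ⧸ M) a := fun a =>
    RingHom.liftOfSurjective_comp_apply π hπ _ a
  let _ : Algebra (MvPolynomial σ k) (B ⧸ M) := ρ.toAlgebra
  have hsm : ∀ a (c : B ⧸ M), π a • c = a • c := by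
    intro a c
    rw [Algebra.smul_def, Algebra.smul_def, ← hρ]; rfl
  have hspan : ∀ (s : Set (B ⧸ M)) c, c ∈ Submodule.span A s ↔
      c ∈ Submodule.span (MvPolynomial σ k) s := by
    intro s c
    constructor
    · intro h
      induction h using Submodule.span_induction with
      | mem x hx => exact Submodule.subset_span hx
      | zero => exact Submodule.zero_mem _
      | add x y _ _ h1 h2 => exact Submodule.add_mem _ h1 h2
      | smul a x _ h1 => rw [← hsm]; exact Submodule.smul_mem _ _ h1
    · intro h
      induction h using Submodule.span_induction with
      | mem x hx => exact Submodule.subset_span hx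
      | zero => exact Submodule.zero_mem _
      | add x y _ _ h1 h2 => exact Submodule.add_mem _ h1 h2
      | smul a x _ h1 =>
        obtain ⟨a, rfl⟩ := hπ a
        rw [hsm]; exact Submodule.smul_mem _ _ h1
  have hinj : Function.Injective (algebraMap (MvPolynomial σ k) (B ⧸ M)) := by
    rw [injective_iff_map_eq_zero]
    intro f hf
    obtain ⟨a, rfl⟩ := hπ f
    have : algebraMap A (B ⧸ M) a = 0 := by rw [← hρ]; exact hf
    rw [IsScalarTower.algebraMap_apply A B (B ⧸ M)] at this
    exact (hM a).1 (Ideal.Quotient.eq_zero_iff_mem.1 this)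
  have hInt : Algebra.IsIntegral (MvPolynomial σ k) (B ⧸ M) := by
    constructor
    intro c
    obtain ⟨b, rfl⟩ := Ideal.Quotient.mk_surjective c
    obtain ⟨q, hq, hq0⟩ := Algebra.IsIntegral.isIntegral (R := A) b
    refine ⟨q.map π, hq.map π, ?_⟩
    rw [Polynomial.eval₂_map]
    have h1 : (algebraMap (MvPolynomial σ k) (B ⧸ M)).comp π =
        (Ideal.Quotient.mk M).comp (algebraMap A B) := by
      ext a; exact hρ a
    rw [h1, ← Polynomial.hom_eval₂, hq0, map_zero]
  have := N2 (k := k) (σ := σ) hinj (l.image (Ideal.Quotient.mk M)) (by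
    intro c
    obtain ⟨b, rfl⟩ := Ideal.Quotient.mk_surjective c
    obtain ⟨s, hs, hsb⟩ := hl b
    refine ⟨π s, hs, ?_⟩
    rw [hsm, ← hspan, Finset.coe_image]
    exact hsb)
  obtain ⟨F, hF⟩ := this.1
  refine ⟨F, ?_⟩
  rw [eq_top_iff]
  intro c _
  rw [hspan, hF]; trivial

lemma pow_sup_le {A : Type*} [CommRing A] {P Q U : Ideal A} (h : P ≤ Q ⊔ U) (c : ℕ) :
    P ^ c ≤ Q ^ c ⊔ U := by
  induction c with
  | zero => simp
  | succ c ih =>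
    rw [pow_succ, pow_succ]
    refine (Ideal.mul_mono ih h).trans ?_
    rw [Ideal.sup_mul, Ideal.mul_sup]
    exact sup_le (sup_le le_sup_left (Ideal.mul_le_right.trans le_sup_right))
      (Ideal.mul_le_left.trans le_sup_right)

theorem finite_iC {A W k σ : Type*} [CommRing A] [CommRing W] [Algebra A W] [IsNoetherianRing A]
    [Field k] [Finite σ] (π : A →+* MvPolynomial σ k) (hπ : Function.Surjective π)
    (hinj : Function.Injective (algebraMap A W)) {u : A}
    (hu : IsUnit (algebraMap A W u))
    (hW : ∀ w : W, ∃ n : ℕ, u ^ n • w ∈ (1 : Submodule A W))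
    (hup : π u = 0) {c : ℕ} {Q : Ideal A} (hQ : Q ^ c ≤ Ideal.span {u})
    (hpQ : ∀ a, π a = 0 → a ∈ Q ⊔ Ideal.span {u})
    (hs : ∀ s, π s ≠ 0 → ∀ b, s * b ∈ Ideal.span {u} → b ∈ Ideal.span {u}) :
    ∃ F : Finset (integralClosure A W), ∀ b : (integralClosure A W),
      b ∈ Submodule.span A (F : Set (integralClosure A W)) ⊔
      LinearMap.range (LinearMap.lsmul A (integralClosure A W) u) := by
  have hp : (RingHom.ker π).IsPrime := RingHom.ker_isPrime π
  refine finite_integralClosure (RingHom.ker π) hinj hu hW (RingHom.mem_ker.2 hup) (c := c) ?_ hs ?_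
  · exact (pow_sup_le hpQ c).trans (sup_le hQ le_rfl)
  · intro M hMp hM ⟨l, hl⟩
    exact N2_transfer π hπ M hM l hl
end N2t

section main
variable {R : Type*} [CommRing R]
open scoped LaurentPolynomial

lemma upow_mul_coeff (J : Ideal R) (n : ℕ) (p : R[T;T⁻¹]) (k : ℤ) :
    (exu J ^ n • p).coeff k = p.coeff (k + n) := by
  have h : exu J ^ n • p = (AddMonoidAlgebra.single (-(n:ℤ)) 1 : R[T;T⁻¹]) * p := by
    change ((exu J ^ n : exR J) : R[T;T⁻¹]) * p = _
    rw [Subalgebra.coe_pow, exu, AddMonoidAlgebra.single_pow]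
    simp
  rw [h, AddMonoidAlgebra.coeff_single_mul_apply, one_mul]
  congr 1
  ring

lemma mem_one_exR {J : Ideal R} {p : R[T;T⁻¹]} :
    p ∈ (1 : Submodule (exR J) R[T;T⁻¹]) ↔ p ∈ exR J := by
  rw [Submodule.mem_one]
  exact ⟨fun ⟨y, hy⟩ => hy ▸ y.2, fun h => ⟨⟨p, h⟩, rfl⟩⟩

lemma exR_absorb {J : Ideal R} (w : R[T;T⁻¹]) :
    ∃ n : ℕ, exu J ^ n • w ∈ (1 : Submodule (exR J) R[T;T⁻¹]) := by
  refine ⟨∑ i ∈ w.coeff.support, i.toNat, ?_⟩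
  rw [mem_one_exR, mem_exR]
  intro k
  rw [upow_mul_coeff]
  by_cases hk : k ≤ 0
  · rw [Int.toNat_of_nonpos hk]; simp
  · have : w.coeff (k + (∑ i ∈ w.coeff.support, i.toNat : ℕ)) = 0 := by
      by_contra h
      have h1 := Finset.single_le_sum (f := fun i : ℤ => i.toNat) (fun i _ => Nat.zero_le _)
        (Finsupp.mem_support_iff.2 h)
      simp only at h1
      omega
    rw [this]
    exact Ideal.zero_mem _

variable {d : ℕ} {J : Ideal R} (x : Fin d → R) (hJ : J = Ideal.span (Set.range x))

include hJ in
theorem exR_finite [IsNoetherianRing R] [IsLocalRing R] (hx : WReg x)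
    (hrad : J.radical = maximalIdeal R) :
    ∃ F : Finset (integralClosure (exR J) R[T;T⁻¹]), ∀ b, b ∈ Submodule.span (exR J) (F : Set _) ⊔
      LinearMap.range (LinearMap.lsmul (exR J) (integralClosure (exR J) R[T;T⁻¹]) (exu J)) := by
  have hQ := hx.QR
  have hnoeth := exR_noeth x hJ
  let ψ : MvPolynomial (Fin d) R →+* exR J ⧸ Ideal.span {exu J} :=
    (Ideal.Quotient.mk _).comp (exφ x hJ).toRingHom
  have hψ : Function.Surjective ψ := by
    intro a
    obtain ⟨a, rfl⟩ := Ideal.Quotient.mk_surjective a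
    obtain ⟨f, q, rfl⟩ := exists_φ_add x hJ a
    refine ⟨f, ?_⟩
    refine (Ideal.Quotient.eq.2 ?_)
    exact Ideal.mem_span_singleton'.2 ⟨-q, by simp; ring⟩
  have hJm : J ≤ maximalIdeal R := hrad ▸ Ideal.le_radical
  let gg : {g : MvPolynomial (Fin d) R →+* MvPolynomial (Fin d) (ResidueField R) //
      RingHom.ker ψ ≤ RingHom.ker g} := ⟨MvPolynomial.map (residue R), by
      intro f hf
      rw [RingHom.mem_ker] at hf ⊢
      have := exφ_mem_u x hJ hQ (Ideal.Quotient.eq_zero_iff_mem.1 hf)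
      ext β
      rw [MvPolynomial.coeff_map, MvPolynomial.coeff_zero, residue_eq_zero_iff]
      exact hJm (this β)⟩
  let π0 : exR J ⧸ Ideal.span {exu J} →+* MvPolynomial (Fin d) (ResidueField R) :=
    RingHom.liftOfSurjective ψ hψ gg
  let π : exR J →+* MvPolynomial (Fin d) (ResidueField R) := π0.comp (Ideal.Quotient.mk _)
  have hπφ : ∀ f, π (exφ x hJ f) = MvPolynomial.map (residue R) f := fun f =>
    RingHom.liftOfSurjective_comp_apply ψ hψ gg f
  have hπu : π (exu J) = 0 := by
    change π0 (Ideal.Quotient.mk _ _) = 0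
    rw [Ideal.Quotient.eq_zero_iff_mem.2 (Ideal.mem_span_singleton_self _), map_zero]
  have hπs : Function.Surjective π := by
    intro g
    obtain ⟨f, rfl⟩ := MvPolynomial.map_surjective _ residue_surjective g
    exact ⟨_, hπφ f⟩
  obtain ⟨c, hc⟩ := Ideal.exists_radical_pow_le_of_fg J (IsNoetherian.noetherian _)
  rw [hrad] at hc
  have hker : ∀ a, π a = 0 → a ∈ (maximalIdeal R).map (algebraMap R (exR J)) ⊔ Ideal.span {exu J} := by
    intro a ha
    obtain ⟨f, q, rfl⟩ := exists_φ_add x hJ a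
    rw [map_add, map_mul, hπu, zero_mul, add_zero, hπφ] at ha
    refine Ideal.add_mem _ (Ideal.mem_sup_left ?_)
      (Ideal.mem_sup_right (Ideal.mul_mem_right _ _ (Ideal.mem_span_singleton_self _)))
    refine exφ_mem_of_coeff x hJ _ fun β => Ideal.mem_map_of_mem _ ?_
    rw [← residue_eq_zero_iff, ← MvPolynomial.coeff_map, ha, MvPolynomial.coeff_zero]
  have h4 : ((maximalIdeal R).map (algebraMap R (exR J))) ^ c ≤ Ideal.span {exu J} := by
    rw [← Ideal.map_pow]
    exact Ideal.map_le_iff_le_comap.2 fun j hj => algebraMap_mem_u (hc hj)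
  refine finite_iC π hπs Subtype.val_injective (u := exu J) ?_ exR_absorb hπu h4 hker ?_
  · refine ⟨⟨AddMonoidAlgebra.single (-1) 1, AddMonoidAlgebra.single 1 1, ?_, ?_⟩, rfl⟩
    · rw [AddMonoidAlgebra.single_mul_single]; simp
    · rw [AddMonoidAlgebra.single_mul_single]; simp
  · intro s hs b hb
    obtain ⟨f, q, rfl⟩ := exists_φ_add x hJ s
    obtain ⟨g, q', rfl⟩ := exists_φ_add x hJ b
    rw [map_add, map_mul, hπu, zero_mul, add_zero, hπφ] at hs
    obtain ⟨β, hβ⟩ := MvPolynomial.ne_zero_iff.1 hs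
    rw [MvPolynomial.coeff_map, residue_ne_zero_iff_isUnit] at hβ
    have h1 : exφ x hJ (f * g) ∈ Ideal.span {exu J} := by
      obtain ⟨r, hr⟩ := Ideal.mem_span_singleton'.1 hb
      refine Ideal.mem_span_singleton'.2 ⟨r - q * (exφ x hJ g + exu J * q') - q' * exφ x hJ f, ?_⟩
      rw [map_mul]
      linear_combination hr
    have h2 := prim_nzd J hβ (exφ_mem_u x hJ hQ h1)
    refine Ideal.add_mem _ (exφ_mem_of_coeff x hJ _ fun β => algebraMap_mem_u (h2 β))
      (Ideal.mul_mem_right _ _ (Ideal.mem_span_singleton_self _))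
end main
end SallyAux

namespace SallyAux
section K3
variable {R : Type*} [CommRing R]
open scoped LaurentPolynomial

lemma pow_sub_top (w : R[T;T⁻¹]) (N : ℤ) (hw : ∀ n, N < n → w.coeff n = 0) (i : ℕ) :
    w ^ i - AddMonoidAlgebra.single (i * N) (w.coeff N ^ i) ∈
      GS (fun n => if n < i * N then (⊤ : Ideal R) else ⊥) := by
  have h1 : w ∈ GS (fun n => if n ≤ N then (⊤ : Ideal R) else ⊥) := by
    intro n
    dsimp only
    split_ifs with h
    · trivial
    · rw [hw n (by omega)]; exact Ideal.zero_mem _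
  have h2 : w - AddMonoidAlgebra.single N (w.coeff N) ∈
      GS (fun n => if n < N then (⊤ : Ideal R) else ⊥) := by
    intro n
    dsimp only
    split_ifs with h
    · trivial
    · rw [AddMonoidAlgebra.coeff_sub, AddMonoidAlgebra.coeff_single, Finsupp.sub_apply,
        Finsupp.single_apply]
      split_ifs with h'
      · subst h'; simp
      · rw [hw n (by omega)]; simp
  induction i with
  | zero => simp
  | succ i ih =>
    have h3 : w ^ (i + 1) - AddMonoidAlgebra.single ((i + 1 : ℕ) * N) (w.coeff N ^ (i + 1)) =
      (w ^ i - AddMonoidAlgebra.single (i * N) (w.coeff N ^ i)) * w +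
        AddMonoidAlgebra.single (i * N) (w.coeff N ^ i) * (w - AddMonoidAlgebra.single N (w.coeff N)) := by
      rw [mul_sub, AddMonoidAlgebra.single_mul_single, sub_mul, pow_succ, pow_succ]
      have : ((i + 1 : ℕ) : ℤ) * N = i * N + N := by push_cast; ring
      rw [this]
      abel
    rw [h3]
    have he : ((i + 1 : ℕ) : ℤ) * N = i * N + N := by push_cast; ring
    refine Submodule.add_mem _ (GS_mul ?_ ih h1)
      (GS_mul (F := fun n => if n = i * N then (⊤ : Ideal R) else ⊥) ?_ (single_mem_GS ?_) h2)
    · intro a b y hy z hz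
      rw [he]
      split_ifs at hy hz ⊢ <;> first | trivial | (exfalso; omega) |
        (rw [Ideal.mem_bot] at *; simp [*])
    · intro a b y hy z hz
      rw [he]
      split_ifs at hy hz ⊢ <;> first | trivial | (exfalso; omega) |
        (rw [Ideal.mem_bot] at *; simp [*])
    · simp

lemma coeff_pow_top (w : R[T;T⁻¹]) (N : ℤ) (hw : ∀ n, N < n → w.coeff n = 0) (i : ℕ) :
    (w ^ i).coeff (i * N) = w.coeff N ^ i := by
  have := pow_sub_top w N hw i (i * N)
  simp only [lt_irrefl, if_false] at this
  rw [Ideal.mem_bot, AddMonoidAlgebra.coeff_sub, Finsupp.sub_apply, AddMonoidAlgebra.coeff_single,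
    Finsupp.single_eq_same, sub_eq_zero] at this
  exact this

variable {I J : Ideal R}

lemma exu_isUnit : IsUnit (algebraMap (exR J) R[T;T⁻¹] (exu J)) := by
  refine ⟨⟨AddMonoidAlgebra.single (-1) 1, AddMonoidAlgebra.single 1 1, ?_, ?_⟩, rfl⟩
  · rw [AddMonoidAlgebra.single_mul_single]; simp
  · rw [AddMonoidAlgebra.single_mul_single]; simp

variable [IsNoetherianRing (exR J)]

lemma single_integral {z : R} {n : ℤ} {k : ℕ} (h : ∀ i : ℕ, z ^ i ∈ J ^ (i * n - k).toNat) :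
    IsIntegral (exR J) (AddMonoidAlgebra.single n z : R[T;T⁻¹]) := by
  refine isIntegral_of_almost (A := exR J) (W := R[T;T⁻¹]) (u := exu J) (k := k)
    Subtype.val_injective exu_isUnit ?_
  intro i
  rw [mem_one_exR, mem_exR]
  intro m
  rw [upow_mul_coeff, AddMonoidAlgebra.single_pow, AddMonoidAlgebra.coeff_single, Finsupp.single_apply]
  split_ifs with hm
  · convert h i using 2
    have : i • n = i * n := by simp
    omega
  · exact Ideal.zero_mem _

lemma coeff_integral (w : R[T;T⁻¹]) (hw : IsIntegral (exR J) w) (n : ℤ) :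
    IsIntegral (exR J) (AddMonoidAlgebra.single n (w.coeff n) : R[T;T⁻¹]) := by
  classical
  induction hc : w.coeff.support.card using Nat.strong_induction_on generalizing w with
  | _ c ih =>
    by_cases h0 : w.coeff.support.Nonempty
    · let N := w.coeff.support.max' h0
      have hN : ∀ n, N < n → w.coeff n = 0 := by
        intro n hn
        by_contra h
        exact absurd (Finset.le_max' _ n (Finsupp.mem_support_iff.2 h)) (not_le.2 hn)
      obtain ⟨k, hk⟩ := almost_of_isIntegral (A := exR J) (u := exu J) exR_absorb hw
      have hs : IsIntegral (exR J) (AddMonoidAlgebra.single N (w.coeff N) : R[T;T⁻¹]) := by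
        refine single_integral (k := k) fun i => ?_
        have := hk i
        rw [mem_one_exR, mem_exR] at this
        have h1 := this (i * N - k)
        rw [upow_mul_coeff, sub_add_cancel, coeff_pow_top w N hN] at h1
        exact h1
      by_cases hn : n = N
      · rw [hn]; exact hs
      · have h2 : (w - AddMonoidAlgebra.single N (w.coeff N)).coeff = w.coeff.erase N := by
          ext m
          rw [AddMonoidAlgebra.coeff_sub, Finsupp.sub_apply, AddMonoidAlgebra.coeff_single,
            Finsupp.single_apply, Finsupp.erase_apply]
          by_cases hm : m = N
          · subst hm; simp
          · simp [hm, Ne.symm hm]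
        have h3 := ih _ ?_ (w - AddMonoidAlgebra.single N (w.coeff N)) (hw.sub hs) rfl
        · rw [h2, Finsupp.erase_ne hn] at h3; exact h3
        · rw [h2, Finsupp.support_erase, ← hc]
          exact Finset.card_erase_lt_of_mem (Finset.max'_mem _ h0)
    · rw [Finset.not_nonempty_iff_eq_empty, Finsupp.support_eq_empty] at h0
      rw [h0]; simp [isIntegral_zero]

/-- The normal filtration, indexed by integers. -/
def nF (I : Ideal R) (n : ℤ) : Ideal R := intCl (I ^ n.toNat)

lemma integral_pow_mem {K : Ideal R} {y : R} {r : ℕ} {a : ℕ → R}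
    (ha : ∀ i ∈ Finset.Icc 1 r, a i ∈ K ^ i)
    (h : y ^ r + ∑ i ∈ Finset.Icc 1 r, a i * y ^ (r - i) = 0) (i : ℕ) : y ^ i ∈ K ^ (i - r) := by
  induction i using Nat.strong_induction_on with
  | _ i ih =>
    by_cases hi : i ≤ r
    · rw [Nat.sub_eq_zero_of_le hi]; simp
    · have h1 : y ^ i = - ∑ j ∈ Finset.Icc 1 r, a j * y ^ (i - j) := by
        have h2 : y ^ i = y ^ (i - r) * y ^ r := by rw [← pow_add]; congr 1; omega
        rw [h2, eq_neg_of_add_eq_zero_left h, mul_neg, Finset.mul_sum]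
        congr 1
        refine Finset.sum_congr rfl fun j hj => ?_
        rw [Finset.mem_Icc] at hj
        rw [mul_left_comm, ← pow_add]
        congr 2
        omega
      rw [h1]
      refine neg_mem (Ideal.sum_mem _ fun j hj => ?_)
      have h3 := Ideal.mul_mem_mul (ha j hj) (ih (i - j) (by rw [Finset.mem_Icc] at hj; omega))
      rw [← pow_add] at h3
      exact Ideal.pow_le_pow_right (by omega) h3

lemma single_integral_of_mem {N : ℕ} (hN : ∀ i, I ^ (N + i) ≤ J ^ i) {n : ℤ} {z : R} (hz : z ∈ nF I n) :
    IsIntegral (exR J) (AddMonoidAlgebra.single n z : R[T;T⁻¹]) := by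
  unfold nF intCl at hz
  induction hz using Submodule.span_induction with
  | zero => simp [isIntegral_zero]
  | add a b _ _ ha hb => rw [AddMonoidAlgebra.single_add]; exact ha.add hb
  | smul r a _ ha =>
    have h1 : IsIntegral (exR J) (AddMonoidAlgebra.single 0 r : R[T;T⁻¹]) :=
      isIntegral_algebraMap (x := (⟨_, single_mem_exR (J := J) (n := 0) (a := r) (by simp)⟩ : exR J))
    have := h1.mul ha
    rwa [AddMonoidAlgebra.single_mul_single, zero_add] at this
  | mem y hy =>
    obtain ⟨r, hr, a, ha, h⟩ := hy
    refine single_integral (k := n.toNat * r + N) fun i => ?_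
    have h1 := integral_pow_mem ha h i
    rw [← pow_mul] at h1
    by_cases h2 : N ≤ n.toNat * (i - r)
    · obtain ⟨m, hm⟩ := Nat.exists_eq_add_of_le h2
      rw [hm] at h1
      refine Ideal.pow_le_pow_right ?_ (hN m h1)
      rcases le_total n 0 with hn | hn
      · have : (i : ℤ) * n ≤ 0 := mul_nonpos_of_nonneg_of_nonpos (by positivity) hn
        omega
      · obtain ⟨n, rfl⟩ := Int.eq_ofNat_of_zero_le hn
        simp only [Int.toNat_natCast] at hm ⊢
        have : n * i ≤ n * (i - r) + n * r := by rw [← mul_add]; exact Nat.mul_le_mul le_rfl (by omega)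
        have h' : (i : ℤ) * n = ((n * i : ℕ) : ℤ) := by push_cast; ring
        rw [h']
        omega
    · have : (i * n - ((n.toNat * r + N : ℕ) : ℤ)).toNat = 0 := by
        rcases le_total n 0 with hn | hn
        · have : (i : ℤ) * n ≤ 0 := mul_nonpos_of_nonneg_of_nonpos (by positivity) hn
          omega
        · obtain ⟨n, rfl⟩ := Int.eq_ofNat_of_zero_le hn
          simp only [Int.toNat_natCast] at h2 ⊢
          have : n * i ≤ n * (i - r) + n * r := by rw [← mul_add]; exact Nat.mul_le_mul le_rfl (by omega)
          have h' : (i : ℤ) * n = ((n * i : ℕ) : ℤ) := by push_cast; ring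
          rw [h']
          omega
      rw [this]; simp

omit [IsNoetherianRing (exR J)] in
lemma mem_of_single_integral [Nontrivial R] (hJI : J ≤ I) {n : ℤ} {z : R}
    (h : IsIntegral (exR J) (AddMonoidAlgebra.single n z : R[T;T⁻¹])) : z ∈ nF I n := by
  obtain ⟨q, hq, hq0⟩ := h
  apply Ideal.subset_span
  have hr : 0 < q.natDegree := by
    rw [Nat.pos_iff_ne_zero]
    intro h
    rw [hq.natDegree_eq_zero.1 h] at hq0
    simp at hq0
  refine ⟨q.natDegree, hr, fun i => (q.coeff (q.natDegree - i) : R[T;T⁻¹]).coeff (i * n), ?_, ?_⟩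
  · intro i hi
    have := (q.coeff (q.natDegree - i)).2 (i * n)
    dsimp only at this
    rw [← pow_mul]
    refine Ideal.pow_right_mono hJI _ ?_
    convert this using 2
    rcases le_total n 0 with hn | hn
    · have : (i : ℤ) * n ≤ 0 := mul_nonpos_of_nonneg_of_nonpos (by positivity) hn
      rw [Int.toNat_of_nonpos hn, Int.toNat_of_nonpos this, zero_mul]
    · obtain ⟨n, rfl⟩ := Int.eq_ofNat_of_zero_le hn
      rw [← Int.natCast_mul, Int.toNat_natCast, Int.toNat_natCast, mul_comm]
  · rw [Polynomial.eval₂_eq_sum_range] at hq0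
    have h1 := congrArg (fun w : R[T;T⁻¹] => w.coeff (q.natDegree * n)) hq0
    simp only [AddMonoidAlgebra.coeff_sum, AddMonoidAlgebra.coeff_zero, Finsupp.coe_zero, Pi.zero_apply,
      Finsupp.finsetSum_apply] at h1
    have h2 : ∀ i ∈ Finset.range (q.natDegree + 1), ((algebraMap (exR J) R[T;T⁻¹] (q.coeff i)) *
        (AddMonoidAlgebra.single n z : R[T;T⁻¹]) ^ i).coeff (q.natDegree * n) =
        (q.coeff i : R[T;T⁻¹]).coeff ((q.natDegree - i : ℕ) * n) * z ^ i := by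
      intro i hi
      rw [AddMonoidAlgebra.single_pow, AddMonoidAlgebra.coeff_mul_single_apply]
      congr 2
      rw [nsmul_eq_mul, Nat.cast_sub (by rw [Finset.mem_range] at hi; omega)]
      ring
    rw [Finset.sum_congr rfl h2, Finset.sum_range_succ] at h1
    rw [show (q.coeff q.natDegree) = 1 from hq] at h1
    have h3 : ((1 : exR J) : R[T;T⁻¹]).coeff ((q.natDegree - q.natDegree : ℕ) * n) = 1 := by
      rw [Nat.sub_self, Nat.cast_zero, zero_mul]
      exact AddMonoidAlgebra.coeff_one_zero
    rw [h3, one_mul, add_comm] at h1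
    rw [← h1]
    congr 1
    refine Finset.sum_bij' (fun i _ => q.natDegree - i) (fun i _ => q.natDegree - i) ?_ ?_ ?_ ?_ ?_
    · intro i hi; rw [Finset.mem_Icc] at hi; rw [Finset.mem_range]; omega
    · intro i hi; rw [Finset.mem_range] at hi; rw [Finset.mem_Icc]; omega
    · intro i hi; rw [Finset.mem_Icc] at hi; omega
    · intro i hi; rw [Finset.mem_range] at hi; omega
    · intro i hi
      rw [Finset.mem_Icc] at hi
      rw [Nat.sub_sub_self hi.2]

theorem isIntegral_iff_GS [Nontrivial R] (hJI : J ≤ I) {N : ℕ} (hN : ∀ i, I ^ (N + i) ≤ J ^ i)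
    {w : R[T;T⁻¹]} : IsIntegral (exR J) w ↔ w ∈ GS (nF I) := by
  constructor
  · intro h n
    exact mem_of_single_integral hJI (coeff_integral w h n)
  · intro h
    exact GS_le_of (F := nF I) ((integralClosure (exR J) R[T;T⁻¹]).toSubsemiring.toAddSubmonoid)
      (fun n a ha => single_integral_of_mem hN ha) h

end K3
end SallyAux

namespace SallyAux
section X
open CategoryTheory Abelian Limits RingTheory.Sequence
open scoped Pointwise
universe u
variable {A : Type u} [CommRing A]

lemma ext_of_regular (k : ModuleCat.{u} A) (rs : List A) : ∀ (N : ModuleCat.{u} A)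
    (_ : ∀ r ∈ rs, r ∈ Module.annihilator A k) (_ : IsWeaklyRegular N rs),
    ∀ i < rs.length, Subsingleton (Ext k N i) := by
  induction rs with
  | nil => simp
  | cons a rs ih =>
    intro N hann hr i hi
    rw [isWeaklyRegular_cons_iff] at hr
    simp only [List.mem_cons, forall_eq_or_imp] at hann
    simp only [List.length_cons] at hi
    match i with
    | 0 =>
      have : Subsingleton (k →ₗ[A] N) := by
        constructor
        intro f g
        ext y
        have h0 : ∀ f : k →ₗ[A] N, f y = 0 := by
          intro f
          apply hr.1
          change a • f y = a • 0
          rw [smul_zero, ← map_smul, Module.mem_annihilator.1 hann.1, map_zero]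
        rw [h0, h0]
      exact (Ext.addEquiv₀.trans ModuleCat.homAddEquiv).subsingleton
    | i + 1 =>
      let g := (AddCommGrpCat.ofHom ((Ext.mk₀ (ModuleCat.smulShortComplex N a).f).postcomp k
          (add_zero (i + 1))))
      have mono_g : Mono g := by
        apply (Ext.covariant_sequence_exact₁' k hr.1.smulShortComplex_shortExact i (i + 1)
            rfl).mono_g ((AddCommGrpCat.isZero_of_iff_subsingleton.mpr ?_).eq_zero_of_src _)
        exact ih (ModuleCat.of A (QuotSMulTop a N)) hann.2 hr.2 i (by omega)
      have zero_g : g = 0 := Ext.postcomp_smul_id_eq_zero_of_mem_annihilator hann.1 (i + 1)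
      exact AddCommGrpCat.subsingleton_of_isZero (IsZero.of_mono_eq_zero _ zero_g)

lemma ext_equiv (k : ModuleCat.{u} A) {M N : Type u} [AddCommGroup M] [Module A M]
    [AddCommGroup N] [Module A N] (e : M ≃ₗ[A] N) (i : ℕ)
    (h : Subsingleton (Ext k (ModuleCat.of A M) i)) : Subsingleton (Ext k (ModuleCat.of A N) i) := by
  have f : AddCommGrpCat.of (Ext k (ModuleCat.of A M) i) ≅ AddCommGrpCat.of (Ext k (ModuleCat.of A N) i) :=
    (extFunctorObj k i).mapIso e.toModuleIso
  exact f.addCommGroupIsoToAddEquiv.symm.toEquiv.subsingleton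

section ses
variable {W : Type u} [AddCommGroup W] [Module A W] (P Q : Submodule A W) (hPQ : P ≤ Q)

/-- The short complex `P → Q → Q/P`. -/
noncomputable def sesC : ShortComplex (ModuleCat.{u} A) :=
  ShortComplex.mk (ModuleCat.ofHom (Submodule.inclusion hPQ))
    (ModuleCat.ofHom (P.comap Q.subtype).mkQ) (by
      ext z
      simp only [ModuleCat.hom_comp, ModuleCat.hom_ofHom, LinearMap.comp_apply, ModuleCat.hom_zero,
        LinearMap.zero_apply]
      rw [Submodule.mkQ_apply, Submodule.Quotient.mk_eq_zero]
      exact z.2)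

lemma sesC_exact : (sesC P Q hPQ).ShortExact := by
  have h1 : Mono (sesC P Q hPQ).f := (ModuleCat.mono_iff_injective _).2 (Submodule.inclusion_injective hPQ)
  have h2 : Epi (sesC P Q hPQ).g := (ModuleCat.epi_iff_surjective _).2 (Submodule.mkQ_surjective _)
  refine ShortComplex.ShortExact.mk ?_
  rw [ShortComplex.moduleCat_exact_iff]
  intro z hz
  have key : ∀ z : Q, Submodule.Quotient.mk (p := P.comap Q.subtype) z = 0 → (z : W) ∈ P := by
    intro z hz'
    rw [Submodule.Quotient.mk_eq_zero] at hz'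
    exact hz'
  have hz' := key z hz
  exact ⟨(⟨z.1, hz'⟩ : P), rfl⟩

include hPQ in
lemma ext_mid (k : ModuleCat.{u} A) (i : ℕ) (h1 : Subsingleton (Ext k (ModuleCat.of A P) i))
    (h2 : Subsingleton (Ext k (ModuleCat.of A (Q ⧸ P.comap Q.subtype)) i)) :
    Subsingleton (Ext k (ModuleCat.of A Q) i) := by
  have zero1 := AddCommGrpCat.isZero_of_iff_subsingleton.mpr h1
  have zero2 := AddCommGrpCat.isZero_of_iff_subsingleton.mpr h2
  exact AddCommGrpCat.subsingleton_of_isZero <| ShortComplex.Exact.isZero_of_both_zeros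
    ((Ext.covariant_sequence_exact₂' k (sesC_exact P Q hPQ)) i)
    (zero1.eq_zero_of_src _) (zero2.eq_zero_of_tgt _)

include hPQ in
lemma ext_right (k : ModuleCat.{u} A) (i : ℕ) (h1 : Subsingleton (Ext k (ModuleCat.of A Q) i))
    (h2 : Subsingleton (Ext k (ModuleCat.of A P) (i + 1))) :
    Subsingleton (Ext k (ModuleCat.of A (Q ⧸ P.comap Q.subtype)) i) := by
  have zero1 := AddCommGrpCat.isZero_of_iff_subsingleton.mpr h1
  have zero2 := AddCommGrpCat.isZero_of_iff_subsingleton.mpr h2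
  exact AddCommGrpCat.subsingleton_of_isZero <| ShortComplex.Exact.isZero_of_both_zeros
    ((Ext.covariant_sequence_exact₃' k (sesC_exact P Q hPQ)) i (i + 1) rfl)
    (zero1.eq_zero_of_src _) (zero2.eq_zero_of_tgt _)
end ses

/-- The homological core. -/
theorem reg_core [IsNoetherianRing A] {W : Type u} [AddCommGroup W] [Module A W]
    (Lm Mm Rm : Submodule A W) (hLM : Lm ≤ Mm) (hMR : Mm ≤ Rm) (e : Mm ≃ₗ[A] Rm)
    (P : Ideal A) (hfin : Module.Finite A (Rm ⧸ Mm.comap Rm.subtype))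
    (hlt : P • (⊤ : Submodule A (Rm ⧸ Mm.comap Rm.subtype)) ≠ ⊤)
    (ts ss : List A) (hts : ∀ r ∈ ts, r ∈ P) (hss : ∀ r ∈ ss, r ∈ P)
    (hreg : IsWeaklyRegular Lm ts) (hregs : IsWeaklyRegular (Mm ⧸ Lm.comap Mm.subtype) ss)
    (hlen : ss.length ≤ ts.length) (n : ℕ) (hn : n + 1 = ss.length) :
    ∃ rs : List A, rs.length = n ∧ (∀ r ∈ rs, r ∈ P) ∧ IsRegular (Rm ⧸ Mm.comap Rm.subtype) rs := by
  let k : ModuleCat.{u} A := ModuleCat.of A (A ⧸ P)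
  have hann : Module.annihilator A k = P := Ideal.annihilator_quotient
  have hM : ∀ i < n + 1, Subsingleton (Ext k (ModuleCat.of A Mm) i) := by
    intro i hi
    refine ext_mid Lm Mm hLM k i ?_ ?_
    · exact ext_of_regular k ts (ModuleCat.of A Lm) (by rw [hann]; exact hts) hreg i (by omega)
    · exact ext_of_regular k ss (ModuleCat.of A _) (by rw [hann]; exact hss) hregs i (by omega)
  have hfin' : Module.Finite A (ModuleCat.of A (Rm ⧸ Mm.comap Rm.subtype)) := hfin
  have hfink : Module.Finite A k := Module.Finite.quotient A P
  refine ModuleCat.exists_isRegular_of_exists_subsingleton_ext P n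
    (ModuleCat.of A (Rm ⧸ Mm.comap Rm.subtype)) hlt.lt_top k ?_ ?_
  · rw [Module.support_eq_zeroLocus, hann]
  · intro i hi
    exact ext_right Mm Rm hMR k i (ext_equiv k e i (hM i (by omega))) (hM (i + 1) (by omega))
end X
end SallyAux

namespace SallyAux
section Y
open RingTheory.Sequence Module
variable {A : Type*} [CommRing A]

lemma supportDim_quot_succ_le {N : Type*} [AddCommGroup N] [Module A N] {x : A}
    (hx : IsSMulRegular N x) : supportDim A (QuotSMulTop x N) + 1 ≤ supportDim A N := by
  nontriviality N
  nontriviality (QuotSMulTop x N)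
  have : Nonempty (Module.support A N) := nonempty_support_of_nontrivial.to_subtype
  have : Nonempty (Module.support A (QuotSMulTop x N)) := nonempty_support_of_nontrivial.to_subtype
  simp only [supportDim, Order.krullDim_eq_iSup_length]
  apply WithBot.coe_le_coe.mpr
  simp only [ENat.iSup_add, iSup_le_iff]
  intro p
  have hp := p.head.2
  have hxp : x ∈ p.head.1.asIdeal := by
    obtain ⟨m, hm⟩ := Module.mem_support_iff_exists_annihilator.mp hp
    apply hm
    rw [Submodule.mem_annihilator_span_singleton]
    obtain ⟨y, rfl⟩ := Submodule.mkQ_surjective _ m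
    rw [← map_smul, Submodule.mkQ_apply, Submodule.Quotient.mk_eq_zero]
    exact Submodule.smul_mem_pointwise_smul _ _ _ trivial
  have le : support A (QuotSMulTop x N) ⊆ support A N :=
    Module.support_subset_of_surjective _ (Submodule.mkQ_surjective _)
  let q : LTSeries (support A N) :=
    p.map (Set.MapsTo.restrict id (support A (QuotSMulTop x N)) (support A N) le) (fun _ _ h ↦ h)
  obtain ⟨z, hz⟩ := Module.mem_support_iff_exists_annihilator.mp (le hp)
  have := p.head.1.isPrime
  obtain ⟨r, hrm, hr⟩ := Ideal.exists_minimalPrimes_le hz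
  have hreg : IsSMulRegular (A ∙ z) x := by
    intro a b hab
    apply Subtype.ext
    apply hx
    exact congrArg Subtype.val hab
  have hxr : x ∉ r := hreg.notMem_of_mem_minimalPrimes hrm
  let r' : support A N := ⟨⟨r, hrm.1.1⟩, Module.mem_support_iff_exists_annihilator.mpr ⟨z, hrm.1.2⟩⟩
  have hr : r' < q.head := lt_of_le_of_ne hr (fun h ↦ hxr (by
    have : q.head.1.asIdeal = r := by rw [← h]
    rw [← this]; exact hxp))
  exact le_of_eq_of_le (by simp [q]; rfl) (le_iSup _ (q.cons r' hr))

lemma length_le_supportDim (rs : List A) : ∀ (N : Type _) [AddCommGroup N] [Module A N],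
    IsRegular N rs → (rs.length : WithBot ℕ∞) ≤ supportDim A N := by
  induction rs with
  | nil =>
    intro N _ _ h
    have := h.nontrivial
    have : supportDim A N ≠ ⊥ := supportDim_ne_bot_of_nontrivial A N
    simp only [List.length_nil, Nat.cast_zero]
    cases hh : supportDim A N with
    | bot => exact absurd hh this
    | coe a => exact WithBot.coe_le_coe.mpr (zero_le : 0 ≤ a)
  | cons r rs ih =>
    intro N _ _ h
    rw [isRegular_cons_iff] at h
    refine le_trans ?_ (supportDim_quot_succ_le h.1)
    simp only [List.length_cons, Nat.cast_add, Nat.cast_one]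
    gcongr
    exact ih _ h.2

lemma supportDim_le_quot {N : Type*} [AddCommGroup N] [Module A N] (𝔞 : Ideal A)
    (h : ∀ p ∈ support A N, 𝔞 ≤ p.asIdeal) : supportDim A N ≤ ringKrullDim (A ⧸ 𝔞) := by
  rw [ringKrullDim_quotient]
  refine Order.krullDim_le_of_strictMono
    (fun p => (⟨p.1, h p.1 p.2⟩ : PrimeSpectrum.zeroLocus (𝔞 : Set A))) ?_
  intro p q hpq
  exact hpq

section
variable {R : Type*} [CommRing R]

lemma rees_le_adjoin {d : ℕ} (x : Fin d → R) {J : Ideal R} (hJ : J = Ideal.span (Set.range x)) :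
    reesAlgebra J ≤ (MvPolynomial.aeval (fun i => (Polynomial.monomial 1 (x i) : R[X]))).range := by
  rw [← adjoin_monomial_eq_reesAlgebra]
  rw [Algebra.adjoin_le_iff]
  rintro _ ⟨a, ha, rfl⟩
  subst hJ
  refine Submodule.span_induction (p := fun a _ => Polynomial.monomial 1 a ∈
    (MvPolynomial.aeval (fun i => (Polynomial.monomial 1 (x i) : R[X]))).range) ?_ ?_ ?_ ?_ ha
  · rintro _ ⟨i, rfl⟩
    exact ⟨MvPolynomial.X i, by simp⟩
  · simp
  · intro a b _ _ h1 h2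
    rw [map_add]; exact add_mem h1 h2
  · intro r a _ h
    rw [← Polynomial.smul_monomial]
    exact Subalgebra.smul_mem _ h r

noncomputable def reesφ {d : ℕ} (x : Fin d → R) {J : Ideal R} (hJ : J = Ideal.span (Set.range x)) :
    MvPolynomial (Fin d) R →ₐ[R] reesAlgebra J :=
  MvPolynomial.aeval (fun i => ⟨Polynomial.monomial 1 (x i), reesAlgebra.monomial_mem.mpr (by
    rw [pow_one, hJ]; exact Ideal.subset_span ⟨i, rfl⟩)⟩)

lemma reesφ_surj {d : ℕ} (x : Fin d → R) {J : Ideal R} (hJ : J = Ideal.span (Set.range x)) :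
    Function.Surjective (reesφ x hJ) := by
  intro p
  obtain ⟨f, hf⟩ := rees_le_adjoin x hJ p.2
  refine ⟨f, Subtype.ext ?_⟩
  rw [← hf]
  have : (reesAlgebra J).val.comp (reesφ x hJ) =
      MvPolynomial.aeval (fun i => (Polynomial.monomial 1 (x i) : R[X])) := by
    ext i; simp [reesφ]
  exact DFunLike.congr_fun this f

lemma fiber_dim {d : ℕ} {Λ : Type*} [CommRing Λ] [Algebra R Λ] [IsLocalRing R]
    (φ : MvPolynomial (Fin d) R →ₐ[R] Λ) (hφ : Function.Surjective φ) :
    ringKrullDim (Λ ⧸ (maximalIdeal R).map (algebraMap R Λ)) ≤ d := by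
  let 𝔞 := (maximalIdeal R).map (algebraMap R Λ)
  let ψ : MvPolynomial (Fin d) R →+* Λ ⧸ 𝔞 := (Ideal.Quotient.mk 𝔞).comp φ.toRingHom
  have hψ : Function.Surjective ψ := Ideal.Quotient.mk_surjective.comp hφ
  have hk : ∀ a ∈ (maximalIdeal R).map (MvPolynomial.C : R →+* MvPolynomial (Fin d) R),
      ψ a = 0 := by
    intro a ha
    have : (maximalIdeal R).map (MvPolynomial.C : R →+* MvPolynomial (Fin d) R) ≤ RingHom.ker ψ := by
      rw [Ideal.map_le_iff_le_comap]
      intro r hr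
      rw [Ideal.mem_comap, RingHom.mem_ker]
      have : φ (MvPolynomial.C r) = algebraMap R Λ r := φ.commutes r
      change Ideal.Quotient.mk 𝔞 (φ (MvPolynomial.C r)) = 0
      rw [this, Ideal.Quotient.eq_zero_iff_mem]
      exact Ideal.mem_map_of_mem _ hr
    exact this ha
  have h1 := ringKrullDim_le_of_surjective _ (Ideal.Quotient.lift_surjective_of_surjective _ hk hψ)
  refine h1.trans ?_
  rw [← ringKrullDim_eq_of_ringEquiv
    (MvPolynomial.quotientEquivQuotientMvPolynomial (σ := Fin d) (maximalIdeal R)).toRingEquiv]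
  have : IsNoetherianRing (R ⧸ maximalIdeal R) := by
    let _ : Field (R ⧸ maximalIdeal R) := Ideal.Quotient.field _
    infer_instance
  rw [MvPolynomial.ringKrullDim_of_isNoetherianRing]
  have h0 : ringKrullDim (R ⧸ maximalIdeal R) ≤ 0 := by
    rw [ringKrullDim_eq_zero_of_isField (((Ideal.Quotient.maximal_ideal_iff_isField_quotient
      (maximalIdeal R))).mp inferInstance)]
  calc _ ≤ (0 : WithBot ℕ∞) + (Nat.card (Fin d) : WithBot ℕ∞) := by gcongr
    _ = d := by simp

lemma length_le_of_torsion {d : ℕ} {Λ : Type*} [CommRing Λ] [Algebra R Λ] [IsLocalRing R]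
    (φ : MvPolynomial (Fin d) R →ₐ[R] Λ) (hφ : Function.Surjective φ)
    {N : Type*} [AddCommGroup N] [Module Λ N]
    (htor : ∀ z : N, ∃ c : ℕ, ∀ a ∈ maximalIdeal R ^ c, algebraMap R Λ a • z = 0)
    (rs : List Λ) (h : IsRegular N rs) : rs.length ≤ d := by
  have h1 := length_le_supportDim rs N h
  have h2 := h1.trans (supportDim_le_quot ((maximalIdeal R).map (algebraMap R Λ)) ?_)
  · have h3 := h2.trans (fiber_dim φ hφ)
    exact_mod_cast h3
  · intro p hp
    obtain ⟨z, hz⟩ := Module.mem_support_iff_exists_annihilator.mp hp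
    obtain ⟨c, hc⟩ := htor z
    rw [Ideal.map_le_iff_le_comap]
    intro a ha
    rw [Ideal.mem_comap]
    apply p.isPrime.mem_of_pow_mem c
    rw [← map_pow]
    apply hz
    rw [Submodule.mem_annihilator_span_singleton]
    exact hc _ (Ideal.pow_mem_pow ha c)
end
end Y
end SallyAux

namespace SallyAux
section Z1
open RingTheory.Sequence Module
open scoped LaurentPolynomial Pointwise
variable {R : Type*} [CommRing R]

/-- facts on the filtration used below -/
structure Filt (J : Ideal R) (F : ℤ → Ideal R) : Prop where
  mul : ∀ i j, ∀ a ∈ F i, ∀ b ∈ F j, a * b ∈ F (i + j)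
  top : ∀ n ≤ 0, F n = ⊤
  pow : ∀ n : ℕ, J ^ n ≤ F n
  anti : ∀ n, F (n + 1) ≤ F n

lemma self_le_intCl (I : Ideal R) : I ≤ intCl I := by
  intro a ha
  apply Ideal.subset_span
  refine ⟨1, one_pos, fun _ => -a, ?_, ?_⟩
  · intro i hi
    obtain rfl : i = 1 := by simpa using hi
    simpa using ha
  · simp

lemma filt_nF {I J : Ideal R} [IsNoetherianRing (exR J)] [Nontrivial R] (hJI : J ≤ I) {N : ℕ}
    (hN : ∀ i, I ^ (N + i) ≤ J ^ i) : Filt J (nF I) where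
  mul := by
    intro i j a ha b hb
    have h1 := ((isIntegral_iff_GS hJI hN).mpr (single_mem_GS ha)).mul
      ((isIntegral_iff_GS hJI hN).mpr (single_mem_GS hb))
    rw [AddMonoidAlgebra.single_mul_single, isIntegral_iff_GS hJI hN] at h1
    have h2 := h1 (i + j)
    rwa [AddMonoidAlgebra.coeff_single, Finsupp.single_eq_same] at h2
  top := by
    intro n hn
    rw [nF, Int.toNat_of_nonpos hn, pow_zero, Ideal.one_eq_top, eq_top_iff]
    exact self_le_intCl _
  pow := by
    intro n
    rw [nF, Int.toNat_natCast]
    exact (Ideal.pow_right_mono hJI n).trans (self_le_intCl _)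
  anti := by
    intro n a ha
    apply Submodule.span_mono ?_ ha
    rintro y ⟨r, hr, c, hc, h⟩
    refine ⟨r, hr, c, fun i hi => ?_, h⟩
    exact Ideal.pow_right_mono (Ideal.pow_le_pow_right (by omega)) i (hc i hi)

lemma intCl_le_max [IsLocalRing R] {I : Ideal R} (hI : I ≤ maximalIdeal R) :
    intCl I ≤ maximalIdeal R := by
  apply Ideal.span_le.mpr
  rintro y ⟨r, hr, c, hc, h⟩
  apply (inferInstance : (maximalIdeal R).IsPrime).mem_of_pow_mem r
  rw [eq_neg_of_add_eq_zero_left h]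
  apply neg_mem
  apply sum_mem
  intro i hi
  apply Ideal.mul_mem_right
  apply hI
  exact Ideal.pow_le_self (by have := Finset.mem_Icc.mp hi; omega) (hc i hi)

variable {J : Ideal R}

lemma toLaurent_monomial (n : ℕ) (a : R) : (toLaurent (monomial n a) : R[T;T⁻¹]) =
      AddMonoidAlgebra.single (n : ℤ) a := by
  rw [← Polynomial.C_mul_X_pow_eq_monomial, Polynomial.toLaurent_C_mul_X_pow,
        LaurentPolynomial.single_eq_C_mul_T]

lemma toLaurent_mem (p : reesAlgebra J) :
    toLaurent (p : R[X]) ∈ GS (fun n => if 0 ≤ n then J ^ n.toNat else ⊥) := by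
  have h : ∀ n : ℕ, (toLaurent (monomial n ((p : R[X]).coeff n)) : R[T;T⁻¹]) ∈
      GS (fun n => if 0 ≤ n then J ^ n.toNat else ⊥) := by
    intro n
    rw [toLaurent_monomial]
    apply single_mem_GS
    simpa using p.2 n
  rw [← Polynomial.sum_monomial_eq (p : R[X]), Polynomial.sum, map_sum]
  exact sum_mem fun n _ => h n

lemma rees_smul_def (p : reesAlgebra J) (w : R[T;T⁻¹]) : p • w = toLaurent (p : R[X]) * w := by
  rw [Subalgebra.smul_def, Algebra.smul_def]; rfl

/-- graded submodules over the Rees algebra -/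
def GSM (J : Ideal R) (G : ℤ → Ideal R) (hG : ∀ (n : ℕ) m, ∀ a ∈ J ^ n, ∀ b ∈ G m, a * b ∈ G (n + m)) :
    Submodule (reesAlgebra J) R[T;T⁻¹] where
  carrier := GS G
  add_mem' := fun h h' => add_mem h h'
  zero_mem' := zero_mem _
  smul_mem' := by
    intro p w hw
    rw [rees_smul_def]
    refine GS_mul ?_ (toLaurent_mem p) hw
    intro i j a ha b hb
    split_ifs at ha with hi
    · have := hG i.toNat j a ha b hb
      rwa [Int.toNat_of_nonneg hi] at this
    · rw [Ideal.mem_bot.mp ha]; simp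

lemma mem_GSM {G : ℤ → Ideal R} {hG} {w : R[T;T⁻¹]} : w ∈ GSM J G hG ↔ w ∈ GS G := Iff.rfl

/-- the family for `L'` -/
def LF (J C : Ideal R) (n : ℤ) : Ideal R := if 0 ≤ n then J ^ n.toNat * C else ⊤

lemma LF_mul {J C : Ideal R} (hC : J ≤ C) (n : ℕ) (m : ℤ) :
    ∀ a ∈ J ^ n, ∀ b ∈ LF J C m, a * b ∈ LF J C (n + m) := by
  intro a ha b hb
  unfold LF at hb ⊢
  split_ifs at hb ⊢ with h1 h2
  · have : (n + m).toNat = n + m.toNat := by omega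
    rw [this, pow_add, mul_assoc]
    exact Ideal.mul_mem_mul ha hb
  · apply Ideal.mul_mem_right
    have : J ^ n ≤ J ^ ((n + m).toNat + 1) := Ideal.pow_le_pow_right (by omega)
    rw [pow_succ] at this
    exact Ideal.mul_mono_right hC (this ha)
  · trivial
  · trivial

lemma weaklyRegular_ofFn {A M : Type*} [CommRing A] [AddCommGroup M] [Module A M] {d : ℕ} (y : Fin d → A)
    (h : ∀ (i : Fin d) (z : M), y i • z ∈ Ideal.ofList ((List.ofFn y).take i) • (⊤ : Submodule A M) →
      z ∈ Ideal.ofList ((List.ofFn y).take i) • (⊤ : Submodule A M)) :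
    IsWeaklyRegular M (List.ofFn y) := by
  constructor
  intro k hk
  rw [List.length_ofFn] at hk
  have h3 : (List.ofFn y)[k]'(by simpa using hk) = y ⟨k, hk⟩ := by simp
  rw [h3]
  rw [isSMulRegular_iff_right_eq_zero_of_smul]
  intro q hq
  obtain ⟨z, rfl⟩ := Submodule.Quotient.mk_surjective _ q
  rw [← Submodule.Quotient.mk_smul, Submodule.Quotient.mk_eq_zero] at hq
  rw [Submodule.Quotient.mk_eq_zero]
  exact h ⟨k, hk⟩ z hq

variable {d : ℕ} (x : Fin d → R) (hJ : J = Ideal.span (Set.range x))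

/-- `x_i t` -/
noncomputable def reesT (i : Fin d) : reesAlgebra J :=
  ⟨Polynomial.monomial 1 (x i), reesAlgebra.monomial_mem.mpr (by
    rw [pow_one, hJ]; exact Ideal.subset_span ⟨i, rfl⟩)⟩

lemma reesT_smul (i : Fin d) (w : R[T;T⁻¹]) : reesT x hJ i • w = AddMonoidAlgebra.single 1 (x i) * w := by
  rw [rees_smul_def, reesT]
  rw [toLaurent_monomial]
  rfl

lemma ofList_smul_mem (G : ℤ → Ideal R) (hG) (i : Fin d) (w : GSM J G hG) :
    w ∈ Ideal.ofList ((List.ofFn (reesT x hJ)).take i) • (⊤ : Submodule (reesAlgebra J) (GSM J G hG)) ↔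
     (w : R[T;T⁻¹]) ∈ GS (fun n => Ideal.span (x '' {j | j < i}) * G (n - 1)) := by
  have hset : Ideal.ofList ((List.ofFn (reesT x hJ)).take i) =
      Ideal.span (reesT x hJ '' {j | j < i}) := by
    rw [Ideal.ofList]
    congr 1
    ext a
    simp only [Set.mem_ofPred_eq, Set.mem_image, List.mem_take_iff_getElem, List.getElem_ofFn,
      List.length_ofFn]
    constructor
    · rintro ⟨j, hj, rfl⟩
      exact ⟨⟨j, by omega⟩, by simp [Fin.lt_def]; omega, rfl⟩
    · rintro ⟨j, hj, rfl⟩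
      exact ⟨j, by have := Fin.lt_def.mp hj; omega, rfl⟩
  rw [hset]
  constructor
  · intro hw
    have hQ : ∀ (n : ℕ) m, ∀ a ∈ J ^ n, ∀ b ∈ (fun n : ℤ => Ideal.span (x '' {j | j < i}) * G (n - 1)) m,
        a * b ∈ (fun n : ℤ => Ideal.span (x '' {j | j < i}) * G (n - 1)) (n + m) := by
      intro n m a ha b hb
      dsimp only at hb ⊢
      refine Submodule.mul_induction_on hb ?_ ?_
      · intro r hr s hs
        rw [mul_left_comm]
        refine Ideal.mul_mem_mul hr ?_
        have := hG n (m - 1) a ha s hs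
        rwa [← add_sub_assoc] at this
      · intro b b' h h'
        rw [mul_add]; exact add_mem h h'
    suffices h : Ideal.span (reesT x hJ '' {j | j < i}) • (⊤ : Submodule (reesAlgebra J) (GSM J G hG)) ≤
        (GSM J _ hQ).comap (GSM J G hG).subtype from h hw
    rw [Submodule.smul_le]
    intro r hr w _
    refine Submodule.span_induction (p := fun r _ => r • w ∈
      (GSM J _ hQ).comap (GSM J G hG).subtype) ?_ ?_ ?_ ?_ hr
    · rintro _ ⟨j, hj, rfl⟩
      rw [Submodule.mem_comap, map_smul, Submodule.subtype_apply, reesT_smul, mem_GSM]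
      intro n
      rw [AddMonoidAlgebra.coeff_single_mul_apply]
      refine Ideal.mul_mem_mul (Ideal.subset_span ⟨j, hj, rfl⟩) ?_
      have := w.2 (n - 1)
      rwa [← neg_add_eq_sub] at this ⊢
    · rw [zero_smul]; exact zero_mem _
    · intro r s _ _ h h'
      rw [add_smul]; exact add_mem h h'
    · intro c r _ h
      rw [smul_assoc]; exact Submodule.smul_mem _ _ h
  · intro hw
    have key := GS_le_of ((Ideal.span (reesT x hJ '' {j | j < i}) •
      (⊤ : Submodule (reesAlgebra J) (GSM J G hG))).map (GSM J G hG).subtype).toAddSubmonoid ?_ hw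
    · obtain ⟨w', hw', h⟩ := key
      rwa [Subtype.ext h] at hw'
    · intro n a ha
      refine Submodule.mul_induction_on ha ?_ ?_
      · intro r hr
        refine Submodule.span_induction (p := fun r _ => ∀ s ∈ G (n - 1),
          (AddMonoidAlgebra.single n (r * s) : R[T;T⁻¹]) ∈ ((Ideal.span (reesT x hJ '' {j | j < i}) •
      (⊤ : Submodule (reesAlgebra J) (GSM J G hG))).map (GSM J G hG).subtype).toAddSubmonoid) ?_ ?_ ?_ ?_ hr
        · rintro _ ⟨j, hj, rfl⟩ s hs
          refine ⟨reesT x hJ j • ⟨AddMonoidAlgebra.single (n - 1) s, single_mem_GS hs⟩, ?_, ?_⟩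
          · exact Submodule.smul_mem_smul (Ideal.subset_span ⟨j, hj, rfl⟩) trivial
          · rw [map_smul, Submodule.subtype_apply, reesT_smul, AddMonoidAlgebra.single_mul_single,
              add_sub_cancel]
        · intro s _
          rw [zero_mul, AddMonoidAlgebra.single_zero]; exact zero_mem _
        · intro a b _ _ h h' s hs
          rw [add_mul, AddMonoidAlgebra.single_add]; exact add_mem (h s hs) (h' s hs)
        · intro c r _ h s hs
          rw [smul_eq_mul, mul_comm c, mul_assoc]
          exact h _ (Ideal.mul_mem_left _ _ hs)
      · intro a b h h'
        rw [AddMonoidAlgebra.single_add]; exact add_mem h h'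

end Z1
end SallyAux

namespace SallyAux
section Z2
open RingTheory.Sequence Module
open scoped LaurentPolynomial Pointwise
variable {R : Type*} [CommRing R] {J : Ideal R} {d : ℕ} (x : Fin d → R) (hJ : J = Ideal.span (Set.range x))

include hJ in
lemma LF_step [IsNoetherianRing R] [IsLocalRing R] (hx : WReg x) (hJt : J ≠ ⊤) {C : Ideal R}
    (hC : J ≤ C) (k : Fin d) (n : ℤ) (z : R) (h1 : x k * z ∈ Ideal.span (x '' {j | j < k}) * LF J C n)
    (hz : z ∈ LF J C n) : z ∈ Ideal.span (x '' {j | j < k}) * LF J C (n - 1) := by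
  have h2 := hx k _ (Ideal.mul_le_left h1)
  by_cases hn : 1 ≤ n
  · obtain ⟨r, rfl⟩ : ∃ r : ℕ, n = r + 1 := ⟨(n - 1).toNat, by omega⟩
    have e1 : LF J C ((r : ℤ) + 1) = J ^ (r + 1) * C := by
      have : ((r : ℤ) + 1).toNat = r + 1 := by omega
      rw [LF, if_pos (by omega), this]
    have e2 : LF J C ((r : ℤ) + 1 - 1) = J ^ r * C := by
      rw [LF, if_pos (by omega)]; simp
    rw [e1] at hz
    rw [e2]
    exact hx.inter k k.2.le hJ hJt hC r h2 hz
  · rw [LF, if_neg (by omega), Ideal.mul_top]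
    exact h2

lemma L_weaklyRegular [IsNoetherianRing R] [IsLocalRing R] (hx : WReg x) (hJt : J ≠ ⊤) {C : Ideal R}
    (hC : J ≤ C) : IsWeaklyRegular (GSM J (LF J C) (LF_mul hC)) (List.ofFn (reesT x hJ)) := by
  apply weaklyRegular_ofFn
  intro k z hq
  have hmem := ofList_smul_mem x hJ (LF J C) (LF_mul hC) k
  rw [hmem] at hq ⊢
  rw [Submodule.coe_smul, reesT_smul] at hq
  intro n
  have h1 := hq (n + 1)
  rw [AddMonoidAlgebra.coeff_single_mul_apply] at h1
  have e1 : -1 + (n + 1) = n := by ring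
  have e2 : n + 1 - 1 = n := by ring
  rw [e1] at h1
  dsimp only at h1
  rw [e2] at h1
  exact LF_step x hJ hx hJt hC k n _ h1 (z.2 n)
end Z2
end SallyAux

namespace SallyAux
section Z3
open RingTheory.Sequence Module
open scoped LaurentPolynomial Pointwise

lemma finite_quot {A W : Type*} [CommRing A] [AddCommGroup W] [Module A W] (Rm Mm : Submodule A W)
    (F : Set W) (hFf : F.Finite) (hF : F ⊆ Rm) (h : Rm ≤ Submodule.span A F ⊔ Mm) :
    Module.Finite A (Rm ⧸ Mm.comap Rm.subtype) := by
  have : Finite F := hFf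
  let g : F → Rm ⧸ Mm.comap Rm.subtype := fun f => Submodule.Quotient.mk ⟨f.1, hF f.2⟩
  rw [Module.finite_def, Submodule.fg_def]
  refine ⟨Set.range g, Set.finite_range g, ?_⟩
  rw [eq_top_iff]
  intro q _
  obtain ⟨⟨w, hw⟩, rfl⟩ := Submodule.Quotient.mk_surjective _ q
  obtain ⟨s, hs, m, hm, hsm⟩ := Submodule.mem_sup.mp (h hw)
  have key : ∃ hs' : s ∈ Rm, (Submodule.Quotient.mk ⟨s, hs'⟩ : Rm ⧸ Mm.comap Rm.subtype) ∈
      Submodule.span A (Set.range g) := by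
    refine Submodule.span_induction (p := fun s _ => ∃ hs' : s ∈ Rm,
      (Submodule.Quotient.mk ⟨s, hs'⟩ : Rm ⧸ Mm.comap Rm.subtype) ∈
      Submodule.span A (Set.range g)) ?_ ?_ ?_ ?_ hs
    · intro f hf
      exact ⟨hF hf, Submodule.subset_span ⟨⟨f, hf⟩, rfl⟩⟩
    · exact ⟨zero_mem _, zero_mem (Submodule.span A (Set.range g))⟩
    · rintro a b _ _ ⟨ha, ha'⟩ ⟨hb, hb'⟩
      exact ⟨add_mem ha hb, add_mem ha' hb'⟩
    · rintro c b _ ⟨hb, hb'⟩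
      exact ⟨Submodule.smul_mem _ c hb, Submodule.smul_mem _ c hb'⟩
  obtain ⟨hs', hk⟩ := key
  have : (Submodule.Quotient.mk ⟨w, hw⟩ : Rm ⧸ Mm.comap Rm.subtype) = Submodule.Quotient.mk ⟨s, hs'⟩ := by
    rw [Submodule.Quotient.eq]
    rw [Submodule.mem_comap]
    change w - s ∈ Mm
    rw [← hsm, add_sub_cancel_left]
    exact hm
  rw [this]; exact hk

lemma span_transfer {E W : Type*} [CommRing E] [CommRing W] [Algebra E W] (B : Subalgebra E W)
    (F : Finset B) (u : E)
    (h : ∀ b : B, b ∈ Submodule.span E (F : Set B) ⊔ LinearMap.range (LinearMap.lsmul E B u))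
    (N : Submodule E W) (hF : ∀ f ∈ F, (f : W) ∈ N)
    (hu : ∀ b ∈ B, u • b ∈ N) (b : W) (hb : b ∈ B) : b ∈ N := by
  have : Submodule.span E (F : Set B) ⊔ LinearMap.range (LinearMap.lsmul E B u) ≤
      N.comap B.val.toLinearMap := by
    apply sup_le
    · rw [Submodule.span_le]
      intro f hf
      exact hF f hf
    · rintro _ ⟨b, rfl⟩
      exact hu b b.2
  exact this (h ⟨b, hb⟩)

variable {R : Type*} [CommRing R] {J : Ideal R} {F : ℤ → Ideal R}

lemma Filt.one (hF : Filt J F) : J ≤ F 1 := by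
  have := hF.pow 1
  simpa using this

lemma Filt.cR (hF : Filt J F) (n : ℕ) (m : ℤ) : ∀ a ∈ J ^ n, ∀ b ∈ F m, a * b ∈ F (n + m) :=
  fun a ha b hb => hF.mul _ _ a (hF.pow n ha) b hb

lemma Filt.cM (hF : Filt J F) (n : ℕ) (m : ℤ) :
    ∀ a ∈ J ^ n, ∀ b ∈ (fun n => F (n + 1)) m, a * b ∈ (fun n => F (n + 1)) (n + m) := by
  intro a ha b hb
  have := hF.mul _ _ a (hF.pow n ha) b hb
  rwa [← add_assoc] at this

lemma Filt.L_le (hF : Filt J F) : GSM J (LF J (F 1)) (LF_mul hF.one) ≤ GSM J _ hF.cM := by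
  intro w hw n
  have := hw n
  unfold LF at this
  split_ifs at this with h
  · have h1 : J ^ n.toNat * F 1 ≤ F (n + 1) := by
      rw [Ideal.mul_le]
      intro a ha b hb
      have := hF.cR n.toNat 1 a ha b hb
      rwa [Int.toNat_of_nonneg h] at this
    exact h1 this
  · dsimp only
    rw [hF.top _ (by omega)]; trivial

lemma Filt.M_le (hF : Filt J F) : GSM J _ hF.cM ≤ GSM J F hF.cR :=
  fun _ hw n => hF.anti n (hw n)

lemma coeff_t_mul (p : R[T;T⁻¹]) (n : ℤ) :
    ((AddMonoidAlgebra.single 1 1 : R[T;T⁻¹]) * p).coeff n = p.coeff (n - 1) := by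
  rw [AddMonoidAlgebra.coeff_single_mul_apply, one_mul]
  congr 1
  ring

noncomputable def Filt.e (hF : Filt J F) : GSM J _ hF.cM ≃ₗ[reesAlgebra J] GSM J F hF.cR where
  toFun w := ⟨AddMonoidAlgebra.single 1 1 * (w : R[T;T⁻¹]), fun n => by
    rw [coeff_t_mul]
    have := w.2 (n - 1)
    dsimp only at this
    rwa [sub_add_cancel] at this⟩
  invFun w := ⟨AddMonoidAlgebra.single (-1) 1 * (w : R[T;T⁻¹]), fun n => by
    rw [coeff_u_mul]
    exact w.2 (n + 1)⟩
  map_add' := fun a b => Subtype.ext (mul_add _ _ _)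
  map_smul' := fun p a => Subtype.ext (by
    change _ * (p • (a : R[T;T⁻¹])) = p • (_ * (a : R[T;T⁻¹]))
    rw [rees_smul_def, rees_smul_def, mul_left_comm])
  left_inv := fun w => Subtype.ext (by
    change (AddMonoidAlgebra.single (-1) 1 : R[T;T⁻¹]) * ((AddMonoidAlgebra.single 1 1 : R[T;T⁻¹]) * (w : R[T;T⁻¹])) = (w : R[T;T⁻¹])
    rw [← mul_assoc, AddMonoidAlgebra.single_mul_single, neg_add_cancel, one_mul]
    exact one_mul _)
  right_inv := fun w => Subtype.ext (by
    change (AddMonoidAlgebra.single 1 1 : R[T;T⁻¹]) * ((AddMonoidAlgebra.single (-1) 1 : R[T;T⁻¹]) * (w : R[T;T⁻¹])) = (w : R[T;T⁻¹])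
    rw [← mul_assoc, AddMonoidAlgebra.single_mul_single, add_neg_cancel, one_mul]
    exact one_mul _)

variable {d : ℕ} (x : Fin d → R) (hJ : J = Ideal.span (Set.range x))

lemma reesφ_eq_exφ (f : MvPolynomial (Fin d) R) :
    (toLaurent (reesφ x hJ f : R[X]) : R[T;T⁻¹]) = exφ x hJ f := by
  have : (Polynomial.toLaurentAlg (R := R)).comp ((reesAlgebra J).val.comp (reesφ x hJ)) =
      (exR J).val.comp (exφ x hJ) := by
    ext i : 1
    simp only [AlgHom.comp_apply, reesφ, exφ, MvPolynomial.aeval_X]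
    exact toLaurent_monomial 1 (x i)
  exact DFunLike.congr_fun this f

/-- a Rees submodule, viewed over the extended Rees ring -/
def exSub (hJ : J = Ideal.span (Set.range x)) (hF : Filt J F) (N : Submodule (reesAlgebra J) R[T;T⁻¹])
    (hN : N ≤ GSM J F hF.cR) (hM : GSM J _ hF.cM ≤ N) : Submodule (exR J) R[T;T⁻¹] where
  carrier := N
  add_mem' := fun h h' => add_mem h h'
  zero_mem' := zero_mem _
  smul_mem' := by
    intro c w hw
    obtain ⟨f, q, rfl⟩ := exists_φ_add x hJ c
    rw [add_smul]
    refine add_mem ?_ (hM ?_)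
    · have h1 : exφ x hJ f • w = reesφ x hJ f • w := by
        rw [rees_smul_def, reesφ_eq_exφ]; rfl
      rw [h1]
      exact N.smul_mem _ hw
    · have h2 : (exu J * q) • w = AddMonoidAlgebra.single (-1) 1 * ((q : R[T;T⁻¹]) * w) := by
        rw [← mul_assoc]; rfl
      rw [h2]
      intro n
      rw [coeff_u_mul]
      refine GS_mul (F := fun n => J ^ n.toNat) (G := F) (H := F) ?_ q.2 (hN hw) (n + 1)
      intro i j a ha b hb
      refine hF.mul i j a ?_ b hb
      by_cases hi : 0 ≤ i
      · have := hF.pow i.toNat ha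
        rwa [Int.toNat_of_nonneg hi] at this
      · rw [hF.top i (by omega)]; trivial

include hJ in
lemma finite_R [IsNoetherianRing R] [IsLocalRing R] (hx : WReg x) (hrad : J.radical = maximalIdeal R)
    (hF : Filt J F) (hInt : ∀ w : R[T;T⁻¹], IsIntegral (exR J) w ↔ w ∈ GS F) :
    Module.Finite (reesAlgebra J) (submoduleQuot (GSM J F hF.cR) (GSM J _ hF.cM)) := by
  obtain ⟨S, hS⟩ := exR_finite x hJ hx hrad
  let S' : Set R[T;T⁻¹] := Subtype.val '' (S : Set (integralClosure (exR J) R[T;T⁻¹]))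
  have hS'R : S' ⊆ GSM J F hF.cR := by
    rintro _ ⟨f, hf, rfl⟩
    exact (hInt _).mp f.2
  refine finite_quot _ _ S' (S.finite_toSet.image _) hS'R ?_
  intro w hw
  have hN : Submodule.span (reesAlgebra J) S' ⊔ GSM J _ hF.cM ≤ GSM J F hF.cR :=
    sup_le (Submodule.span_le.mpr hS'R) hF.M_le
  refine span_transfer _ S _ hS (exSub x hJ hF _ hN le_sup_right) ?_ ?_ w ((hInt w).mpr hw)
  · intro f hf
    exact Submodule.mem_sup_left (Submodule.subset_span ⟨f, hf, rfl⟩)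
  · intro b hb
    refine Submodule.mem_sup_right ?_
    intro n
    have : exu J • b = AddMonoidAlgebra.single (-1) 1 * b := rfl
    rw [this, coeff_u_mul]
    exact (hInt b).mp hb (n + 1)

end Z3
end SallyAux

namespace SallyAux
section Z4
open RingTheory.Sequence Module
open scoped LaurentPolynomial Pointwise

lemma smul_ne_top {A W : Type*} [CommRing A] [AddCommGroup W] [Module A W] (Rm Mm Q : Submodule A W)
    (P : Ideal A) (hMQ : Mm ≤ Q) (hP : ∀ p ∈ P, ∀ w ∈ Rm, p • w ∈ Q) (w₀ : W) (hw₀ : w₀ ∈ Rm)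
    (hw₀' : w₀ ∉ Q) : P • (⊤ : Submodule A (submoduleQuot Rm Mm)) ≠ ⊤ := by
  intro h
  have hle : Mm.comap Rm.subtype ≤ Q.comap Rm.subtype := Submodule.comap_mono hMQ
  have h1 : P • (⊤ : Submodule A (submoduleQuot Rm Mm)) ≤
      (Q.comap Rm.subtype).map (Mm.comap Rm.subtype).mkQ := by
    rw [Submodule.smul_le]
    intro p hp q _
    obtain ⟨w, rfl⟩ := Submodule.mkQ_surjective _ q
    refine ⟨p • w, ?_, map_smul _ _ _⟩
    exact hP p hp w w.2
  rw [h] at h1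
  obtain ⟨w, hw, hw'⟩ := h1 (Submodule.mem_top (x := Submodule.mkQ _ ⟨w₀, hw₀⟩))
  rw [Submodule.mkQ_apply, Submodule.mkQ_apply, Submodule.Quotient.eq] at hw'
  have h3 := (Q.comap Rm.subtype).sub_mem hw (hle hw')
  rw [sub_sub_cancel] at h3
  exact hw₀' h3

lemma quot_equiv {A V W : Type*} [CommRing A] [AddCommGroup V] [Module A V] [AddCommGroup W] [Module A W]
    (N₁ N₂ : Submodule A V) (M L : Submodule A W) (θ : V →ₗ[A] W) (h1 : ∀ v ∈ N₁, θ v ∈ M)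
    (h2 : ∀ v ∈ N₁, θ v ∈ L ↔ v ∈ N₂) (h3 : ∀ w ∈ M, ∃ v ∈ N₁, w - θ v ∈ L) :
    Nonempty (submoduleQuot N₁ N₂ ≃ₗ[A] submoduleQuot M L) := by
  let g : N₁ →ₗ[A] submoduleQuot M L := (L.comap M.subtype).mkQ ∘ₗ (θ.restrict h1)
  have hg : Function.Surjective g := by
    intro q
    obtain ⟨⟨w, hw⟩, rfl⟩ := Submodule.mkQ_surjective _ q
    obtain ⟨v, hv, hvw⟩ := h3 w hw
    refine ⟨⟨v, hv⟩, ?_⟩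
    symm
    change Submodule.Quotient.mk _ = Submodule.Quotient.mk _
    rw [Submodule.Quotient.eq]
    exact hvw
  have hk : N₂.comap N₁.subtype = LinearMap.ker g := by
    ext ⟨v, hv⟩
    rw [LinearMap.mem_ker, Submodule.mem_comap]
    change v ∈ N₂ ↔ Submodule.Quotient.mk _ = _
    rw [Submodule.Quotient.mk_eq_zero]
    exact (h2 v hv).symm
  exact ⟨(Submodule.quotEquivOfEq _ _ hk).trans (g.quotKerEquivOfSurjective hg)⟩

lemma add_equiv {A Q : Type*} [CommRing A] [AddCommGroup Q] (K : Ideal A) (θ : A →+ Q)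
    (hs : Function.Surjective θ) (hk : ∀ a, θ a = 0 ↔ a ∈ K) :
    ∃ e : (A ⧸ K) ≃+ Q, ∀ a, e (Ideal.Quotient.mk K a) = θ a := by
  let g : (A ⧸ K) →+ Q := QuotientAddGroup.lift K.toAddSubgroup θ (fun a ha => (hk a).mpr ha)
  have hg : ∀ a, g (Ideal.Quotient.mk K a) = θ a := fun a => rfl
  refine ⟨AddEquiv.ofBijective g ⟨?_, ?_⟩, hg⟩
  · rw [injective_iff_map_eq_zero]
    intro q hq
    obtain ⟨a, rfl⟩ := Ideal.Quotient.mk_surjective q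
    rw [hg, hk] at hq
    exact Ideal.Quotient.eq_zero_iff_mem.mpr hq
  · intro q
    obtain ⟨a, rfl⟩ := hs q
    exact ⟨_, hg a⟩

lemma regular_transfer {Λ A Q : Type*} [CommRing Λ] [CommRing A] [AddCommGroup Q] [Module Λ Q]
    (K : Ideal A) (θ : A →+ Q) (hs : Function.Surjective θ) (hk : ∀ a, θ a = 0 ↔ a ∈ K)
    (i : Λ → A) (hi : ∀ l a, θ (i l * a) = l • θ a) (rs : List Λ) (h : IsRegular Q rs) :
    IsRegular (A ⧸ K) (rs.map (fun l => Ideal.Quotient.mk K (i l))) := by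
  obtain ⟨e, he⟩ := add_equiv K θ hs hk
  refine (AddEquiv.isRegular_congr (e := e) ?_).mpr h
  rw [List.forall₂_map_left_iff, List.forall₂_same]
  intro l _ q
  obtain ⟨a, rfl⟩ := Ideal.Quotient.mk_surjective q
  rw [smul_eq_mul, ← map_mul, he, he, hi]

variable {R : Type*} [CommRing R] {J : Ideal R} {F : ℤ → Ideal R}

lemma toLaurent_coeff (p : R[X]) (n : ℕ) : (toLaurent p : R[T;T⁻¹]).coeff (n : ℤ) = p.coeff n := by
  induction p using Polynomial.induction_on' with
  | add p q hp hq =>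
    rw [map_add, AddMonoidAlgebra.coeff_add, Finsupp.add_apply, hp, hq, Polynomial.coeff_add]
  | monomial k a =>
    rw [toLaurent_monomial, AddMonoidAlgebra.coeff_single, Finsupp.single_apply, Polynomial.coeff_monomial]
    simp

lemma toLaurent_coeff_neg (p : R[X]) (n : ℤ) (hn : n < 0) : (toLaurent p : R[T;T⁻¹]).coeff n = 0 := by
  induction p using Polynomial.induction_on' with
  | add p q hp hq =>
    rw [map_add, AddMonoidAlgebra.coeff_add, Finsupp.add_apply, hp, hq, add_zero]
  | monomial k a =>
    rw [toLaurent_monomial, AddMonoidAlgebra.coeff_single, Finsupp.single_apply, if_neg (by omega)]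

lemma toLaurent_mem_GS (p : R[X]) (G : ℤ → Ideal R) :
    (toLaurent p : R[T;T⁻¹]) ∈ GS G ↔ ∀ n : ℕ, p.coeff n ∈ G n := by
  constructor
  · intro h n
    rw [← toLaurent_coeff]; exact h n
  · intro h n
    by_cases hn : n < 0
    · rw [toLaurent_coeff_neg _ _ hn]; exact zero_mem _
    · obtain ⟨k, rfl⟩ : ∃ k : ℕ, n = k := ⟨n.toNat, by omega⟩
      rw [toLaurent_coeff]; exact h k

/-- nonnegative part of a Laurent polynomial from degree `k` on -/
lemma exists_trunc (w : R[T;T⁻¹]) (k : ℕ) : ∃ p : R[X], (∀ n : ℕ, n < k → p.coeff n = 0) ∧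
    ∀ n : ℕ, k ≤ n → p.coeff n = w.coeff n := by
  refine ⟨∑ n ∈ Finset.range (w.coeff.support.sup Int.toNat + 1),
    if k ≤ n then Polynomial.monomial n (w.coeff n) else 0, ?_, ?_⟩
  · intro n hn
    rw [Polynomial.finsetSum_coeff]
    apply Finset.sum_eq_zero
    intro i _
    split_ifs with h
    · rw [Polynomial.coeff_monomial, if_neg (by omega)]
    · rfl
  · intro n hn
    rw [Polynomial.finsetSum_coeff]
    rw [Finset.sum_eq_single n]
    · rw [if_pos hn, Polynomial.coeff_monomial, if_pos rfl]
    · intro b _ hb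
      split_ifs with h
      · rw [Polynomial.coeff_monomial, if_neg hb]
      · rfl
    · intro h
      rw [if_pos hn, Polynomial.coeff_monomial, if_pos rfl]
      by_contra h'
      apply h
      rw [Finset.mem_range]
      have := Finset.le_sup (f := Int.toNat) (Finsupp.mem_support_iff.mpr h')
      simp only [Int.toNat_natCast] at this
      omega

/-- `toLaurent` as a map of modules over the Rees algebra -/
noncomputable def θL (J : Ideal R) : R[X] →ₗ[reesAlgebra J] R[T;T⁻¹] where
  toFun p := toLaurent p
  map_add' := map_add _
  map_smul' := by
    intro p w
    rw [RingHom.id_apply, rees_smul_def, Subalgebra.smul_def, smul_eq_mul, map_mul]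

end Z4
end SallyAux

namespace SallyAux
section Z5
open RingTheory.Sequence Module
open scoped LaurentPolynomial Pointwise
universe u
variable {R : Type u} [CommRing R] {J : Ideal R} {F : ℤ → Ideal R}

lemma R_ne_top [IsLocalRing R] (hF : Filt J F) (hF1 : F 1 ≤ maximalIdeal R) (MJ : Ideal (reesAlgebra J))
    (hMJ : ∀ p : reesAlgebra J, p ∈ MJ ↔ (p : Polynomial R).coeff 0 ∈ maximalIdeal R) :
    MJ • (⊤ : Submodule (reesAlgebra J) (submoduleQuot (GSM J F hF.cR) (GSM J _ hF.cM))) ≠ ⊤ := by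
  have hJm : ∀ n : ℕ, 0 < n → J ^ n ≤ maximalIdeal R := fun n hn =>
    (Ideal.pow_le_self hn.ne').trans (hF.one.trans hF1)
  have hG : ∀ (n : ℕ) m, ∀ a ∈ J ^ n, ∀ b ∈ (fun n => if n = 0 then maximalIdeal R else F n) m,
      a * b ∈ (fun n => if n = 0 then maximalIdeal R else F n) (n + m) := by
    intro n m a ha b hb
    dsimp only at hb ⊢
    split_ifs with h
    · by_cases hm : m = 0
      · rw [if_pos hm] at hb
        exact Ideal.mul_mem_left _ _ hb
      · exact Ideal.mul_mem_right _ _ (hJm n (by omega) ha)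
    · refine hF.cR n m a ha b ?_
      split_ifs at hb with hm
      · rw [hF.top m hm.le]; trivial
      · exact hb
  refine smul_ne_top _ _ (GSM J _ hG) MJ ?_ ?_ (AddMonoidAlgebra.single 0 1) ?_ ?_
  · intro w hw n
    dsimp only
    split_ifs with h
    · subst h; exact hF1 (hw 0)
    · exact hF.anti n (hw n)
  · intro p hp w hw
    rw [rees_smul_def]
    refine GS_mul (F := fun n => if n < 0 then ⊥ else if n = 0 then maximalIdeal R else J ^ n.toNat)
      (G := F) ?_ ?_ hw
    · intro i j a ha b hb
      split_ifs at ha with h1 h2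
      · rw [Ideal.mem_bot.mp ha, zero_mul]; exact zero_mem _
      · subst h2
        rw [zero_add]
        split_ifs
        · exact Ideal.mul_mem_right _ _ ha
        · exact Ideal.mul_mem_left _ _ hb
      · split_ifs
        · exact Ideal.mul_mem_right _ _ (hJm _ (by omega) ha)
        · have := hF.cR i.toNat j a ha b hb
          rwa [Int.toNat_of_nonneg (by omega)] at this
    · rw [toLaurent_mem_GS]
      intro n
      rw [if_neg (by omega)]
      split_ifs with h
      · obtain rfl : n = 0 := by omega
        exact (hMJ p).mp hp
      · exact p.2 n
  · apply single_mem_GS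
    rw [hF.top 0 le_rfl]; trivial
  · intro h
    have h1 := h 0
    rw [AddMonoidAlgebra.coeff_single, Finsupp.single_eq_same] at h1
    dsimp only at h1
    rw [if_pos rfl] at h1
    exact (Ideal.ne_top_iff_one _).mp (inferInstance : (maximalIdeal R).IsPrime).ne_top h1

/-- the Sally module as a quotient of graded modules -/
lemma sally_equiv (hF : Filt J F) (N₁ N₂ : Submodule (reesAlgebra J) (Polynomial R))
    (h₁ : ∀ p : Polynomial R, p ∈ N₁ ↔ (p.coeff 0 = 0 ∧ ∀ n : ℕ, 1 ≤ n → p.coeff n ∈ F (n + 1)))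
    (h₂ : ∀ p : Polynomial R, p ∈ N₂ ↔ (p.coeff 0 = 0 ∧ ∀ n, 1 ≤ n → p.coeff n ∈ J ^ n * F 1)) :
    Nonempty (submoduleQuot N₁ N₂ ≃ₗ[reesAlgebra J]
      submoduleQuot (GSM J _ hF.cM) (GSM J (LF J (F 1)) (LF_mul hF.one))) := by
  have hLF : ∀ n : ℕ, LF J (F 1) n = J ^ n * F 1 := by
    intro n; rw [LF, if_pos (by omega), Int.toNat_natCast]
  refine quot_equiv N₁ N₂ _ _ (θL J) ?_ ?_ ?_
  · intro v hv
    obtain ⟨hv0, hv⟩ := (h₁ v).mp hv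
    refine (toLaurent_mem_GS v _).mpr ?_
    intro n
    by_cases hn : 1 ≤ n
    · exact hv n hn
    · obtain rfl : n = 0 := by omega
      rw [hv0]; exact zero_mem _
  · intro v hv
    obtain ⟨hv0, -⟩ := (h₁ v).mp hv
    rw [h₂]
    refine (toLaurent_mem_GS v _).trans ?_
    constructor
    · intro h
      refine ⟨hv0, fun n _ => ?_⟩
      have := h n
      rwa [hLF] at this
    · rintro ⟨-, h⟩ n
      rw [hLF]
      by_cases hn : 1 ≤ n
      · exact h n hn
      · obtain rfl : n = 0 := by omega
        rw [hv0]; exact zero_mem _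
  · intro w hw
    obtain ⟨p, hp0, hp⟩ := exists_trunc w 1
    refine ⟨p, (h₁ p).mpr ⟨hp0 0 (by omega), fun n hn => ?_⟩, ?_⟩
    · rw [hp n hn]; exact hw n
    · intro n
      change (w - toLaurent p).coeff n ∈ _
      rw [AddMonoidAlgebra.coeff_sub, Finsupp.sub_apply]
      by_cases hn : n < 0
      · rw [LF, if_neg (by omega)]; trivial
      · obtain ⟨k, rfl⟩ : ∃ k : ℕ, n = k := ⟨n.toNat, by omega⟩
        rw [toLaurent_coeff]
        by_cases hk : 1 ≤ k
        · rw [hp k hk, sub_self]; exact zero_mem _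
        · obtain rfl : k = 0 := by omega
          rw [hp0 0 (by omega), sub_zero, hLF, pow_zero, one_mul]
          have := hw 0
          simpa using this

lemma regular_transfer' {Λ A W : Type*} [CommRing Λ] [CommRing A] [AddCommGroup W] [Module Λ W]
    (Rm Mm : Submodule Λ W) (K : Ideal A) (θ : A →+ W) (hR : ∀ a, θ a ∈ Rm)
    (hs : ∀ w ∈ Rm, ∃ a, w - θ a ∈ Mm) (hk : ∀ a, θ a ∈ Mm ↔ a ∈ K)
    (i : Λ → A) (hi : ∀ l a, θ (i l * a) = l • θ a) (rs : List Λ)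
    (h : IsRegular (submoduleQuot Rm Mm) rs) :
    IsRegular (A ⧸ K) (rs.map (fun l => Ideal.Quotient.mk K (i l))) := by
  let θ₀ : A →+ Rm :=
    { toFun := fun a => ⟨θ a, hR a⟩
      map_zero' := Subtype.ext (map_zero θ)
      map_add' := fun a b => Subtype.ext (map_add θ _ _) }
  let θ₁ : A →+ submoduleQuot Rm Mm := (Submodule.mkQ (Mm.comap Rm.subtype)).toAddMonoidHom.comp θ₀
  refine regular_transfer K θ₁ ?_ ?_ i ?_ rs h
  · intro q
    obtain ⟨⟨w, hw⟩, rfl⟩ := Submodule.mkQ_surjective _ q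
    obtain ⟨a, ha⟩ := hs w hw
    refine ⟨a, ?_⟩
    symm
    change Submodule.Quotient.mk _ = Submodule.Quotient.mk _
    rw [Submodule.Quotient.eq]
    exact ha
  · intro a
    change Submodule.Quotient.mk _ = _ ↔ _
    rw [Submodule.Quotient.mk_eq_zero, ← hk]
    rfl
  · intro l a
    change Submodule.Quotient.mk _ = _ • Submodule.Quotient.mk _
    rw [← Submodule.Quotient.mk_smul]
    congr 1
    exact Subtype.ext (hi l a)

lemma agr_transfer (hF : Filt J F) (A : Subalgebra R (Polynomial R))
    (hA : ∀ p : Polynomial R, p ∈ A ↔ ∀ n : ℕ, p.coeff n ∈ F n)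
    (K : Ideal A) (hK : ∀ p : A, p ∈ K ↔ ∀ n : ℕ, (p : Polynomial R).coeff n ∈ F (n + 1))
    (rs : List (reesAlgebra J))
    (h : IsRegular (submoduleQuot (GSM J F hF.cR) (GSM J _ hF.cM)) rs) :
    ∃ i : reesAlgebra J → A, (∀ l, (i l : R[X]) = l) ∧
      IsRegular (A ⧸ K) (rs.map (fun l => Ideal.Quotient.mk K (i l))) := by
  have hi : ∀ l : reesAlgebra J, (l : R[X]) ∈ A := fun l => (hA _).mpr fun n => hF.pow n (l.2 n)
  let i : reesAlgebra J → A := fun l => ⟨l, hi l⟩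
  refine ⟨i, fun _ => rfl, ?_⟩
  refine regular_transfer' _ _ K
    ((toLaurent : R[X] →+* R[T;T⁻¹]).toAddMonoidHom.comp A.val.toRingHom.toAddMonoidHom) ?_ ?_ ?_ i ?_ rs h
  · intro a
    exact (toLaurent_mem_GS _ _).mpr ((hA _).mp a.2)
  · intro w hw
    obtain ⟨p, -, hp⟩ := exists_trunc w 0
    refine ⟨⟨p, (hA p).mpr fun n => by rw [hp n (by omega)]; exact hw n⟩, ?_⟩
    intro n
    change (w - toLaurent p).coeff n ∈ F (n + 1)
    rw [AddMonoidAlgebra.coeff_sub, Finsupp.sub_apply]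
    by_cases hn : n < 0
    · rw [hF.top (n + 1) (by omega)]; trivial
    · obtain ⟨k, rfl⟩ : ∃ k : ℕ, n = k := ⟨n.toNat, by omega⟩
      rw [toLaurent_coeff, hp k (by omega), sub_self]; exact zero_mem _
  · intro a
    rw [hK]
    exact toLaurent_mem_GS _ _
  · intro l a
    exact (θL J).map_smul l (a : R[X])

end Z5
end SallyAux

namespace SallyAux
section Z6
open RingTheory.Sequence Module
open scoped LaurentPolynomial Pointwise
universe u
variable {R : Type u} [CommRing R] {J : Ideal R} {F : ℤ → Ideal R}

lemma sally_length [IsNoetherianRing R] [IsLocalRing R] {d : ℕ} (x : Fin d → R)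
    (hJ : J = Ideal.span (Set.range x))
    (hF : Filt J F) (hrad : J.radical = maximalIdeal R)
    (N₁ N₂ : Submodule (reesAlgebra J) (Polynomial R))
    (h₁ : ∀ p : Polynomial R, p ∈ N₁ ↔ (p.coeff 0 = 0 ∧ ∀ n : ℕ, 1 ≤ n → p.coeff n ∈ F (n + 1)))
    (h₂ : ∀ p : Polynomial R, p ∈ N₂ ↔ (p.coeff 0 = 0 ∧ ∀ n, 1 ≤ n → p.coeff n ∈ J ^ n * F 1))
    (rs : List (reesAlgebra J)) (h : IsRegular (submoduleQuot N₁ N₂) rs) : rs.length ≤ d := by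
  obtain ⟨k, hk⟩ : ∃ k, maximalIdeal R ^ k ≤ J := by
    rw [← hrad]
    exact Ideal.exists_radical_pow_le_of_fg J (IsNoetherian.noetherian _)
  refine length_le_of_torsion (reesφ x hJ) (reesφ_surj x hJ) ?_ rs h
  intro z
  obtain ⟨⟨z, hz⟩, rfl⟩ := Submodule.Quotient.mk_surjective _ z
  refine ⟨k * (z.natDegree + 1), fun a ha => ?_⟩
  have ha' : a ∈ J ^ (z.natDegree + 1) := by
    rw [pow_mul] at ha
    exact Ideal.pow_right_mono hk _ ha
  rw [← Submodule.Quotient.mk_smul, Submodule.Quotient.mk_eq_zero]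
  change algebraMap R (reesAlgebra J) a • z ∈ N₂
  have e : algebraMap R (reesAlgebra J) a • z = Polynomial.C a * z := rfl
  rw [e, h₂]
  obtain ⟨hz0, -⟩ := (h₁ z).mp hz
  refine ⟨by rw [Polynomial.coeff_C_mul, hz0, mul_zero], fun n hn => ?_⟩
  rw [Polynomial.coeff_C_mul]
  by_cases hd : n ≤ z.natDegree
  · apply Ideal.mul_mem_right
    have h3 : J ^ (z.natDegree + 1) ≤ J ^ (n + 1) := Ideal.pow_le_pow_right (by omega)
    rw [pow_succ J n] at h3
    exact Ideal.mul_mono_right hF.one (h3 ha')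
  · rw [Polynomial.coeff_eq_zero_of_natDegree_lt (by omega), mul_zero]; exact zero_mem _

theorem main_core [IsNoetherianRing R] [IsLocalRing R] {d : ℕ} (x : Fin d → R)
    (hJ : J = Ideal.span (Set.range x)) (hx : WReg x)
    (hF : Filt J F) (hrad : J.radical = maximalIdeal R) (hF1 : F 1 ≤ maximalIdeal R)
    (hInt : ∀ w : R[T;T⁻¹], IsIntegral (exR J) w ↔ w ∈ GS F)
    (N₁ N₂ : Submodule (reesAlgebra J) (Polynomial R))
    (h₁ : ∀ p : Polynomial R, p ∈ N₁ ↔ (p.coeff 0 = 0 ∧ ∀ n : ℕ, 1 ≤ n → p.coeff n ∈ F (n + 1)))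
    (h₂ : ∀ p : Polynomial R, p ∈ N₂ ↔ (p.coeff 0 = 0 ∧ ∀ n, 1 ≤ n → p.coeff n ∈ J ^ n * F 1))
    (MJ : Ideal (reesAlgebra J))
    (hMJ : ∀ p : reesAlgebra J, p ∈ MJ ↔ (p : Polynomial R).coeff 0 ∈ maximalIdeal R)
    (rs : List (reesAlgebra J)) (hrs : ∀ r ∈ rs, r ∈ MJ)
    (h : IsRegular (submoduleQuot N₁ N₂) rs) (n : ℕ) (hn : n + 1 = rs.length) :
    ∃ ts : List (reesAlgebra J), ts.length = n ∧ (∀ r ∈ ts, r ∈ MJ) ∧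
      IsRegular (submoduleQuot (GSM J F hF.cR) (GSM J _ hF.cM)) ts := by
  have hlen := sally_length x hJ hF hrad N₁ N₂ h₁ h₂ rs h
  obtain ⟨e⟩ := sally_equiv hF N₁ N₂ h₁ h₂
  have hw := (e.isRegular_congr rs).mp h
  have hJt : J ≠ ⊤ := by
    intro h
    rw [h, Ideal.radical_top] at hrad
    exact (inferInstance : (maximalIdeal R).IsPrime).ne_top hrad.symm
  refine reg_core _ _ _ hF.L_le hF.M_le hF.e MJ (finite_R x hJ hx hrad hF hInt)
    (R_ne_top hF hF1 MJ hMJ) (List.ofFn (reesT x hJ)) rs ?_ hrs (L_weaklyRegular x hJ hx hJt hF.one)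
    hw.toIsWeaklyRegular (by rw [List.length_ofFn]; exact hlen) n hn
  intro r hr
  obtain ⟨i, rfl⟩ := List.mem_ofFn.mp hr
  rw [hMJ]
  have : (reesT x hJ i : R[X]) = Polynomial.monomial 1 (x i) := rfl
  rw [this, Polynomial.coeff_monomial, if_neg (by omega)]
  exact zero_mem _

end Z6
end SallyAux

theorem depth_agr_ge_depth_sally_sub_one
    (R : Type*) [CommRing R] [IsLocalRing R] [IsNoetherianRing R]
    (d : ℕ) (hd : 0 < d) (hdim : ringKrullDim R = d)
    (hCM : IsCMLocal R) (hAU : AnalyticallyUnramified R)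
    (hres : Infinite (ResidueField R))
    (I J : Ideal R) (hI : IsMPrimary I) (hJ : IsMinimalReduction d J I)
    -- the Sally module of the normal filtration
    (N₁ N₂ : Submodule (reesAlgebra J) (Polynomial R))
    (h₁ : ∀ p : Polynomial R, p ∈ N₁ ↔
      (p.coeff 0 = 0 ∧ ∀ n, 1 ≤ n → p.coeff n ∈ intCl (I ^ (n + 1))))
    (h₂ : ∀ p : Polynomial R, p ∈ N₂ ↔
      (p.coeff 0 = 0 ∧ ∀ n, 1 ≤ n → p.coeff n ∈ J ^ n * intCl I))
    (hnz : Nontrivial (submoduleQuot N₁ N₂))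
    -- the maximal homogeneous ideal of the Rees algebra of `J`
    (MJ : Ideal (reesAlgebra J))
    (hMJ : ∀ p : reesAlgebra J, p ∈ MJ ↔ (p : Polynomial R).coeff 0 ∈ maximalIdeal R)
    -- the Rees algebra of the normal filtration and its associated graded ring
    (A : Subalgebra R (Polynomial R))
    (hA : ∀ p : Polynomial R, p ∈ A ↔ ∀ n, p.coeff n ∈ intCl (I ^ n))
    (K : Ideal A)
    (hK : ∀ p : A, p ∈ K ↔ ∀ n, (p : Polynomial R).coeff n ∈ intCl (I ^ (n + 1)))
    (MG : Ideal A)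
    (hMG : ∀ p : A, p ∈ MG ↔ (p : Polynomial R).coeff 0 ∈ maximalIdeal R) :
    -- depth Ḡ ≥ depth S̄ − 1
    rdepth (reesAlgebra J) MJ (submoduleQuot N₁ N₂) ≤
      rdepth (A ⧸ K) (MG.map (Ideal.Quotient.mk K)) (A ⧸ K) + 1 := by
  obtain ⟨hJI, ⟨s, hJs⟩, N, hN⟩ := hJ
  have hN' : ∀ i, I ^ (N + i) ≤ J ^ i := by
    intro i
    induction i with
    | zero => rw [pow_zero, Ideal.one_eq_top]; exact le_top
    | succ i ih =>
      rw [← add_assoc, hN (N + i) (by omega), pow_succ']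
      exact Ideal.mul_mono_right ih
  have hrad : J.radical = maximalIdeal R := by
    unfold IsMPrimary at hI
    apply le_antisymm
    · rw [← hI]; exact Ideal.radical_mono hJI
    · rw [← hI, Ideal.radical_le_radical_iff]
      intro a ha
      refine ⟨N + 1, ?_⟩
      have := hN' 1 (Ideal.pow_mem_pow ha (N + 1))
      rwa [pow_one] at this
  have hIm : I ≤ maximalIdeal R := by
    rw [← hI]; exact Ideal.le_radical
  have hx : SallyAux.WReg s := SallyAux.wReg_of_list s
    (SallyAux.weaklyRegular_of_CM d hdim hCM s (by rw [← hJs]; exact hrad))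
  have hnoe : IsNoetherianRing (SallyAux.exR J) := SallyAux.exR_noeth s hJs
  have hF := SallyAux.filt_nF hJI hN'
  have e1 : ∀ n : ℕ, SallyAux.nF I (n + 1) = intCl (I ^ (n + 1)) := by
    intro n
    rw [SallyAux.nF]
    congr 2
  have e0 : ∀ n : ℕ, SallyAux.nF I n = intCl (I ^ n) := by
    intro n
    rw [SallyAux.nF, Int.toNat_natCast]
  have e2 : SallyAux.nF I 1 = intCl I := by
    have := e0 1
    rwa [pow_one, Nat.cast_one] at this
  refine sSup_le ?_
  rintro _ ⟨rs, rfl, hrs, hreg⟩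
  rcases Nat.eq_zero_or_pos rs.length with h0 | h0
  · rw [h0, Nat.cast_zero]; exact zero_le
  obtain ⟨n, hn⟩ : ∃ n, n + 1 = rs.length := ⟨rs.length - 1, by omega⟩
  obtain ⟨ts, hts, htsm, htsr⟩ := SallyAux.main_core s hJs hx hF hrad
    (by rw [e2]; exact SallyAux.intCl_le_max hIm)
    (fun w => SallyAux.isIntegral_iff_GS hJI hN') N₁ N₂
    (by intro p; simp only [e1]; exact h₁ p) (by intro p; rw [e2]; exact h₂ p) MJ hMJ rs hrs hreg n hn
  obtain ⟨i, hi, hir⟩ := SallyAux.agr_transfer hF A (by intro p; simp only [e0]; exact hA p) K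
    (by intro p; simp only [e1]; exact hK p) ts htsr
  rw [← hn, Nat.cast_add, Nat.cast_one]
  gcongr
  refine le_sSup ⟨_, ?_, ?_, hir⟩
  · rw [List.length_map, hts]
  · intro y hy
    obtain ⟨l, hl, rfl⟩ := List.mem_map.mp hy
    refine Ideal.mem_map_of_mem _ ?_
    rw [hMG, hi]
    exact (hMJ l).mp (htsm l hl)
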